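/- arXiv:1705.11099 — 2 statements merged into one kernel-verified Lean document; each statement's English description precedes it below -/
import Mathlib

section
/- Let 0 < r' < r. There exists a constant c > 0, depending only on r and r', such that for every continuously differentiable u : E' → ℝ³ on E' = {x ∈ ℝ³ : |x| > r', x₃ < 0} with ∫_{E'} |u|²/(1+|x|²) dx < ∞ and ∫_{E'} |∇u|² dx < ∞, one has ∫_{{|x| > r} ∩ ℝ³₋} |∇u(x)|² dx ≤ c² ∫_{{|x| > r'} ∩ ℝ³₋} |∇̂u(x)|² dx, where ∇̂u = (∇u + (∇u)ᵀ)/2. -/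
open MeasureTheory Metric Set

noncomputable section

abbrev E3 := EuclideanSpace ℝ (Fin 3)
abbrev E2 := EuclideanSpace ℝ (Fin 2)

/-- The open lower half-space `{x : x₃ < 0}`. -/
def lowerHalf : Set E3 := {x | x 2 < 0}

/-- The lower half-ball `B⁻_r(0) = {|x| < r, x₃ < 0}`. -/
def negBall (r : ℝ) : Set E3 := {x | ‖x‖ < r ∧ x 2 < 0}

/-- Jacobian matrix of a vector field: `(jac u x) i j = ∂uᵢ/∂xⱼ (x)`. -/
def jac (u : E3 → E3) (x : E3) : Matrix (Fin 3) (Fin 3) ℝ :=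
  fun i j => fderiv ℝ u x (EuclideanSpace.single j 1) i

/-- Symmetric part of the Jacobian (strain tensor) `∇̂u`. -/
def strain (u : E3 → E3) (x : E3) : Matrix (Fin 3) (Fin 3) ℝ :=
  fun i j => (jac u x i j + jac u x j i) / 2

/-- Squared Frobenius norm of a 3×3 matrix. -/
def frob2 (M : Matrix (Fin 3) (Fin 3) ℝ) : ℝ := ∑ i, ∑ j, (M i j)^2

/-- Divergence of a vector field. -/
def divg (u : E3 → E3) (x : E3) : ℝ := ∑ i, jac u x i i

/-- Projection on the first two coordinates. -/
def proj12 (x : E3) : E2 :=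
  (x 0) • EuclideanSpace.single 0 1 + (x 1) • EuclideanSpace.single 1 1

/-- Embedding of the plane `{x₃ = 0}` into `ℝ³`: `x' ↦ (x'₁, x'₂, 0)`. -/
def emb2 (x' : E2) : E3 :=
  (x' 0) • EuclideanSpace.single 0 1 + (x' 1) • EuclideanSpace.single 1 1

/-- Partial derivative of a scalar field in the k-th coordinate direction. -/
def pd (f : E3 → ℝ) (k : Fin 3) (x : E3) : ℝ := fderiv ℝ f x (EuclideanSpace.single k 1)


lemma diffq_bound {f : E3 → ℝ} {C : NNReal} (hf : LipschitzWith C f) (s : ℝ) (v x : E3) :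
    |s⁻¹ * (f (x + s • v) - f x)| ≤ C * ‖v‖ := by
  rcases eq_or_ne s 0 with rfl | hs
  · simp; positivity
  have h := hf.dist_le_mul (x + s • v) x
  rw [Real.dist_eq, dist_eq_norm, add_sub_cancel_left, norm_smul] at h
  rw [abs_mul, abs_inv]
  have hs' : 0 < |s| := abs_pos.mpr hs
  rw [inv_mul_le_iff₀ hs']
  calc _ ≤ _ := h
    _ = _ := by rw [Real.norm_eq_abs]; ring

lemma diffq_tendsto {f g : E3 → ℝ} {C D : NNReal} (hf : LipschitzWith C f)
    (hg : LipschitzWith D g) (hfs : HasCompactSupport f) (v w : E3) :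
    Filter.Tendsto (fun s : ℝ => ∫ x, (s⁻¹ * (f (x + s • v) - f x)) * (s⁻¹ * (g (x + s • w) - g x)))
      (nhdsWithin 0 {0}ᶜ) (nhds (∫ x, fderiv ℝ f x v * fderiv ℝ g x w)) := by
  obtain ⟨R, hR⟩ := hfs.isCompact.isBounded.subset_closedBall (0 : E3)
  apply tendsto_integral_filter_of_dominated_convergence
    ((closedBall (0 : E3) (R + ‖v‖)).indicator (fun _ => (C * ‖v‖) * (D * ‖w‖)))
  · refine Filter.Eventually.of_forall fun s => Continuous.aestronglyMeasurable ?_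
    have := hf.continuous; have := hg.continuous
    fun_prop
  · have : ∀ᶠ s : ℝ in nhdsWithin 0 {0}ᶜ, |s| ≤ 1 := by
      apply nhdsWithin_le_nhds
      have : closedBall (0:ℝ) 1 ∈ nhds (0:ℝ) := closedBall_mem_nhds _ one_pos
      filter_upwards [this] with s hs
      simpa using hs
    filter_upwards [this] with s hs
    refine Filter.Eventually.of_forall fun x => ?_
    by_cases hx : x ∈ closedBall (0 : E3) (R + ‖v‖)
    · rw [indicator_of_mem hx, norm_mul]
      gcongr
      · exact diffq_bound hf s v x
      · exact diffq_bound hg s w x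
    · rw [indicator_of_notMem hx]
      have hx' : R + ‖v‖ < ‖x‖ := by simpa using hx
      have hz : ∀ y : E3, R < ‖y‖ → f y = 0 := by
        intro y hy
        by_contra h
        have := hR (subset_tsupport f h)
        simp at this; linarith
      have h1 : f x = 0 := hz x (by have := norm_nonneg v; linarith)
      have h2 : f (x + s • v) = 0 := by
        apply hz
        have : ‖x‖ ≤ ‖x + s • v‖ + ‖s • v‖ := by
          simpa using norm_sub_le (x + s • v) (s • v)
        rw [norm_smul, Real.norm_eq_abs] at this
        have : |s| * ‖v‖ ≤ 1 * ‖v‖ := by gcongr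
        linarith
      simp [h1, h2]
  · exact (integrable_indicator_iff measurableSet_closedBall).2
      (integrableOn_const (measure_closedBall_lt_top.ne))
  · filter_upwards [hf.ae_differentiableAt, hg.ae_differentiableAt] with x h1 h2
    have a := (h1.hasFDerivAt.hasLineDerivAt v).tendsto_slope_zero
    have b := (h2.hasFDerivAt.hasLineDerivAt w).tendsto_slope_zero
    exact a.mul b

lemma diffq_swap {f g : E3 → ℝ} (hf : Continuous f)
    (hg : Continuous g) (hfs : HasCompactSupport f) (hgs : HasCompactSupport g) (v w : E3) (s : ℝ) :
    ∫ x, (s⁻¹ * (f (x + s • v) - f x)) * (s⁻¹ * (g (x + s • w) - g x)) =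
    ∫ x, ((-s)⁻¹ * (f (x + (-s) • w) - f x)) * ((-s)⁻¹ * (g (x + (-s) • v) - g x)) := by
  have hI : ∀ a b : E3, Integrable (fun x => f (x + a) * g (x + b)) := by
    intro a b
    apply Continuous.integrable_of_hasCompactSupport (by fun_prop)
    apply HasCompactSupport.mul_right
    exact hfs.comp_homeomorph (Homeomorph.addRight a)
  have hT : ∀ a b c : E3, ∫ x, f (x + a) * g (x + b) = ∫ x, f (x + (c + a)) * g (x + (c + b)) := by
    intro a b c
    rw [← integral_add_right_eq_self _ c]
    simp only [add_assoc]
  have key : ∀ (s : ℝ) (v w : E3),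
    ∫ x, (s⁻¹ * (f (x + s • v) - f x)) * (s⁻¹ * (g (x + s • w) - g x)) = s⁻¹ ^ 2 *
      ((∫ x, f (x + s • v) * g (x + s • w)) - (∫ x, f (x + s • v) * g (x + 0)) -
        (∫ x, f (x + 0) * g (x + s • w)) + ∫ x, f (x + 0) * g (x + 0)) := by
    intro s v w
    have i1 : Integrable (fun x => f (x + s • v) * g (x + s • w) - f (x + s • v) * g (x + 0)) :=
      (hI _ _).sub (hI _ _)
    have i2 : Integrable (fun x => f (x + s • v) * g (x + s • w) - f (x + s • v) * g (x + 0) -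
      f (x + 0) * g (x + s • w)) := i1.sub (hI _ _)
    rw [← integral_sub (hI _ _) (hI _ _), ← integral_sub i1 (hI _ _),
      ← integral_add i2 (hI _ _), ← integral_const_mul]
    congr 1
    ext x
    simp only [add_zero]
    ring
  rw [key, key]
  rw [hT (-s • w) (-s • v) (s • v + s • w), hT (-s • w) 0 (s • w), hT 0 (-s • v) (s • v)]
  have e1 : s • v + s • w + -s • w = s • v := by module
  have e2 : s • v + s • w + -s • v = s • w := by module
  have e3 : s • w + -s • w = (0 : E3) := by module
  have e4 : s • v + -s • v = (0 : E3) := by module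
  rw [e1, e2, e3, e4, add_zero, add_zero, inv_neg]
  ring

lemma fderiv_swap {f g : E3 → ℝ} {C D : NNReal} (hf : LipschitzWith C f)
    (hg : LipschitzWith D g) (hfs : HasCompactSupport f) (hgs : HasCompactSupport g) (v w : E3) :
    ∫ x, fderiv ℝ f x v * fderiv ℝ g x w = ∫ x, fderiv ℝ f x w * fderiv ℝ g x v := by
  have h1 := diffq_tendsto hf hg hfs v w
  have h2 := diffq_tendsto hf hg hfs w v
  have hneg : Filter.Tendsto (fun s : ℝ => -s) (nhdsWithin 0 {0}ᶜ) (nhdsWithin 0 {0}ᶜ) := by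
    apply tendsto_nhdsWithin_iff.2 ⟨?_, ?_⟩
    · have : Filter.Tendsto (fun s : ℝ => -s) (nhds 0) (nhds (-0)) := (continuous_neg.tendsto 0)
      rw [neg_zero] at this
      exact this.mono_left nhdsWithin_le_nhds
    · filter_upwards [self_mem_nhdsWithin] with s hs
      simpa using hs
  have h3 := h2.comp hneg
  refine tendsto_nhds_unique h1 (h3.congr fun s => ?_)
  simp only [Function.comp]
  exact (diffq_swap hf.continuous hg.continuous hfs hgs v w s).symm

lemma frob2_nonneg (M : Matrix (Fin 3) (Fin 3) ℝ) : 0 ≤ frob2 M := by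
  unfold frob2; positivity

lemma measurable_jac (u : E3 → E3) (i j : Fin 3) : Measurable (fun x => jac u x i j) := by
  unfold jac
  have := measurable_fderiv_apply_const ℝ u (EuclideanSpace.single j 1)
  fun_prop

lemma measurable_frob_jac (u : E3 → E3) : Measurable (fun x => frob2 (jac u x)) := by
  unfold frob2
  have := measurable_jac u
  fun_prop

lemma measurable_frob_strain (u : E3 → E3) : Measurable (fun x => frob2 (strain u x)) := by
  unfold frob2 strain
  have := measurable_jac u
  fun_prop

lemma jac_comp {u : E3 → E3} {x : E3} (h : DifferentiableAt ℝ u x) (i j : Fin 3) :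
    jac u x i j = fderiv ℝ (fun y => u y i) x (EuclideanSpace.single j 1) := by
  have h1 : HasFDerivAt (fun y => u y i) ((EuclideanSpace.proj i : E3 →L[ℝ] ℝ).comp (fderiv ℝ u x)) x :=
    (EuclideanSpace.proj i : E3 →L[ℝ] ℝ).hasFDerivAt.comp x h.hasFDerivAt
  rw [h1.fderiv]; rfl

lemma frob2_strain_eq (u : E3 → E3) (x : E3) :
    2 * frob2 (strain u x) = frob2 (jac u x) + ∑ i, ∑ j, jac u x i j * jac u x j i := by
  simp only [frob2, strain, Fin.sum_univ_three]; ring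

lemma frob2_strain_le (u : E3 → E3) (x : E3) : frob2 (strain u x) ≤ frob2 (jac u x) := by
  simp only [frob2, strain, Fin.sum_univ_three]
  nlinarith [sq_nonneg (jac u x 0 1 - jac u x 1 0), sq_nonneg (jac u x 0 2 - jac u x 2 0),
    sq_nonneg (jac u x 1 2 - jac u x 2 1)]

lemma korn_whole {V : E3 → E3} {C : NNReal} (hV : LipschitzWith C V) (hs : HasCompactSupport V) :
    Integrable (fun x => frob2 (jac V x)) ∧ Integrable (fun x => frob2 (strain V x)) ∧
    ∫ x, frob2 (jac V x) ≤ 2 * ∫ x, frob2 (strain V x) := by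
  have hL : ∀ i, LipschitzWith C (fun x => V x i) := by
    intro i
    have : LipschitzWith 1 (fun x : E3 => x i) := by
      apply LipschitzWith.of_dist_le_mul
      intro x y
      rw [dist_eq_norm, dist_eq_norm, NNReal.coe_one, one_mul]
      exact PiLp.norm_apply_le (x - y) i
    have h2 := this.comp hV
    rw [one_mul] at h2
    exact h2
  have hS : ∀ i, HasCompactSupport (fun x => V x i) := by
    intro i
    exact hs.comp_left (g := fun x : E3 => x i) rfl
  have hB : ∀ x i j, |jac V x i j| ≤ C := by
    intro x i j
    calc |jac V x i j| ≤ ‖fderiv ℝ V x (EuclideanSpace.single j 1)‖ :=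
          PiLp.norm_apply_le (fderiv ℝ V x (EuclideanSpace.single j 1)) i
      _ ≤ ‖fderiv ℝ V x‖ * ‖(EuclideanSpace.single j 1 : E3)‖ := ContinuousLinearMap.le_opNorm _ _
      _ ≤ C * 1 := by
        gcongr
        · exact norm_fderiv_le_of_lipschitz ℝ hV
        · simp
      _ = C := mul_one _
  have hI : ∀ i j k l, Integrable (fun x => jac V x i j * jac V x k l) := by
    intro i j k l
    have h0 : IntegrableOn (fun x => jac V x i j * jac V x k l) (tsupport V) := by
      apply Measure.integrableOn_of_bounded (M := C * C) hs.isCompact.measure_lt_top.ne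
      · exact ((measurable_jac V i j).mul (measurable_jac V k l)).aestronglyMeasurable
      · refine Filter.Eventually.of_forall fun x => ?_
        rw [norm_mul]
        gcongr
        · exact hB x i j
        · exact hB x k l
    rwa [integrableOn_iff_integrable_of_support_subset] at h0
    intro x hx
    by_contra hx'
    apply hx
    have : fderiv ℝ V x = 0 := by
      by_contra h
      exact hx' (support_fderiv_subset ℝ h)
    simp [jac, this]
  have hj : Integrable (fun x => frob2 (jac V x)) := by
    unfold frob2
    refine integrable_finsetSum _ fun i _ => integrable_finsetSum _ fun j _ => ?_
    simpa only [sq] using hI i j i j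
  have hst : Integrable (fun x => frob2 (strain V x)) := by
    refine hj.mono (measurable_frob_strain V).aestronglyMeasurable ?_
    refine Filter.Eventually.of_forall fun x => ?_
    rw [Real.norm_of_nonneg (frob2_nonneg _), Real.norm_of_nonneg (frob2_nonneg _)]
    exact frob2_strain_le V x
  refine ⟨hj, hst, ?_⟩
  have hswap : ∀ i j, ∫ x, jac V x i j * jac V x j i = ∫ x, jac V x i i * jac V x j j := by
    intro i j
    have := fderiv_swap (hL i) (hL j) (hS i) (hS j) (EuclideanSpace.single j 1)
      (EuclideanSpace.single i 1)
    have hae := hV.ae_differentiableAt (μ := volume)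
    calc _ = _ := integral_congr_ae (by
            filter_upwards [hae] with x hx
            rw [jac_comp hx, jac_comp hx])
      _ = _ := this
      _ = _ := integral_congr_ae (by
            filter_upwards [hae] with x hx
            rw [jac_comp hx, jac_comp hx])
  have hdiv : 0 ≤ ∑ i, ∑ j, ∫ x, jac V x i j * jac V x j i := by
    simp only [hswap]
    have : ∑ i, ∑ j, ∫ x, jac V x i i * jac V x j j = ∫ x, (∑ i, jac V x i i) ^ 2 := by
      simp only [sq, Finset.sum_mul_sum]
      rw [integral_finsetSum _ fun i _ => integrable_finsetSum _ fun j _ => hI _ _ _ _]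
      refine Finset.sum_congr rfl fun i _ => ?_
      rw [integral_finsetSum _ fun j _ => hI _ _ _ _]
    rw [this]
    exact integral_nonneg fun x => sq_nonneg _
  rw [← integral_const_mul]
  simp only [frob2_strain_eq]
  rw [integral_add hj (integrable_finsetSum _ fun i _ => integrable_finsetSum _ fun j _ => hI _ _ _ _),
    integral_finsetSum _ fun i _ => integrable_finsetSum _ fun j _ => hI _ _ _ _]
  simp only [integral_finsetSum _ fun j _ => hI _ _ _ _]
  linarith

def Lam (l : ℝ) : E3 →L[ℝ] E3 :=
  ContinuousLinearMap.id ℝ E3 -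
    (1 + l) • (EuclideanSpace.proj (2 : Fin 3) : E3 →L[ℝ] ℝ).smulRight (EuclideanSpace.single 2 1)

def dcoef (l : ℝ) (i : Fin 3) : ℝ := if i = 2 then -l else 1

lemma Lam_apply (l : ℝ) (x : E3) (i : Fin 3) : Lam l x i = dcoef l i * x i := by
  fin_cases i <;> simp [Lam, dcoef] <;> ring

lemma Lam_single (l : ℝ) (j : Fin 3) :
    Lam l (EuclideanSpace.single j 1) = dcoef l j • EuclideanSpace.single j 1 := by
  ext i
  rw [Lam_apply]
  by_cases h : i = j
  · subst h; simp
  · simp [h]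

lemma Lam_det (l : ℝ) (hl : l ≠ 0) : LinearMap.det (Lam l : E3 →ₗ[ℝ] E3) ≠ 0 := by
  have h : (Lam l : E3 →ₗ[ℝ] E3) ∘ₗ (Lam l⁻¹ : E3 →ₗ[ℝ] E3) = LinearMap.id := by
    ext x i
    simp only [LinearMap.comp_apply, ContinuousLinearMap.coe_coe, Lam_apply, LinearMap.id_apply]
    rw [← mul_assoc]
    have : dcoef l i * dcoef l⁻¹ i = 1 := by
      unfold dcoef; split_ifs
      · field_simp
      · simp
    rw [this, one_mul]
  have := congrArg LinearMap.det h
  rw [LinearMap.det_comp, LinearMap.det_id] at this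
  exact left_ne_zero_of_mul_eq_one this

lemma lintegral_Lam (l : ℝ) (hl : 0 < l) : ∃ c : ENNReal, c ≠ ⊤ ∧ ∀ F : E3 → ENNReal, Measurable F →
    ∫⁻ x in {x : E3 | 0 < x 2}, F (Lam l x) = c * ∫⁻ x in lowerHalf, F x := by
  refine ⟨ENNReal.ofReal |(LinearMap.det (Lam l : E3 →ₗ[ℝ] E3))⁻¹|, ENNReal.ofReal_ne_top, ?_⟩
  intro F hF
  have hm := Measure.map_linearMap_addHaar_eq_smul_addHaar (volume : Measure E3) (Lam_det l hl.ne')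
  have hlow : MeasurableSet lowerHalf := by
    unfold lowerHalf
    exact measurableSet_lt (by fun_prop) measurable_const
  have h2 : ∫⁻ x in lowerHalf, F x ∂(Measure.map (Lam l : E3 →ₗ[ℝ] E3) volume) =
      ∫⁻ x in (Lam l) ⁻¹' lowerHalf, F (Lam l x) :=
    setLIntegral_map hlow hF (Lam l).continuous.measurable
  rw [hm, Measure.restrict_smul, lintegral_smul_measure] at h2
  have h3 : (Lam l) ⁻¹' lowerHalf = {x : E3 | 0 < x 2} := by
    ext x
    simp only [lowerHalf, mem_preimage, mem_ofPred_eq, Lam_apply, dcoef, if_true]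
    constructor
    · intro h; by_contra h'; nlinarith
    · intro h; nlinarith
  rw [h3] at h2
  exact h2.symm

def Wl (l : ℝ) (v : E3 → E3) (x : E3) : E3 := Lam l (v (Lam l x))

lemma jac_Wl (l : ℝ) {v : E3 → E3} (hv : Differentiable ℝ v) (x : E3) (i j : Fin 3) :
    jac (Wl l v) x i j = dcoef l i * dcoef l j * jac v (Lam l x) i j := by
  have h : HasFDerivAt (Wl l v) ((Lam l).comp ((fderiv ℝ v (Lam l x)).comp (Lam l))) x :=
    (Lam l).hasFDerivAt.comp x ((hv _).hasFDerivAt.comp x (Lam l).hasFDerivAt)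
  unfold jac
  rw [h.fderiv]
  simp only [ContinuousLinearMap.comp_apply, Lam_single, map_smul, Lam_apply, PiLp.smul_apply,
    smul_eq_mul]
  ring

def Wt (v : E3 → E3) (x : E3) : E3 := (3 : ℝ) • Wl 1 v x - (2 : ℝ) • Wl 2 v x

lemma Wl_contDiff (l : ℝ) {v : E3 → E3} (hv : ContDiff ℝ 1 v) : ContDiff ℝ 1 (Wl l v) :=
  (Lam l).contDiff.comp (hv.comp (Lam l).contDiff)

lemma Wt_contDiff {v : E3 → E3} (hv : ContDiff ℝ 1 v) : ContDiff ℝ 1 (Wt v) :=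
  ((Wl_contDiff 1 hv).const_smul _).sub ((Wl_contDiff 2 hv).const_smul _)

lemma strain_Wt {v : E3 → E3} (hv : ContDiff ℝ 1 v) (x : E3) :
    frob2 (strain (Wt v) x) ≤ 18 * frob2 (strain v (Lam 1 x)) + 128 * frob2 (strain v (Lam 2 x)) := by
  have hd := hv.differentiable (by norm_num)
  have hj : ∀ i j, jac (Wt v) x i j = 3 * (dcoef 1 i * dcoef 1 j * jac v (Lam 1 x) i j) -
      2 * (dcoef 2 i * dcoef 2 j * jac v (Lam 2 x) i j) := by
    intro i j
    rw [← jac_Wl 1 hd, ← jac_Wl 2 hd]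
    have h1 := ((Wl_contDiff 1 hv).differentiable (by norm_num) x).hasFDerivAt.const_smul (3 : ℝ)
    have h2 := ((Wl_contDiff 2 hv).differentiable (by norm_num) x).hasFDerivAt.const_smul (2 : ℝ)
    have h3 : HasFDerivAt (Wt v) _ x := h1.sub h2
    unfold jac
    rw [h3.fderiv]
    simp
  have hs : ∀ i j, strain (Wt v) x i j = 3 * (dcoef 1 i * dcoef 1 j * strain v (Lam 1 x) i j) -
      2 * (dcoef 2 i * dcoef 2 j * strain v (Lam 2 x) i j) := by
    intro i j
    unfold strain
    rw [hj, hj]; ring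
  unfold frob2
  simp only [Finset.mul_sum, ← Finset.sum_add_distrib]
  refine Finset.sum_le_sum fun i _ => Finset.sum_le_sum fun j _ => ?_
  rw [hs]
  generalize strain v (Lam 1 x) i j = a
  generalize strain v (Lam 2 x) i j = b
  have h1 : (dcoef 1 i * dcoef 1 j) ^ 2 ≤ 1 := by
    unfold dcoef; split_ifs <;> norm_num
  have h2 : (dcoef 2 i * dcoef 2 j) ^ 2 ≤ 16 := by
    unfold dcoef; split_ifs <;> norm_num
  generalize dcoef 1 i * dcoef 1 j = p at *
  generalize dcoef 2 i * dcoef 2 j = q at *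
  have h3 : (p * a) ^ 2 ≤ a ^ 2 := by rw [mul_pow]; nlinarith [sq_nonneg a]
  have h4 : (q * b) ^ 2 ≤ 16 * b ^ 2 := by rw [mul_pow]; nlinarith [sq_nonneg b]
  nlinarith [sq_nonneg (3 * (p * a) + 2 * (q * b))]

lemma HasCompactSupport.of_norm {f : E3 → E3} (R : ℝ) (h : ∀ x, R < ‖x‖ → f x = 0) :
    HasCompactSupport f := by
  refine HasCompactSupport.intro (isCompact_closedBall (0 : E3) R) fun x hx => h x ?_
  simpa using hx

lemma exists_norm_of_hcs {f : E3 → E3} (h : HasCompactSupport f) :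
    ∃ R : ℝ, ∀ x, R < ‖x‖ → f x = 0 := by
  obtain ⟨R, hR⟩ := h.isCompact.isBounded.subset_closedBall (0 : E3)
  refine ⟨R, fun y hy => ?_⟩
  by_contra h
  have := hR (subset_tsupport f h)
  simp at this; linarith

lemma norm_le_Lam (l : ℝ) (hl : 1 ≤ l) (x : E3) : ‖x‖ ≤ ‖Lam l x‖ := by
  rw [EuclideanSpace.norm_eq, EuclideanSpace.norm_eq]
  apply Real.sqrt_le_sqrt
  refine Finset.sum_le_sum fun i _ => ?_
  rw [Lam_apply, norm_mul, mul_pow]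
  have : 1 ≤ ‖dcoef l i‖ ^ 2 := by
    unfold dcoef; split_ifs
    · simp; rw [abs_of_nonneg (by linarith)]; linarith
    · simp
  nlinarith [sq_nonneg ‖x i‖]

lemma Wt_zero {v : E3 → E3} {R : ℝ} (h : ∀ x, R < ‖x‖ → v x = 0) (x : E3) (hx : R < ‖x‖) :
    Wt v x = 0 := by
  have h1 := h (Lam 1 x) (hx.trans_le (norm_le_Lam 1 le_rfl x))
  have h2 := h (Lam 2 x) (hx.trans_le (norm_le_Lam 2 (by norm_num) x))
  simp [Wt, Wl, h1, h2]

lemma Wt_plane (v : E3 → E3) (x : E3) (hx : x 2 = 0) : Wt v x = v x := by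
  have h : ∀ l, Lam l x = x := by
    intro l; ext i; rw [Lam_apply]; unfold dcoef; split_ifs with h
    · subst h; simp [hx]
    · simp
  ext i
  simp only [Wt, Wl, h, PiLp.sub_apply, PiLp.smul_apply, Lam_apply, smul_eq_mul]
  unfold dcoef
  split_ifs <;> ring

open Classical in
def glue (v : E3 → E3) (x : E3) : E3 := if x 2 ≤ 0 then v x else Wt v x

def cutm (x : E3) : E3 := x - (max (x 2) 0) • EuclideanSpace.single 2 1
def cutM (x : E3) : E3 := x - (min (x 2) 0) • EuclideanSpace.single 2 1
def cutP (x : E3) : E3 := x - (x 2) • EuclideanSpace.single 2 1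

lemma glue_eq (v : E3 → E3) (x : E3) :
    glue v x = v (cutm x) + Wt v (cutM x) - Wt v (cutP x) := by
  unfold glue cutm cutM cutP
  split_ifs with h
  · simp [max_eq_right h, min_eq_left h]
  · have h' : 0 ≤ x 2 := by linarith
    rw [max_eq_left h', min_eq_right h']
    rw [Wt_plane v (x - x 2 • EuclideanSpace.single 2 1) (by simp)]
    simp

lemma lip_coord : LipschitzWith 1 (fun x : E3 => x 2) := by
  apply LipschitzWith.of_dist_le_mul
  intro x y
  rw [dist_eq_norm, dist_eq_norm, NNReal.coe_one, one_mul]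
  exact PiLp.norm_apply_le (x - y) 2

lemma lip_cut {g : ℝ → ℝ} (hg : ∀ a b, |g a - g b| ≤ |a - b|) (x y : E3) :
    dist (x - g (x 2) • (EuclideanSpace.single 2 1 : E3))
      (y - g (y 2) • (EuclideanSpace.single 2 1 : E3)) ≤ 2 * dist x y := by
  have h1 := lip_coord.dist_le_mul x y
  have h2 := hg (x 2) (y 2)
  rw [Real.dist_eq, NNReal.coe_one, one_mul] at h1
  rw [dist_eq_norm] at h1 ⊢
  have : x - g (x 2) • (EuclideanSpace.single 2 1 : E3) - (y - g (y 2) • EuclideanSpace.single 2 1)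
      = (x - y) - (g (x 2) - g (y 2)) • (EuclideanSpace.single 2 1 : E3) := by module
  rw [this]
  refine (norm_sub_le _ _).trans ?_
  rw [norm_smul, Real.norm_eq_abs, dist_eq_norm]
  simp only [EuclideanSpace.norm_single, norm_one, mul_one]
  linarith

lemma glue_lip {v : E3 → E3} (hv : ContDiff ℝ 1 v) (hs : HasCompactSupport v) :
    ∃ C, LipschitzWith C (glue v) := by
  obtain ⟨R, hR⟩ := exists_norm_of_hcs hs
  obtain ⟨C, hC⟩ := ContDiff.lipschitzWith_of_hasCompactSupport hs hv (by norm_num)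
  obtain ⟨D, hD⟩ := ContDiff.lipschitzWith_of_hasCompactSupport
    (HasCompactSupport.of_norm R (Wt_zero hR)) (Wt_contDiff hv) (by norm_num)
  refine ⟨C * 2 + D * 2 + D * 2, LipschitzWith.of_dist_le_mul fun x y => ?_⟩
  have hm : dist (cutm x) (cutm y) ≤ 2 * dist x y :=
    lip_cut (g := fun t => max t 0) (fun a b => abs_max_sub_max_le_abs a b 0) x y
  have hM : dist (cutM x) (cutM y) ≤ 2 * dist x y :=
    lip_cut (g := fun t => min t 0) (fun a b => abs_inf_sub_inf_le_abs a b 0) x y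
  have hP : dist (cutP x) (cutP y) ≤ 2 * dist x y :=
    lip_cut (g := fun t => t) (fun a b => le_rfl) x y
  rw [glue_eq, glue_eq]
  have h1 : dist (v (cutm x)) (v (cutm y)) ≤ C * (2 * dist x y) :=
    (hC.dist_le_mul _ _).trans (by gcongr)
  have h2 : dist (Wt v (cutM x)) (Wt v (cutM y)) ≤ D * (2 * dist x y) :=
    (hD.dist_le_mul _ _).trans (by gcongr)
  have h3 : dist (Wt v (cutP x)) (Wt v (cutP y)) ≤ D * (2 * dist x y) :=
    (hD.dist_le_mul _ _).trans (by gcongr)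
  have h4 := dist_sub_sub_le (v (cutm x) + Wt v (cutM x)) (Wt v (cutP x))
    (v (cutm y) + Wt v (cutM y)) (Wt v (cutP y))
  have h5 := dist_add_add_le (v (cutm x)) (Wt v (cutM x)) (v (cutm y)) (Wt v (cutM y))
  push_cast
  linarith

lemma jac_congr {u v : E3 → E3} {x : E3} (h : u =ᶠ[nhds x] v) : jac u x = jac v x := by
  unfold jac; rw [h.fderiv_eq]

lemma strain_congr {u v : E3 → E3} {x : E3} (h : u =ᶠ[nhds x] v) : strain u x = strain v x := by
  unfold strain; rw [jac_congr h]

lemma isOpen_lower : IsOpen lowerHalf := isOpen_lt (by fun_prop) continuous_const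

lemma isOpen_upper : IsOpen {x : E3 | 0 < x 2} := isOpen_lt continuous_const (by fun_prop)

lemma upper_ae : {x : E3 | 0 < x 2} =ᵐ[volume] lowerHalfᶜ := by
  have h0 : volume {x : E3 | x 2 = 0} = 0 := by
    have := Measure.addHaar_submodule (volume : Measure E3)
      (LinearMap.ker ((EuclideanSpace.proj (2 : Fin 3) : E3 →L[ℝ] ℝ) : E3 →ₗ[ℝ] ℝ)) (by
        intro h
        have : (EuclideanSpace.single 2 1 : E3) ∈ LinearMap.ker ((EuclideanSpace.proj (2 : Fin 3) : E3 →L[ℝ] ℝ) : E3 →ₗ[ℝ] ℝ) := by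
          rw [h]; trivial
        simp at this)
    exact this
  have h1 : ∀ᵐ x : E3, ¬ (x 2 = 0) := by
    rw [ae_iff]; simpa using h0
  filter_upwards [h1] with x hx
  apply propext
  show 0 < x 2 ↔ ¬ (x 2 < 0)
  constructor
  · intro h; linarith
  · intro h; exact lt_of_le_of_ne (not_lt.1 h) (Ne.symm hx)

lemma korn_half_smooth : ∃ K : ENNReal, K ≠ ⊤ ∧ ∀ v : E3 → E3, ContDiff ℝ 1 v → HasCompactSupport v →
    ∫⁻ x in lowerHalf, ENNReal.ofReal (frob2 (jac v x)) ≤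
      K * ∫⁻ x in lowerHalf, ENNReal.ofReal (frob2 (strain v x)) := by
  obtain ⟨c1, hc1, H1⟩ := lintegral_Lam 1 one_pos
  obtain ⟨c2, hc2, H2⟩ := lintegral_Lam 2 two_pos
  refine ⟨2 * (1 + (18 * c1 + 128 * c2)), ?_, ?_⟩
  · finiteness
  intro v hv hs
  obtain ⟨C, hC⟩ := glue_lip hv hs
  obtain ⟨R, hR⟩ := exists_norm_of_hcs hs
  have hgs : HasCompactSupport (glue v) := by
    refine HasCompactSupport.of_norm R fun x hx => ?_
    unfold glue
    split_ifs
    · exact hR x hx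
    · exact Wt_zero hR x hx
  obtain ⟨i1, i2, h⟩ := korn_whole hC hgs
  have hlow : ∀ x ∈ lowerHalf, glue v =ᶠ[nhds x] v := by
    intro x hx
    filter_upwards [isOpen_lower.mem_nhds hx] with y hy
    exact if_pos (le_of_lt hy)
  have hup : ∀ x ∈ {x : E3 | 0 < x 2}, glue v =ᶠ[nhds x] Wt v := by
    intro x hx
    filter_upwards [isOpen_upper.mem_nhds hx] with y hy
    exact if_neg (not_le.2 hy)
  have h' : ∫⁻ x, ENNReal.ofReal (frob2 (jac (glue v) x)) ≤
      2 * (∫⁻ x, ENNReal.ofReal (frob2 (strain (glue v) x))) := by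
    rw [← ofReal_integral_eq_lintegral_ofReal i1 (Filter.Eventually.of_forall fun x => frob2_nonneg _),
      ← ofReal_integral_eq_lintegral_ofReal i2 (Filter.Eventually.of_forall fun x => frob2_nonneg _)]
    refine (ENNReal.ofReal_le_ofReal h).trans ?_
    rw [ENNReal.ofReal_mul (by norm_num), ENNReal.ofReal_ofNat]
  have hmF : Measurable (fun x => ENNReal.ofReal (frob2 (strain v x))) :=
    (measurable_frob_strain v).ennreal_ofReal
  calc ∫⁻ x in lowerHalf, ENNReal.ofReal (frob2 (jac v x))
      = ∫⁻ x in lowerHalf, ENNReal.ofReal (frob2 (jac (glue v) x)) :=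
        setLIntegral_congr_fun isOpen_lower.measurableSet fun x hx => by
          simp only [jac_congr (hlow x hx)]
    _ ≤ ∫⁻ x, ENNReal.ofReal (frob2 (jac (glue v) x)) := setLIntegral_le_lintegral _ _
    _ ≤ _ := h'
    _ = 2 * ((∫⁻ x in lowerHalf, ENNReal.ofReal (frob2 (strain (glue v) x))) +
          ∫⁻ x in lowerHalfᶜ, ENNReal.ofReal (frob2 (strain (glue v) x))) := by
        rw [lintegral_add_compl _ isOpen_lower.measurableSet]
    _ = 2 * ((∫⁻ x in lowerHalf, ENNReal.ofReal (frob2 (strain v x))) +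
          ∫⁻ x in {x : E3 | 0 < x 2}, ENNReal.ofReal (frob2 (strain (Wt v) x))) := by
        congr 2
        · exact setLIntegral_congr_fun isOpen_lower.measurableSet fun x hx => by
            simp only [strain_congr (hlow x hx)]
        · refine (setLIntegral_congr upper_ae.symm).trans ?_
          exact setLIntegral_congr_fun isOpen_upper.measurableSet fun x hx => by
            simp only [strain_congr (hup x hx)]
    _ ≤ 2 * ((∫⁻ x in lowerHalf, ENNReal.ofReal (frob2 (strain v x))) +
          ∫⁻ x in {x : E3 | 0 < x 2}, (18 * ENNReal.ofReal (frob2 (strain v (Lam 1 x))) +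
            128 * ENNReal.ofReal (frob2 (strain v (Lam 2 x))))) := by
        gcongr with x
        refine (ENNReal.ofReal_le_ofReal (strain_Wt hv x)).trans ?_
        rw [ENNReal.ofReal_add
            (mul_nonneg (by norm_num) (frob2_nonneg _)) (mul_nonneg (by norm_num) (frob2_nonneg _)),
            ENNReal.ofReal_mul (by norm_num), ENNReal.ofReal_mul (by norm_num), ENNReal.ofReal_ofNat,
            ENNReal.ofReal_ofNat]
    _ = _ := by
        have m1 : Measurable (fun x => ENNReal.ofReal (frob2 (strain v (Lam 1 x)))) :=
          hmF.comp (Lam 1).continuous.measurable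
        have m2 : Measurable (fun x => ENNReal.ofReal (frob2 (strain v (Lam 2 x)))) :=
          hmF.comp (Lam 2).continuous.measurable
        rw [lintegral_add_left (m1.const_mul _), lintegral_const_mul _ m1, lintegral_const_mul _ m2,
          H1 _ hmF, H2 _ hmF]
        ring

lemma jac_comp_sub (w : E3 → E3) (a x : E3) : jac (fun y => w (y - a)) x = jac w (x - a) := by
  unfold jac
  rw [fderiv_comp_sub]

lemma strain_comp_sub (w : E3 → E3) (a x : E3) :
    strain (fun y => w (y - a)) x = strain w (x - a) := by
  unfold strain; rw [jac_comp_sub]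

lemma lintegral_shift (δ : ℝ) {F : E3 → ENNReal} (hF : Measurable F) :
    ∫⁻ x in lowerHalf, F (x - δ • EuclideanSpace.single 2 1) = ∫⁻ x in {x : E3 | x 2 < -δ}, F x := by
  have hs : MeasurableSet {x : E3 | x 2 < -δ} := measurableSet_lt (by fun_prop) measurable_const
  rw [← (measurePreserving_sub_right (volume : Measure E3)
    (δ • EuclideanSpace.single 2 1)).setLIntegral_comp_preimage hs hF]
  congr 2
  ext x
  simp only [lowerHalf, mem_preimage, mem_ofPred_eq, PiLp.sub_apply, PiLp.smul_apply,
    PiLp.single_eq_same, smul_eq_mul, mul_one]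
  constructor <;> intro h <;> linarith

lemma korn_half : ∃ K : ENNReal, K ≠ ⊤ ∧ ∀ (w : E3 → E3) (R : ℝ), ContDiffOn ℝ 1 w lowerHalf →
    (∀ x ∈ lowerHalf, R < ‖x‖ → w x = 0) →
    ∫⁻ x in lowerHalf, ENNReal.ofReal (frob2 (jac w x)) ≤
      K * ∫⁻ x in lowerHalf, ENNReal.ofReal (frob2 (strain w x)) := by
  obtain ⟨K, hK, H⟩ := korn_half_smooth
  refine ⟨K, hK, fun w R hw hR => ?_⟩
  have hmj : Measurable (fun x => ENNReal.ofReal (frob2 (jac w x))) :=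
    (measurable_frob_jac w).ennreal_ofReal
  have hms : Measurable (fun x => ENNReal.ofReal (frob2 (strain w x))) :=
    (measurable_frob_strain w).ennreal_ofReal
  have step : ∀ δ : ℝ, 0 < δ → ∫⁻ x in {x : E3 | x 2 < -δ}, ENNReal.ofReal (frob2 (jac w x)) ≤
      K * ∫⁻ x in lowerHalf, ENNReal.ofReal (frob2 (strain w x)) := by
    intro δ hδ
    set a : E3 := δ • EuclideanSpace.single 2 1 with ha
    have ha2 : a 2 = δ := by simp [ha]
    have han : ‖a‖ = δ := by simp [ha, norm_smul, abs_of_pos hδ]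
    let v : E3 → E3 := fun x => Real.smoothTransition (1 - 2 * x 2 / δ) • w (x - a)
    have hv : ContDiff ℝ 1 v := by
      rw [contDiff_iff_contDiffAt]
      intro x
      by_cases hx : x 2 < δ
      · have h1 : x - a ∈ lowerHalf := by simp [lowerHalf, ha2, hx]
        have h2 : ContDiffAt ℝ 1 w (x - a) := hw.contDiffAt (isOpen_lower.mem_nhds h1)
        have h3 : ContDiffAt ℝ 1 (fun y => w (y - a)) x :=
          ContDiffAt.comp x h2 (contDiffAt_id.sub contDiffAt_const)
        have h4 : ContDiff ℝ 1 (fun y : E3 => Real.smoothTransition (1 - 2 * y 2 / δ)) := by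
          have : ContDiff ℝ 1 (fun y : E3 => 1 - 2 * y 2 / δ) := by fun_prop
          exact (Real.smoothTransition.contDiff (n := 1)).comp this
        exact h4.contDiffAt.smul h3
      · have hU : IsOpen {y : E3 | δ / 2 < y 2} := isOpen_lt continuous_const (by fun_prop)
        have hxU : x ∈ {y : E3 | δ / 2 < y 2} := by
          show δ / 2 < x 2
          linarith
        have : v =ᶠ[nhds x] fun _ => 0 := by
          filter_upwards [hU.mem_nhds hxU] with y hy
          have hy' : δ / 2 < y 2 := hy
          have : 1 - 2 * y 2 / δ ≤ 0 := by
            rw [sub_nonpos, le_div_iff₀ hδ]; linarith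
          simp [v, Real.smoothTransition.zero_of_nonpos this]
        exact contDiffAt_const.congr_of_eventuallyEq this
    have hvs : HasCompactSupport v := by
      apply HasCompactSupport.of_norm (R + δ)
      intro x hx
      by_cases hx2 : x 2 < δ
      · have h1 : x - a ∈ lowerHalf := by simp [lowerHalf, ha2, hx2]
        have : w (x - a) = 0 := by
          apply hR _ h1
          have := norm_sub_norm_le x a
          linarith
        simp [v, this]
      · have : 1 - 2 * x 2 / δ ≤ 0 := by
            rw [sub_nonpos, le_div_iff₀ hδ]; linarith
        simp [v, Real.smoothTransition.zero_of_nonpos this]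
    have hloc : ∀ x ∈ lowerHalf, v =ᶠ[nhds x] fun y => w (y - a) := by
      intro x hx
      filter_upwards [isOpen_lower.mem_nhds hx] with y hy
      have hy' : y 2 < 0 := hy
      have : 1 ≤ 1 - 2 * y 2 / δ := by
        have : 2 * y 2 / δ ≤ 0 := div_nonpos_of_nonpos_of_nonneg (by linarith) hδ.le
        linarith
      simp [v, Real.smoothTransition.one_of_one_le this]
    have h := H v hv hvs
    rw [setLIntegral_congr_fun (g := fun x => ENNReal.ofReal (frob2 (jac w (x - a))))
      isOpen_lower.measurableSet (fun x hx => by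
        simp only [jac_congr (hloc x hx), jac_comp_sub]),
      setLIntegral_congr_fun (f := fun x => ENNReal.ofReal (frob2 (strain v x)))
        (g := fun x => ENNReal.ofReal (frob2 (strain w (x - a))))
      isOpen_lower.measurableSet (fun x hx => by
        simp only [strain_congr (hloc x hx), strain_comp_sub]),
      lintegral_shift δ hmj, lintegral_shift δ hms] at h
    refine h.trans ?_
    gcongr
    intro x hx
    have hx' : x 2 < -δ := hx
    show x 2 < 0
    linarith
  have hU : lowerHalf = ⋃ n : ℕ, {x : E3 | x 2 < -(1 / ((n : ℝ) + 1))} := by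
    ext x
    simp only [mem_iUnion]
    constructor
    · intro hx
      have hx' : 0 < -(x 2) := by have : x 2 < 0 := hx; linarith
      obtain ⟨n, hn⟩ := exists_nat_one_div_lt hx'
      exact ⟨n, by show x 2 < _; linarith⟩
    · rintro ⟨n, hn⟩
      have hn' : x 2 < -(1 / ((n : ℝ) + 1)) := hn
      have : 0 < 1 / ((n : ℝ) + 1) := by positivity
      show x 2 < 0
      linarith
  have hmono : Monotone (fun n : ℕ => {x : E3 | x 2 < -(1 / ((n : ℝ) + 1))}) := by
    intro m n hmn x hx
    have hx' : x 2 < -(1 / ((m : ℝ) + 1)) := hx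
    have : 1 / ((n : ℝ) + 1) ≤ 1 / ((m : ℝ) + 1) := Nat.one_div_le_one_div hmn
    show x 2 < -(1 / ((n : ℝ) + 1))
    linarith
  conv_lhs => rw [hU]
  rw [setLIntegral_iUnion_of_directed _ (directed_of_isDirected_le hmono)]
  exact iSup_le fun n => step _ (by positivity)

lemma inner_fderiv_eq (u : E3 → E3) (p x : E3) :
    inner ℝ (fderiv ℝ u p x) x = ∑ i, ∑ j, strain u p i j * x i * x j := by
  have hx : x = ∑ j, x j • (EuclideanSpace.single j 1 : E3) := by
    ext i
    simp [Fin.sum_univ_three]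
    fin_cases i <;> simp
  have h : ∀ i, fderiv ℝ u p x i = ∑ j, jac u p i j * x j := by
    intro i
    conv_lhs => rw [hx]
    simp [jac, Fin.sum_univ_three, mul_comm]
  simp only [PiLp.inner_apply, h, Fin.sum_univ_three, strain]
  simp
  ring

lemma inner_fderiv_sq_le (u : E3 → E3) (p x : E3) :
    (inner ℝ (fderiv ℝ u p x) x) ^ 2 ≤ frob2 (strain u p) * ‖x‖ ^ 4 := by
  rw [inner_fderiv_eq]
  have hn : ‖x‖ ^ 4 = ∑ i, ∑ j, (x i * x j) ^ 2 := by
    rw [show ‖x‖ ^ 4 = (‖x‖ ^ 2) * (‖x‖ ^ 2) by ring, EuclideanSpace.real_norm_sq_eq,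
      Finset.sum_mul_sum]
    simp only [mul_pow]
  rw [hn]
  unfold frob2
  rw [← Finset.sum_product', ← Finset.sum_product', ← Finset.sum_product']
  simp only [mul_assoc]
  exact Finset.sum_mul_sq_le_sq_mul_sq _ (fun p' : Fin 3 × Fin 3 => strain u p p'.1 p'.2)
    (fun p' : Fin 3 × Fin 3 => x p'.1 * x p'.2)

lemma jensen12 {k k' : ℝ → ℝ} (hk : ∀ t ∈ Icc (1:ℝ) 2, HasDerivAt k (k' t) t)
    (hc : ContinuousOn k' (Icc 1 2)) :
    ENNReal.ofReal ((k 2 - k 1) ^ 2) ≤ ∫⁻ t in Icc (1:ℝ) 2, ENNReal.ofReal (k' t ^ 2) := by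
  have h12 : uIcc (1:ℝ) 2 = Icc 1 2 := uIcc_of_le (by norm_num)
  have hc' : ContinuousOn k' (uIcc 1 2) := by rwa [h12]
  have hi : IntervalIntegrable k' volume 1 2 := hc'.intervalIntegrable
  have hi2 : IntervalIntegrable (fun t => k' t ^ 2) volume 1 2 := (hc'.pow 2).intervalIntegrable
  have hF : ∫ t in (1:ℝ)..2, k' t = k 2 - k 1 :=
    intervalIntegral.integral_eq_sub_of_hasDerivAt (fun t ht => hk t (h12 ▸ ht)) hi
  set m := k 2 - k 1
  have h0 : 0 ≤ ∫ t in (1:ℝ)..2, (k' t - m) ^ 2 :=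
    intervalIntegral.integral_nonneg (by norm_num) fun t _ => sq_nonneg _
  have h1 : ∫ t in (1:ℝ)..2, (k' t - m) ^ 2 = (∫ t in (1:ℝ)..2, k' t ^ 2) - m ^ 2 := by
    have : ∀ t, (k' t - m) ^ 2 = k' t ^ 2 - 2 * m * k' t + m ^ 2 := fun t => by ring
    simp only [this]
    rw [intervalIntegral.integral_add (hi2.sub (hi.const_mul _)) (by simp),
      intervalIntegral.integral_sub hi2 (hi.const_mul _), intervalIntegral.integral_const_mul, hF]
    simp
    ring
  have h2 : m ^ 2 ≤ ∫ t in (1:ℝ)..2, k' t ^ 2 := by linarith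
  refine (ENNReal.ofReal_le_ofReal h2).trans ?_
  rw [intervalIntegral.integral_of_le (by norm_num), ← integral_Icc_eq_integral_Ioc,
    ofReal_integral_eq_lintegral_ofReal _ (Filter.Eventually.of_forall fun t => sq_nonneg _)]
  exact (hc.pow 2).integrableOn_Icc

lemma lintegral_scale {D : Set E3} (hD : MeasurableSet D) (hst : ∀ x ∈ D, ∀ t : ℝ, 1 ≤ t → t • x ∈ D)
    (F : E3 → ENNReal) (t : ℝ) (ht : 1 ≤ t) :
    ∫⁻ x in D, F (t • x) ≤ ENNReal.ofReal ((t ^ 3)⁻¹) * ∫⁻ x in D, F x := by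
  have ht0 : t ≠ 0 := by linarith
  have hemb : MeasurableEmbedding (fun x : E3 => t • x) :=
    (Homeomorph.smulOfNeZero t ht0).measurableEmbedding
  have hm := Measure.map_addHaar_smul (volume : Measure E3) ht0
  have hfr : Module.finrank ℝ E3 = 3 := by simp
  rw [hfr, abs_of_nonneg (by positivity)] at hm
  have hsub : D ⊆ (fun x : E3 => t • x) ⁻¹' D := fun x hx => hst x hx t ht
  calc ∫⁻ x in D, F (t • x) ≤ ∫⁻ x in (fun x : E3 => t • x) ⁻¹' D, F (t • x) :=
        lintegral_mono_set hsub
    _ = ∫⁻ x in D, F x ∂(Measure.map (fun x : E3 => t • x) volume) := by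
        rw [hemb.restrict_map, hemb.lintegral_map]
    _ = _ := by
        rw [hm, Measure.restrict_smul, lintegral_smul_measure, smul_eq_mul]

lemma hardy0 {D : Set E3} (hD : IsOpen D) (hst : ∀ x ∈ D, ∀ t : ℝ, 1 ≤ t → t • x ∈ D)
    (h0 : (0 : E3) ∉ D) {u : E3 → E3} (hu : ContDiffOn ℝ 1 u D)
    (hfin : ∫⁻ x in D, ENNReal.ofReal (‖u x‖ ^ 2 / ‖x‖ ^ 2) ≠ ⊤) :
    ∫⁻ x in D, ENNReal.ofReal ((inner ℝ (u x) x) ^ 2 / ‖x‖ ^ 4) ≤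
      12 * ∫⁻ x in D, ENNReal.ofReal (frob2 (strain u x)) := by
  set G : E3 → ENNReal := fun x => ENNReal.ofReal ((inner ℝ (u x) x) ^ 2 / ‖x‖ ^ 4) with hG
  set S : E3 → ENNReal := fun x => ENNReal.ofReal (frob2 (strain u x)) with hS
  have hSm : Measurable S := (measurable_frob_strain u).ennreal_ofReal
  have hpos : ∀ x ∈ D, 0 < ‖x‖ := by
    intro x hx
    rw [norm_pos_iff]
    rintro rfl
    exact h0 hx
  have hSm2 : Measurable (fun p : E3 × ℝ => S (p.2 • p.1)) :=
    hSm.comp (by fun_prop)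
  have hpt : ∀ x ∈ D, G x ≤ 6 * G ((2:ℝ) • x) + 3 * ∫⁻ t in Icc (1:ℝ) 2, S (t • x) := by
    intro x hx
    have hxp := hpos x hx
    let k : ℝ → ℝ := fun t => inner ℝ (u (t • x)) x
    let k' : ℝ → ℝ := fun t => inner ℝ (fderiv ℝ u (t • x) x) x
    have hmem : ∀ t ∈ Icc (1:ℝ) 2, t • x ∈ D := fun t ht => hst x hx t ht.1
    have hder : ∀ t ∈ Icc (1:ℝ) 2, HasDerivAt k (k' t) t := by
      intro t ht
      have h1 : HasFDerivAt u (fderiv ℝ u (t • x)) (t • x) :=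
        ((hu.contDiffAt (hD.mem_nhds (hmem t ht))).differentiableAt (by norm_num)).hasFDerivAt
      have h2 : HasDerivAt (fun t : ℝ => t • x) x t := by
        simpa using (hasDerivAt_id t).smul_const x
      have h3 := h1.comp_hasDerivAt t h2
      have h4 := h3.inner ℝ (hasDerivAt_const t x)
      simpa [k, k'] using h4
    have hcont : ContinuousOn k' (Icc 1 2) := by
      have h1 : ContinuousOn (fderiv ℝ u) D := hu.continuousOn_fderiv_of_isOpen hD (by norm_num)
      have h2 : ContinuousOn (fun t : ℝ => fderiv ℝ u (t • x)) (Icc 1 2) :=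
        h1.comp (by fun_prop) hmem
      exact (h2.clm_apply continuousOn_const).inner continuousOn_const
    have hj := jensen12 hder hcont
    have hle : ENNReal.ofReal ((k 2 - k 1) ^ 2) ≤
        ENNReal.ofReal (‖x‖ ^ 4) * ∫⁻ t in Icc (1:ℝ) 2, S (t • x) := by
      refine hj.trans ?_
      rw [← lintegral_const_mul' _ _ ENNReal.ofReal_ne_top]
      refine lintegral_mono fun t => ?_
      rw [hS, ← ENNReal.ofReal_mul (by positivity), mul_comm]
      exact ENNReal.ofReal_le_ofReal (inner_fderiv_sq_le u (t • x) x)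
    have hG2 : G ((2:ℝ) • x) = ENNReal.ofReal (k 2 ^ 2 / (4 * ‖x‖ ^ 4)) := by
      simp only [hG, k]
      congr 1
      rw [inner_smul_right, norm_smul]
      have : ‖(2:ℝ)‖ = 2 := by norm_num
      rw [this]
      field_simp
      ring
    have hG1 : G x = ENNReal.ofReal (k 1 ^ 2 / ‖x‖ ^ 4) := by
      simp only [hG, k, one_smul]
    have h4 : 0 < ‖x‖ ^ 4 := by positivity
    have hreal : k 1 ^ 2 / ‖x‖ ^ 4 ≤ 6 * (k 2 ^ 2 / (4 * ‖x‖ ^ 4)) +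
        3 * ((‖x‖ ^ 4)⁻¹ * (k 2 - k 1) ^ 2) := by
      have : 6 * (k 2 ^ 2 / (4 * ‖x‖ ^ 4)) + 3 * ((‖x‖ ^ 4)⁻¹ * (k 2 - k 1) ^ 2) =
        (3 / 2 * k 2 ^ 2 + 3 * (k 2 - k 1) ^ 2) / ‖x‖ ^ 4 := by field_simp; ring
      rw [this]
      gcongr
      nlinarith [sq_nonneg (3 * k 2 - 2 * k 1)]
    rw [hG1, hG2]
    refine (ENNReal.ofReal_le_ofReal hreal).trans ?_
    rw [ENNReal.ofReal_add (by positivity) (by positivity), ENNReal.ofReal_mul (by norm_num),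
      ENNReal.ofReal_mul (by norm_num), ENNReal.ofReal_ofNat, ENNReal.ofReal_ofNat,
      ENNReal.ofReal_mul (by positivity)]
    gcongr
    refine (mul_le_mul_right hle _).trans ?_
    rw [← mul_assoc, ← ENNReal.ofReal_mul (by positivity), inv_mul_cancel₀ h4.ne']
    simp
  have hA : ∫⁻ x in D, G x ≠ ⊤ := by
    refine ne_top_of_le_ne_top hfin (setLIntegral_mono' hD.measurableSet fun x hx => ?_)
    apply ENNReal.ofReal_le_ofReal
    have hxp := hpos x hx
    rw [div_le_div_iff₀ (by positivity) (by positivity)]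
    have h1 : (inner ℝ (u x) x) ^ 2 ≤ (‖u x‖ * ‖x‖) ^ 2 :=
      sq_le_sq' (neg_le_of_abs_le (abs_real_inner_le_norm _ _)) (real_inner_le_norm _ _)
    nlinarith [mul_le_mul_of_nonneg_right h1 (sq_nonneg ‖x‖)]
  have hm1 : Measurable (fun x : E3 => ∫⁻ t in Icc (1:ℝ) 2, S (t • x)) :=
    hSm2.lintegral_prod_right'
  have hB : ∫⁻ x in D, ∫⁻ t in Icc (1:ℝ) 2, S (t • x) ≤ ∫⁻ x in D, S x := by
    rw [lintegral_lintegral_swap hSm2.aemeasurable]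
    calc ∫⁻ t in Icc (1:ℝ) 2, ∫⁻ x in D, S (t • x) ≤ ∫⁻ t in Icc (1:ℝ) 2, ∫⁻ x in D, S x := by
          refine setLIntegral_mono' measurableSet_Icc fun t ht => ?_
          refine (lintegral_scale hD.measurableSet hst S t ht.1).trans ?_
          refine mul_le_of_le_one_left (zero_le) ?_
          rw [ENNReal.ofReal_le_one]
          exact inv_le_one_of_one_le₀ (one_le_pow₀ ht.1)
      _ = _ := by simp; norm_num
  have hmain : ∫⁻ x in D, G x ≤ 6 * (ENNReal.ofReal ((2 ^ 3)⁻¹) * ∫⁻ x in D, G x) +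
      3 * ∫⁻ x in D, S x := by
    calc ∫⁻ x in D, G x ≤ ∫⁻ x in D, (6 * G ((2:ℝ) • x) + 3 * ∫⁻ t in Icc (1:ℝ) 2, S (t • x)) :=
          setLIntegral_mono' hD.measurableSet hpt
      _ = 6 * (∫⁻ x in D, G ((2:ℝ) • x)) + 3 * ∫⁻ x in D, ∫⁻ t in Icc (1:ℝ) 2, S (t • x) := by
          rw [lintegral_add_right _ (hm1.const_mul _), lintegral_const_mul' _ _ (by simp),
            lintegral_const_mul' _ _ (by simp)]
      _ ≤ _ := by
          gcongr
          exact lintegral_scale hD.measurableSet hst G 2 (by norm_num)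
  by_cases hSt : ∫⁻ x in D, S x = ⊤
  · rw [hSt]; simp
  generalize (∫⁻ x in D, G x) = A at *
  generalize (∫⁻ x in D, S x) = B at *
  lift A to NNReal using hA
  lift B to NNReal using hSt
  rw [ENNReal.ofReal] at hmain
  norm_cast at hmain ⊢
  have hm' : (A : ℝ) ≤ 6 * ((2 ^ 3)⁻¹ * A) + 3 * B := by
    have := NNReal.coe_le_coe.2 hmain
    push_cast [Real.coe_toNNReal'] at this
    norm_num at this ⊢
    linarith
  rw [← NNReal.coe_le_coe]
  push_cast
  norm_num at hm'
  linarith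

lemma hardy {D : Set E3} (hD : IsOpen D) (y : E3)
    (hst : ∀ x ∈ D, ∀ t : ℝ, 1 ≤ t → y + t • (x - y) ∈ D)
    (h0 : y ∉ D) {u : E3 → E3} (hu : ContDiffOn ℝ 1 u D)
    (hfin : ∫⁻ x in D, ENNReal.ofReal (‖u x‖ ^ 2 / ‖x - y‖ ^ 2) ≠ ⊤) :
    ∫⁻ x in D, ENNReal.ofReal ((inner ℝ (u x) (x - y)) ^ 2 / ‖x - y‖ ^ 4) ≤
      12 * ∫⁻ x in D, ENNReal.ofReal (frob2 (strain u x)) := by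
  set T : E3 → E3 := fun z => z - (-y) with hT
  have hTc : Continuous T := by fun_prop
  have key : ∀ F : E3 → ENNReal, ∫⁻ z in T ⁻¹' D, F (T z) = ∫⁻ x in D, F x := fun F =>
    (measurePreserving_sub_right (volume : Measure E3) (-y)).setLIntegral_comp_preimage_emb
      (MeasurableEquiv.subRight (-y)).measurableEmbedding F D
  have hTy : ∀ z, T z - y = z := by intro z; simp [hT]
  have := hardy0 (D := T ⁻¹' D) (u := fun z => u (z - (-y))) (hD.preimage hTc) ?_ ?_ ?_ ?_
  · rw [← key, ← key]
    simpa only [strain_comp_sub, hTy] using this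
  · intro x hx t ht
    have := hst (T x) hx t ht
    rw [hTy] at this
    show T (t • x) ∈ D
    convert this using 1
    simp [hT, add_comm]
  · simpa [hT] using h0
  · refine hu.comp (f := T) ?_ (fun z hz => hz)
    exact (contDiff_id.sub contDiff_const).contDiffOn
  · rw [← key] at hfin
    simpa only [hTy] using hfin

def ExtD (r : ℝ) : Set E3 := {x : E3 | r < ‖x‖ ∧ x 2 < 0}

lemma isOpen_ExtD (r : ℝ) : IsOpen (ExtD r) :=
  (isOpen_lt continuous_const continuous_norm).inter isOpen_lower

lemma hardy_ext {r' : ℝ} (hr' : 0 < r') (y : E3) (hy : ‖y‖ ≤ r' / 2) (hy2 : 0 ≤ y 2) {u : E3 → E3}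
    (hu : ContDiffOn ℝ 1 u (ExtD r'))
    (hfin : ∫⁻ x in ExtD r', ENNReal.ofReal (‖u x‖ ^ 2 / (1 + ‖x‖ ^ 2)) ≠ ⊤) :
    ∫⁻ x in ExtD r', ENNReal.ofReal ((inner ℝ (u x) (x - y)) ^ 2 / ‖x - y‖ ^ 4) ≤
      12 * ∫⁻ x in ExtD r', ENNReal.ofReal (frob2 (strain u x)) := by
  apply hardy (isOpen_ExtD r') y _ _ hu
  · have hc : ENNReal.ofReal (4 * (1 + 1 / r' ^ 2)) *
        ∫⁻ x in ExtD r', ENNReal.ofReal (‖u x‖ ^ 2 / (1 + ‖x‖ ^ 2)) ≠ ⊤ :=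
      ENNReal.mul_ne_top ENNReal.ofReal_ne_top hfin
    refine ne_top_of_le_ne_top hc ?_
    rw [← lintegral_const_mul' _ _ ENNReal.ofReal_ne_top]
    refine setLIntegral_mono' (isOpen_ExtD r').measurableSet fun x hx => ?_
    rw [← ENNReal.ofReal_mul (by positivity)]
    apply ENNReal.ofReal_le_ofReal
    have hx1 : r' < ‖x‖ := hx.1
    have h1 : ‖x‖ / 2 ≤ ‖x - y‖ := by
      have := norm_sub_norm_le x y
      linarith
    have hxp : 0 < ‖x‖ := hr'.trans hx1
    have h2 : 1 + ‖x‖ ^ 2 ≤ (1 + 1 / r' ^ 2) * ‖x‖ ^ 2 := by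
      have : 1 ≤ ‖x‖ ^ 2 / r' ^ 2 := by
        rw [le_div_iff₀ (by positivity), one_mul]
        gcongr
      calc 1 + ‖x‖ ^ 2 ≤ ‖x‖ ^ 2 / r' ^ 2 + ‖x‖ ^ 2 := by linarith
        _ = _ := by ring
    have h3 : ‖x‖ ^ 2 / 4 ≤ ‖x - y‖ ^ 2 := by
      calc ‖x‖ ^ 2 / 4 = (‖x‖ / 2) ^ 2 := by ring
        _ ≤ _ := by gcongr
    have hq : 0 < ‖x - y‖ ^ 2 := by
      have : 0 < ‖x‖ ^ 2 / 4 := by positivity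
      linarith
    rw [mul_div_assoc', div_le_div_iff₀ hq (by positivity)]
    have h4 : 1 + ‖x‖ ^ 2 ≤ 4 * (1 + 1 / r' ^ 2) * ‖x - y‖ ^ 2 := by
      have : (1 + 1 / r' ^ 2) * (‖x‖ ^ 2 / 4) ≤ (1 + 1 / r' ^ 2) * ‖x - y‖ ^ 2 := by gcongr
      linarith
    nlinarith [mul_le_mul_of_nonneg_left h4 (sq_nonneg ‖u x‖)]
  · intro x hx t ht
    have hx1 : r' < ‖x‖ := hx.1
    have hx2 : x 2 < 0 := hx.2
    constructor
    · by_contra hcon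
      rw [not_lt] at hcon
      have ht0 : 0 < t := by linarith
      have : t • x = (y + t • (x - y)) + (t - 1) • y := by module
      have h1 : ‖t • x‖ ≤ r' + (t - 1) * r' := by
        rw [this]
        refine (norm_add_le _ _).trans ?_
        rw [norm_smul, Real.norm_eq_abs, abs_of_nonneg (by linarith)]
        have : (t - 1) * ‖y‖ ≤ (t - 1) * r' :=
          mul_le_mul_of_nonneg_left (by linarith) (by linarith)
        linarith
      rw [norm_smul, Real.norm_eq_abs, abs_of_pos ht0] at h1
      have : t * r' < t * ‖x‖ := by gcongr
      linarith
    · show (y + t • (x - y)) 2 < 0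
      simp only [PiLp.add_apply, PiLp.smul_apply, PiLp.sub_apply, smul_eq_mul]
      nlinarith
  · intro h
    have : r' < ‖y‖ := h.1
    linarith

lemma local_L2 {r' r : ℝ} (hr' : 0 < r') (hrr : r' < r) : ∃ L : ENNReal, L ≠ ⊤ ∧ ∀ u : E3 → E3,
    ContDiffOn ℝ 1 u (ExtD r') →
    ∫⁻ x in ExtD r', ENNReal.ofReal (‖u x‖ ^ 2 / (1 + ‖x‖ ^ 2)) ≠ ⊤ →
    ∫⁻ x in ExtD r' ∩ closedBall 0 r, ENNReal.ofReal (‖u x‖ ^ 2) ≤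
      L * ∫⁻ x in ExtD r', ENNReal.ofReal (frob2 (strain u x)) := by
  set c : ℝ := 8 / r' ^ 2 * (2 * r) ^ 4 with hc
  have hc0 : 0 ≤ c := by positivity
  refine ⟨ENNReal.ofReal c * 72, ENNReal.mul_ne_top ENNReal.ofReal_ne_top (by simp), ?_⟩
  intro u hu hfin
  let y : Fin 3 → E3 := fun i => (r' / 2) • EuclideanSpace.single i 1
  have hyn : ∀ i, ‖y i‖ ≤ r' / 2 := by
    intro i
    simp only [y, norm_smul]
    simp [abs_of_pos hr']
  have hy2 : ∀ i, 0 ≤ y i 2 := by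
    intro i
    fin_cases i <;> simp [y]
    linarith
  let g : E3 → E3 → ℝ := fun p x => (inner ℝ (u x) (x - p)) ^ 2 / ‖x - p‖ ^ 4
  have hg0 : ∀ p x, 0 ≤ g p x := fun p x => by positivity
  have hum : AEMeasurable u (volume.restrict (ExtD r')) :=
    hu.continuousOn.aemeasurable (isOpen_ExtD r').measurableSet
  have hgm : ∀ p, AEMeasurable (fun x => ENNReal.ofReal (g p x)) (volume.restrict (ExtD r')) := by
    intro p
    apply AEMeasurable.ennreal_ofReal
    have h1 : AEMeasurable (fun x : E3 => x - p) (volume.restrict (ExtD r')) := by fun_prop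
    exact ((hum.inner h1).pow_const 2).div ((h1.norm).pow_const 4)
  have hbd : ∀ x ∈ ExtD r' ∩ closedBall 0 r, ∀ p : E3, ‖p‖ ≤ r' / 2 →
      (inner ℝ (u x) (x - p)) ^ 2 ≤ (2 * r) ^ 4 * g p x := by
    intro x hx p hp
    have hx1 : r' < ‖x‖ := hx.1.1
    have hx2 : ‖x‖ ≤ r := by simpa using hx.2
    have h1 : ‖x - p‖ ≤ 2 * r := (norm_sub_le x p).trans (by linarith)
    have h2 : 0 < ‖x - p‖ := by
      have := norm_sub_norm_le x p
      linarith
    calc (inner ℝ (u x) (x - p)) ^ 2 = ‖x - p‖ ^ 4 * g p x := by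
          simp only [g]; field_simp
      _ ≤ _ := by
          gcongr
  have hpt : ∀ x ∈ ExtD r' ∩ closedBall 0 r, ‖u x‖ ^ 2 ≤ c * ∑ i, (g 0 x + g (y i) x) := by
    intro x hx
    rw [EuclideanSpace.real_norm_sq_eq, Finset.mul_sum]
    refine Finset.sum_le_sum fun i _ => ?_
    have h1 := hbd x hx 0 (by simp; linarith)
    have h2 := hbd x hx (y i) (hyn i)
    have h3 : u x i = 2 / r' * (inner ℝ (u x) (x - 0) - inner ℝ (u x) (x - y i)) := by
      rw [← inner_sub_right]
      have : x - 0 - (x - y i) = y i := by abel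
      rw [this]
      simp only [y, inner_smul_right]
      rw [EuclideanSpace.inner_single_right]
      simp
      field_simp
    rw [h3, mul_pow]
    have h4 : ∀ a b : ℝ, (a - b) ^ 2 ≤ 2 * (a ^ 2 + b ^ 2) := fun a b => by
      nlinarith [sq_nonneg (a + b)]
    calc (2 / r') ^ 2 * (inner ℝ (u x) (x - 0) - inner ℝ (u x) (x - y i)) ^ 2
        ≤ (2 / r') ^ 2 * (2 * ((2 * r) ^ 4 * g 0 x + (2 * r) ^ 4 * g (y i) x)) := by
          gcongr
          refine (h4 _ _).trans ?_
          linarith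
      _ = c * (g 0 x + g (y i) x) := by rw [hc]; ring
  calc ∫⁻ x in ExtD r' ∩ closedBall 0 r, ENNReal.ofReal (‖u x‖ ^ 2)
      ≤ ∫⁻ x in ExtD r' ∩ closedBall 0 r, ENNReal.ofReal c *
          ∑ i, (ENNReal.ofReal (g 0 x) + ENNReal.ofReal (g (y i) x)) := by
        refine setLIntegral_mono' ((isOpen_ExtD r').measurableSet.inter measurableSet_closedBall)
          fun x hx => ?_
        refine (ENNReal.ofReal_le_ofReal (hpt x hx)).trans ?_
        rw [ENNReal.ofReal_mul hc0, ENNReal.ofReal_sum_of_nonneg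
          (fun i _ => add_nonneg (hg0 _ _) (hg0 _ _))]
        simp only [ENNReal.ofReal_add (hg0 _ _) (hg0 _ _), le_refl]
    _ ≤ ∫⁻ x in ExtD r', ENNReal.ofReal c *
          ∑ i, (ENNReal.ofReal (g 0 x) + ENNReal.ofReal (g (y i) x)) :=
        lintegral_mono_set inter_subset_left
    _ = ENNReal.ofReal c * ∑ i, ((∫⁻ x in ExtD r', ENNReal.ofReal (g 0 x)) +
          ∫⁻ x in ExtD r', ENNReal.ofReal (g (y i) x)) := by
        rw [lintegral_const_mul' _ _ ENNReal.ofReal_ne_top, lintegral_finsetSum'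
          (f := fun i x => ENNReal.ofReal (g 0 x) + ENNReal.ofReal (g (y i) x)) _
          (fun i _ => (hgm 0).add (hgm (y i)))]
        congr 1
        refine Finset.sum_congr rfl fun i _ => ?_
        rw [lintegral_add_left' (hgm 0)]
    _ ≤ ENNReal.ofReal c * ∑ i : Fin 3, (12 * (∫⁻ x in ExtD r', ENNReal.ofReal (frob2 (strain u x))) +
          12 * ∫⁻ x in ExtD r', ENNReal.ofReal (frob2 (strain u x))) := by
        gcongr with i
        · exact hardy_ext hr' 0 (by simp; linarith) (by simp) hu hfin
        · exact hardy_ext hr' (y i) (hyn i) (hy2 i) hu hfin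
    _ = _ := by
        rw [Fin.sum_univ_three]; ring

lemma exists_bound_theta : ∃ K : ℝ, 0 ≤ K ∧ (∀ t, |deriv Real.smoothTransition t| ≤ K) ∧
    (∀ t ≤ 0, deriv Real.smoothTransition t = 0) ∧ (∀ t ≥ 1, deriv Real.smoothTransition t = 0) := by
  have h0 : ∀ t ≤ 0, deriv Real.smoothTransition t = 0 := by
    intro t ht
    apply IsLocalMin.deriv_eq_zero
    refine Filter.Eventually.of_forall fun s => ?_
    rw [Real.smoothTransition.zero_of_nonpos ht]
    exact Real.smoothTransition.nonneg s
  have h1 : ∀ t ≥ 1, deriv Real.smoothTransition t = 0 := by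
    intro t ht
    apply IsLocalMax.deriv_eq_zero
    refine Filter.Eventually.of_forall fun s => ?_
    rw [Real.smoothTransition.one_of_one_le ht]
    exact Real.smoothTransition.le_one s
  have hc : Continuous (deriv Real.smoothTransition) :=
    (Real.smoothTransition.contDiff (n := 1)).continuous_deriv (by norm_num)
  obtain ⟨K, hK⟩ := (isCompact_Icc (a := (0:ℝ)) (b := 1)).exists_bound_of_continuousOn hc.continuousOn
  have hK0 : 0 ≤ K := (norm_nonneg _).trans (hK 0 (by simp))
  refine ⟨K, hK0, fun t => ?_, h0, h1⟩
  by_cases ht0 : t ≤ 0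
  · rw [h0 t ht0]; simpa
  by_cases ht1 : 1 ≤ t
  · rw [h1 t ht1]; simpa
  · exact hK t ⟨by linarith, by linarith⟩

lemma theta_comp (α β : ℝ) (x : E3) :
    HasFDerivAt (fun x : E3 => Real.smoothTransition (α * ‖x‖ ^ 2 + β))
      ((deriv Real.smoothTransition (α * ‖x‖ ^ 2 + β) * α * 2) • innerSL ℝ x) x := by
  have h1 : HasFDerivAt (fun x : E3 => ‖x‖ ^ 2) (2 • innerSL ℝ x) x :=
    (hasStrictFDerivAt_norm_sq x).hasFDerivAt
  have h2 := (h1.const_mul α).add_const β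
  have h3 : HasDerivAt Real.smoothTransition (deriv Real.smoothTransition (α * ‖x‖ ^ 2 + β))
      (α * ‖x‖ ^ 2 + β) :=
    ((Real.smoothTransition.contDiff (n := 1)).differentiable (by norm_num) _).hasDerivAt
  have h4 := h3.comp_hasFDerivAt x h2
  have h5 : (deriv Real.smoothTransition (α * ‖x‖ ^ 2 + β) * α * 2) • innerSL ℝ x =
      deriv Real.smoothTransition (α * ‖x‖ ^ 2 + β) • α • 2 • (innerSL ℝ) x := by
    rw [mul_assoc, mul_smul, mul_smul, two_smul, two_smul]
  rw [h5]
  exact h4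

lemma exists_cutoff {r1 r : ℝ} (h1 : 0 < r1) (h2 : r1 < r) : ∃ C : ℝ, 0 ≤ C ∧ ∀ R : ℝ, r ≤ R → 1 ≤ R →
    ∃ η : E3 → ℝ, ContDiff ℝ 1 η ∧ (∀ x, 0 ≤ η x ∧ η x ≤ 1) ∧ (∀ x, ‖x‖ ≤ r1 → η x = 0) ∧
      (∀ x, r ≤ ‖x‖ → ‖x‖ ≤ R → η x = 1) ∧ (∀ x, 2 * R < ‖x‖ → η x = 0) ∧
      (∀ x, ‖x‖ ≤ r → ‖fderiv ℝ η x‖ ^ 2 ≤ C) ∧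
      (∀ x, r < ‖x‖ → ‖x‖ < R → fderiv ℝ η x = 0) ∧
      (∀ x, R ≤ ‖x‖ → r < ‖x‖ → ‖fderiv ℝ η x‖ ^ 2 ≤ C / (1 + ‖x‖ ^ 2)) := by
  obtain ⟨K, hK0, hK, hz, ho⟩ := exists_bound_theta
  have hr : 0 < r := h1.trans h2
  set d : ℝ := r ^ 2 - r1 ^ 2 with hd
  have hd0 : 0 < d := by rw [hd]; nlinarith
  refine ⟨(K * d⁻¹ * 2 * r) ^ 2 + 24 * K ^ 2, by positivity, fun R hrR hR1 => ?_⟩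
  have hR0 : 0 < R := by linarith
  set θ := Real.smoothTransition with hθ
  let p : E3 → ℝ := fun x => d⁻¹ * ‖x‖ ^ 2 + (-(d⁻¹ * r1 ^ 2))
  let q : E3 → ℝ := fun x => (-(R ^ 2)⁻¹) * ‖x‖ ^ 2 + 2
  have hp0 : ∀ x, ‖x‖ ≤ r1 → p x ≤ 0 := by
    intro x hx
    have : d⁻¹ * ‖x‖ ^ 2 ≤ d⁻¹ * r1 ^ 2 := by gcongr
    simp only [p]; linarith
  have hp1 : ∀ x, r ≤ ‖x‖ → 1 ≤ p x := by
    intro x hx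
    have : d⁻¹ * r ^ 2 ≤ d⁻¹ * ‖x‖ ^ 2 := by gcongr
    have h3 : d⁻¹ * r ^ 2 - d⁻¹ * r1 ^ 2 = 1 := by
      rw [← mul_sub, ← hd, inv_mul_cancel₀ hd0.ne']
    simp only [p]; linarith
  have hq1 : ∀ x, ‖x‖ ≤ R → 1 ≤ q x := by
    intro x hx
    have : (R ^ 2)⁻¹ * ‖x‖ ^ 2 ≤ (R ^ 2)⁻¹ * R ^ 2 := by gcongr
    rw [inv_mul_cancel₀ (by positivity)] at this
    simp only [q]; linarith
  have hq0 : ∀ x, 2 * R ^ 2 ≤ ‖x‖ ^ 2 → q x ≤ 0 := by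
    intro x hx
    have : (R ^ 2)⁻¹ * (2 * R ^ 2) ≤ (R ^ 2)⁻¹ * ‖x‖ ^ 2 := by gcongr
    have h3 : (R ^ 2)⁻¹ * (2 * R ^ 2) = 2 := by field_simp
    simp only [q]; linarith
  have hder : ∀ x, HasFDerivAt (fun x => θ (p x) * θ (q x)) (θ (p x) •
      ((deriv θ (q x) * (-(R ^ 2)⁻¹) * 2) • innerSL ℝ x) + θ (q x) •
      ((deriv θ (p x) * d⁻¹ * 2) • innerSL ℝ x)) x := fun x =>
    (theta_comp d⁻¹ _ x).mul (theta_comp (-(R ^ 2)⁻¹) 2 x)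
  have hab : ∀ t, |θ t| ≤ 1 := fun t => by
    rw [abs_of_nonneg (Real.smoothTransition.nonneg t)]; exact Real.smoothTransition.le_one t
  refine ⟨fun x => θ (p x) * θ (q x), ?_, ?_, ?_, ?_, ?_, ?_, ?_, ?_⟩
  · have hn : ContDiff ℝ 1 (fun x : E3 => ‖x‖ ^ 2) := contDiff_norm_sq ℝ
    have hp : ContDiff ℝ 1 p := (contDiff_const.mul hn).add contDiff_const
    have hq : ContDiff ℝ 1 q := (contDiff_const.mul hn).add contDiff_const
    exact ((Real.smoothTransition.contDiff (n := 1)).comp hp).mul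
      ((Real.smoothTransition.contDiff (n := 1)).comp hq)
  · intro x
    exact ⟨mul_nonneg (Real.smoothTransition.nonneg _) (Real.smoothTransition.nonneg _),
      mul_le_one₀ (Real.smoothTransition.le_one _) (Real.smoothTransition.nonneg _)
        (Real.smoothTransition.le_one _)⟩
  · intro x hx
    simp [hθ, Real.smoothTransition.zero_of_nonpos (hp0 x hx)]
  · intro x hx hx'
    simp [hθ, Real.smoothTransition.one_of_one_le (hp1 x hx),
      Real.smoothTransition.one_of_one_le (hq1 x hx')]
  · intro x hx
    have : q x ≤ 0 := hq0 x (by nlinarith)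
    simp [hθ, Real.smoothTransition.zero_of_nonpos this]
  · intro x hx
    rw [(hder x).fderiv, ho (q x) (hq1 x (hx.trans hrR))]
    simp only [zero_mul, zero_smul, smul_zero, zero_add]
    have : ‖θ (q x) • (deriv θ (p x) * d⁻¹ * 2) • innerSL ℝ x‖ ≤ K * d⁻¹ * 2 * r := by
      rw [norm_smul, norm_smul, innerSL_apply_norm, norm_mul, norm_mul]
      have e1 : ‖d⁻¹‖ = d⁻¹ := by rw [Real.norm_eq_abs, abs_of_pos (by positivity)]
      have e2 : ‖(2:ℝ)‖ = 2 := by norm_num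
      rw [e1, e2]
      calc _ ≤ 1 * (K * d⁻¹ * 2 * r) := by
            gcongr
            · exact hab _
            · exact hK _
        _ = _ := one_mul _
    calc _ ≤ (K * d⁻¹ * 2 * r) ^ 2 := by gcongr
      _ ≤ _ := by nlinarith [sq_nonneg K]
  · intro x hx hx'
    rw [(hder x).fderiv, ho (q x) (hq1 x hx'.le), ho (p x) (hp1 x hx.le)]
    simp
  · intro x hx hx'
    rw [(hder x).fderiv, ho (p x) (hp1 x hx'.le)]
    simp only [zero_mul, zero_smul, smul_zero, add_zero]
    by_cases hx2 : 2 * R ^ 2 ≤ ‖x‖ ^ 2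
    · rw [hz (q x) (hq0 x hx2)]
      simp only [zero_mul, zero_smul, smul_zero, norm_zero]
      rw [zero_pow two_ne_zero]
      positivity
    · rw [not_le] at hx2
      have hle : ‖θ (p x) • (deriv θ (q x) * (-(R ^ 2)⁻¹) * 2) • innerSL ℝ x‖ ≤
          K * (R ^ 2)⁻¹ * 2 * ‖x‖ := by
        rw [norm_smul, norm_smul, innerSL_apply_norm, norm_mul, norm_mul, norm_neg]
        have e1 : ‖(R ^ 2)⁻¹‖ = (R ^ 2)⁻¹ := by rw [Real.norm_eq_abs, abs_of_pos (by positivity)]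
        have e2 : ‖(2:ℝ)‖ = 2 := by norm_num
        rw [e1, e2]
        calc _ ≤ 1 * (K * (R ^ 2)⁻¹ * 2 * ‖x‖) := by
              gcongr
              · exact hab _
              · exact hK _
          _ = _ := one_mul _
      calc _ ≤ (K * (R ^ 2)⁻¹ * 2 * ‖x‖) ^ 2 := by gcongr
        _ = 4 * K ^ 2 * (‖x‖ ^ 2 / (R ^ 2) ^ 2) := by field_simp; ring
        _ ≤ 4 * K ^ 2 * (6 / (1 + ‖x‖ ^ 2)) := by
            gcongr 4 * K ^ 2 * ?_
            rw [div_le_div_iff₀ (by positivity) (by positivity)]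
            have hR2 : 1 ≤ R ^ 2 := one_le_pow₀ hR1
            have a1 : 1 + ‖x‖ ^ 2 ≤ 3 * R ^ 2 := by linarith
            calc ‖x‖ ^ 2 * (1 + ‖x‖ ^ 2) ≤ (2 * R ^ 2) * (3 * R ^ 2) := by gcongr
              _ = _ := by ring
        _ = 24 * K ^ 2 / (1 + ‖x‖ ^ 2) := by ring
        _ ≤ _ := by
            gcongr
            nlinarith [sq_nonneg (K * d⁻¹ * 2 * r)]

lemma strain_mul {u : E3 → E3} {η : E3 → ℝ} {x : E3} (hu : DifferentiableAt ℝ u x)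
    (hη : DifferentiableAt ℝ η x) (h0 : 0 ≤ η x) (h1 : η x ≤ 1) :
    frob2 (strain (fun x => η x • u x) x) ≤
      2 * frob2 (strain u x) + 6 * ‖fderiv ℝ η x‖ ^ 2 * ‖u x‖ ^ 2 := by
  have hj : ∀ i j, jac (fun x => η x • u x) x i j =
      η x * jac u x i j + fderiv ℝ η x (EuclideanSpace.single j 1) * u x i := by
    intro i j
    have := (hη.hasFDerivAt.smul hu.hasFDerivAt).fderiv
    simp only [jac]
    erw [this]
    simp
  have hd : ∀ j : Fin 3, (fderiv ℝ η x (EuclideanSpace.single j 1)) ^ 2 ≤ ‖fderiv ℝ η x‖ ^ 2 := by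
    intro j
    have := (fderiv ℝ η x).le_opNorm (EuclideanSpace.single j 1)
    simp at this
    rw [← sq_abs]
    gcongr
  have hij : ∀ i j, (strain (fun x => η x • u x) x i j) ^ 2 ≤
      2 * (strain u x i j) ^ 2 + ‖fderiv ℝ η x‖ ^ 2 * ((u x i) ^ 2 + (u x j) ^ 2) := by
    intro i j
    simp only [strain, hj]
    set a := fderiv ℝ η x (EuclideanSpace.single j 1)
    set b := fderiv ℝ η x (EuclideanSpace.single i 1)
    set N := ‖fderiv ℝ η x‖ ^ 2
    have ha : a ^ 2 ≤ N := hd j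
    have hb : b ^ 2 ≤ N := hd i
    set S := (jac u x i j + jac u x j i) / 2 with hS
    have e : (η x * jac u x i j + a * u x i + (η x * jac u x j i + b * u x j)) / 2 =
        η x * S + (a * u x i + b * u x j) / 2 := by rw [hS]; ring
    rw [e]
    have t1 : (η x * S) ^ 2 ≤ S ^ 2 := by
      rw [mul_pow]
      exact mul_le_of_le_one_left (sq_nonneg _) (pow_le_one₀ h0 h1)
    have t2 : a ^ 2 * (u x i) ^ 2 ≤ N * (u x i) ^ 2 := by gcongr
    have t3 : b ^ 2 * (u x j) ^ 2 ≤ N * (u x j) ^ 2 := by gcongr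
    nlinarith [sq_nonneg (η x * S - (a * u x i + b * u x j) / 2), sq_nonneg (a * u x i - b * u x j)]
  have hn : ‖u x‖ ^ 2 = ∑ i, (u x i) ^ 2 := EuclideanSpace.real_norm_sq_eq _
  calc frob2 (strain (fun x => η x • u x) x) ≤ ∑ i, ∑ j, (2 * (strain u x i j) ^ 2 +
        ‖fderiv ℝ η x‖ ^ 2 * ((u x i) ^ 2 + (u x j) ^ 2)) :=
        Finset.sum_le_sum fun i _ => Finset.sum_le_sum fun j _ => hij i j
    _ = _ := by
        rw [hn, frob2]
        simp only [Fin.sum_univ_three]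
        ring

lemma tail_tendsto (D : Set E3) (hD : MeasurableSet D) (f : E3 → ENNReal)
    (hf : ∫⁻ x in D, f x ≠ ⊤) :
    Filter.Tendsto (fun n : ℕ => ∫⁻ x in D ∩ {x : E3 | (n : ℝ) ≤ ‖x‖}, f x) Filter.atTop (nhds 0) := by
  have hs : ∀ n : ℕ, MeasurableSet {x : E3 | (n : ℝ) ≤ ‖x‖} := fun n =>
    measurableSet_le measurable_const measurable_norm
  let ν := (volume.restrict D).withDensity f
  have e : ∀ n : ℕ, ∫⁻ x in D ∩ {x : E3 | (n : ℝ) ≤ ‖x‖}, f x = ν {x : E3 | (n : ℝ) ≤ ‖x‖} := by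
    intro n
    simp only [ν]
    rw [withDensity_apply _ (hs n), Measure.restrict_restrict (hs n), inter_comm]
  simp only [e]
  have hi : (⋂ n : ℕ, {x : E3 | (n : ℝ) ≤ ‖x‖}) = ∅ := by
    ext x
    simp only [mem_iInter, mem_empty_iff_false, iff_false, not_forall]
    obtain ⟨n, hn⟩ := exists_nat_gt ‖x‖
    exact ⟨n, fun h => absurd (show (n : ℝ) ≤ ‖x‖ from h) (not_le.2 hn)⟩
  have := tendsto_measure_iInter_atTop (μ := ν) (s := fun n : ℕ => {x : E3 | (n : ℝ) ≤ ‖x‖})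
    (fun n => (hs n).nullMeasurableSet) (by
      intro m n hmn x hx
      have h1 : (n : ℝ) ≤ ‖x‖ := hx
      have h2 : (m : ℝ) ≤ n := by exact_mod_cast hmn
      exact h2.trans h1) ⟨0, by
      refine ne_top_of_le_ne_top ?_ (measure_mono (subset_univ _))
      simp only [ν]
      rw [withDensity_apply _ MeasurableSet.univ, Measure.restrict_univ]
      exact hf⟩
  rw [hi, measure_empty] at this
  exact this

lemma korn_trunc {r' r : ℝ} (hr' : 0 < r') (hrr : r' < r) : ∃ K L : ENNReal, K ≠ ⊤ ∧ L ≠ ⊤ ∧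
    ∀ u : E3 → E3, ContDiffOn ℝ 1 u (ExtD r') →
    ∫⁻ x in ExtD r', ENNReal.ofReal (‖u x‖ ^ 2 / (1 + ‖x‖ ^ 2)) ≠ ⊤ → ∀ R : ℝ, r ≤ R → 1 ≤ R →
    ∫⁻ x in ExtD r ∩ ball 0 R, ENNReal.ofReal (frob2 (jac u x)) ≤
      K * (∫⁻ x in ExtD r', ENNReal.ofReal (frob2 (strain u x))) +
      L * ∫⁻ x in ExtD r' ∩ {x | R ≤ ‖x‖}, ENNReal.ofReal (‖u x‖ ^ 2 / (1 + ‖x‖ ^ 2)) := by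
  obtain ⟨K, hK, hkorn⟩ := korn_half
  obtain ⟨L, hL, hloc⟩ := local_L2 hr' hrr
  obtain ⟨C, hC, hcut⟩ := exists_cutoff (r1 := (r' + r) / 2) (r := r) (by linarith) (by linarith)
  refine ⟨K * (2 + ENNReal.ofReal (6 * C) * L), K * ENNReal.ofReal (6 * C),
    ENNReal.mul_ne_top hK (ENNReal.add_ne_top.2 ⟨by simp, ENNReal.mul_ne_top ENNReal.ofReal_ne_top hL⟩),
    ENNReal.mul_ne_top hK ENNReal.ofReal_ne_top, fun u hu hfin R hrR hR1 => ?_⟩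
  obtain ⟨η, hη, h01, hz, h1, hzz, hd1, hd2, hd3⟩ := hcut R hrR hR1
  have hDo := isOpen_ExtD r'
  have hDm := hDo.measurableSet
  set w : E3 → E3 := fun x => η x • u x with hw
  have hloc0 : ∀ x : E3, ‖x‖ ≤ r' → w =ᶠ[nhds x] fun _ => 0 := by
    intro x hx
    have : {y : E3 | ‖y‖ < (r' + r) / 2} ∈ nhds x :=
      (isOpen_lt continuous_norm continuous_const).mem_nhds (show ‖x‖ < (r' + r) / 2 by linarith)
    filter_upwards [this] with y hy
    have hy' : ‖y‖ < (r' + r) / 2 := hy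
    simp [hw, hz y hy'.le]
  have hwC : ContDiffOn ℝ 1 w lowerHalf := by
    intro x hx
    apply ContDiffAt.contDiffWithinAt
    by_cases hx' : ‖x‖ ≤ r'
    · exact contDiffAt_const.congr_of_eventuallyEq (hloc0 x hx')
    · have hxD : x ∈ ExtD r' := ⟨not_le.1 hx', hx⟩
      exact hη.contDiffAt.smul (hu.contDiffAt (hDo.mem_nhds hxD))
  have hwz : ∀ x ∈ lowerHalf, 2 * R < ‖x‖ → w x = 0 := fun x _ hx => by simp [hw, hzz x hx]
  have hmain := hkorn w (2 * R) hwC hwz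
  have hleft : ∫⁻ x in ExtD r ∩ ball 0 R, ENNReal.ofReal (frob2 (jac u x)) ≤
      ∫⁻ x in lowerHalf, ENNReal.ofReal (frob2 (jac w x)) := by
    have hm := ((isOpen_ExtD r).inter (isOpen_ball (x := (0:E3)) (ε := R)))
    calc _ = ∫⁻ x in ExtD r ∩ ball 0 R, ENNReal.ofReal (frob2 (jac w x)) := by
          refine setLIntegral_congr_fun hm.measurableSet fun x hx => ?_
          have : w =ᶠ[nhds x] u := by
            filter_upwards [hm.mem_nhds hx] with y hy
            have hy1 : r < ‖y‖ := hy.1.1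
            have hy2 : ‖y‖ < R := by simpa using hy.2
            simp [hw, h1 y hy1.le hy2.le]
          simp only [jac_congr this]
      _ ≤ _ := lintegral_mono_set fun x hx => hx.1.2
  let S : E3 → ENNReal := fun x => ENNReal.ofReal (frob2 (strain u x))
  let G : E3 → ENNReal := fun x => ENNReal.ofReal (6 * ‖fderiv ℝ η x‖ ^ 2 * ‖u x‖ ^ 2)
  have hSm : Measurable S := (measurable_frob_strain u).ennreal_ofReal
  have hright : ∫⁻ x in lowerHalf, ENNReal.ofReal (frob2 (strain w x)) ≤
      2 * (∫⁻ x in ExtD r', S x) + ∫⁻ x in ExtD r', G x := by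
    calc ∫⁻ x in lowerHalf, ENNReal.ofReal (frob2 (strain w x))
        ≤ ∫⁻ x in lowerHalf, (ExtD r').indicator (fun x => 2 * S x + G x) x := by
          refine setLIntegral_mono' isOpen_lower.measurableSet fun x hx => ?_
          by_cases hx' : ‖x‖ ≤ r'
          · have e : strain w x = 0 := by
              rw [strain_congr (hloc0 x hx')]
              ext i j
              simp [strain, jac]
            rw [e]
            simp [frob2]
          · have hxD : x ∈ ExtD r' := ⟨not_le.1 hx', hx⟩
            rw [indicator_of_mem hxD]
            have := strain_mul ((hu.contDiffAt (hDo.mem_nhds hxD)).differentiableAt (by norm_num))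
              (hη.differentiable (by norm_num) x) (h01 x).1 (h01 x).2
            refine (ENNReal.ofReal_le_ofReal this).trans ?_
            rw [ENNReal.ofReal_add (by have := frob2_nonneg (strain u x); positivity) (by positivity),
              ENNReal.ofReal_mul (by norm_num), ENNReal.ofReal_ofNat]
      _ ≤ ∫⁻ x, (ExtD r').indicator (fun x => 2 * S x + G x) x := setLIntegral_le_lintegral _ _
      _ = ∫⁻ x in ExtD r', (2 * S x + G x) := lintegral_indicator hDm _
      _ = _ := by
          rw [lintegral_add_left (hSm.const_mul 2), lintegral_const_mul _ hSm]
  have hsplit : ∫⁻ x in ExtD r', G x ≤ (∫⁻ x in ExtD r' ∩ closedBall 0 r, G x) +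
      ((∫⁻ x in ExtD r' ∩ {x | r < ‖x‖ ∧ ‖x‖ < R}, G x) +
        ∫⁻ x in ExtD r' ∩ {x | R ≤ ‖x‖ ∧ r < ‖x‖}, G x) := by
    refine le_trans (lintegral_mono_set ?_) ((lintegral_union_le _ _ _).trans
      (add_le_add le_rfl (lintegral_union_le _ _ _)))
    intro x hx
    by_cases a : ‖x‖ ≤ r
    · exact Or.inl ⟨hx, by simpa using a⟩
    · rw [not_le] at a
      by_cases b : ‖x‖ < R
      · exact Or.inr (Or.inl ⟨hx, a, b⟩)
      · exact Or.inr (Or.inr ⟨hx, not_lt.1 b, a⟩)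
  have hg1 : ∫⁻ x in ExtD r' ∩ closedBall 0 r, G x ≤
      ENNReal.ofReal (6 * C) * (L * ∫⁻ x in ExtD r', S x) := by
    calc _ ≤ ∫⁻ x in ExtD r' ∩ closedBall 0 r, ENNReal.ofReal (6 * C) * ENNReal.ofReal (‖u x‖ ^ 2) := by
          refine setLIntegral_mono' (hDm.inter measurableSet_closedBall) fun x hx => ?_
          rw [← ENNReal.ofReal_mul (by positivity)]
          refine ENNReal.ofReal_le_ofReal ?_
          have := hd1 x (by simpa using hx.2)
          gcongr
      _ = ENNReal.ofReal (6 * C) * ∫⁻ x in ExtD r' ∩ closedBall 0 r, ENNReal.ofReal (‖u x‖ ^ 2) :=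
          lintegral_const_mul' _ _ ENNReal.ofReal_ne_top
      _ ≤ _ := by
          gcongr
          exact hloc u hu hfin
  have hg2 : ∫⁻ x in ExtD r' ∩ {x | r < ‖x‖ ∧ ‖x‖ < R}, G x = 0 := by
    have hm : MeasurableSet (ExtD r' ∩ {x | r < ‖x‖ ∧ ‖x‖ < R}) :=
      hDm.inter ((measurableSet_lt measurable_const measurable_norm).inter
        (measurableSet_lt measurable_norm measurable_const))
    have hG : ∀ x ∈ ExtD r' ∩ {x | r < ‖x‖ ∧ ‖x‖ < R}, G x ≤ 0 := fun x hx => by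
      have : fderiv ℝ η x = 0 := hd2 x hx.2.1 hx.2.2
      simp only [G]
      rw [this]
      simp
    refine le_antisymm ((setLIntegral_mono' hm hG).trans ?_) bot_le
    simp
  have hg3 : ∫⁻ x in ExtD r' ∩ {x | R ≤ ‖x‖ ∧ r < ‖x‖}, G x ≤ ENNReal.ofReal (6 * C) *
      ∫⁻ x in ExtD r' ∩ {x | R ≤ ‖x‖}, ENNReal.ofReal (‖u x‖ ^ 2 / (1 + ‖x‖ ^ 2)) := by
    have hm : MeasurableSet (ExtD r' ∩ {x | R ≤ ‖x‖ ∧ r < ‖x‖}) :=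
      hDm.inter ((measurableSet_le measurable_const measurable_norm).inter
        (measurableSet_lt measurable_const measurable_norm))
    calc _ ≤ ∫⁻ x in ExtD r' ∩ {x | R ≤ ‖x‖ ∧ r < ‖x‖}, ENNReal.ofReal (6 * C) *
            ENNReal.ofReal (‖u x‖ ^ 2 / (1 + ‖x‖ ^ 2)) := by
          refine setLIntegral_mono' hm fun x hx => ?_
          rw [← ENNReal.ofReal_mul (by positivity)]
          refine ENNReal.ofReal_le_ofReal ?_
          have := hd3 x hx.2.1 hx.2.2
          calc 6 * ‖fderiv ℝ η x‖ ^ 2 * ‖u x‖ ^ 2 ≤ 6 * (C / (1 + ‖x‖ ^ 2)) * ‖u x‖ ^ 2 := by gcongr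
            _ = _ := by ring
      _ = _ := lintegral_const_mul' _ _ ENNReal.ofReal_ne_top
      _ ≤ _ := by
          gcongr ENNReal.ofReal (6 * C) * ?_
          exact lintegral_mono_set fun x hx => ⟨hx.1, hx.2.1⟩
  refine hleft.trans (hmain.trans ?_)
  refine (mul_le_mul_right (hright.trans (add_le_add le_rfl (hsplit.trans
    (add_le_add hg1 (add_le_add hg2.le hg3))))) K).trans (le_of_eq ?_)
  ring

lemma korn_ext {r' r : ℝ} (hr' : 0 < r') (hrr : r' < r) : ∃ K : ENNReal, K ≠ ⊤ ∧
    ∀ u : E3 → E3, ContDiffOn ℝ 1 u (ExtD r') →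
    ∫⁻ x in ExtD r', ENNReal.ofReal (‖u x‖ ^ 2 / (1 + ‖x‖ ^ 2)) ≠ ⊤ →
    ∫⁻ x in ExtD r, ENNReal.ofReal (frob2 (jac u x)) ≤
      K * ∫⁻ x in ExtD r', ENNReal.ofReal (frob2 (strain u x)) := by
  obtain ⟨K, L, hK, hL, h⟩ := korn_trunc hr' hrr
  refine ⟨K, hK, fun u hu hfin => ?_⟩
  have hb : ∀ m : ℕ, ∫⁻ x in ExtD r ∩ ball 0 (m : ℝ), ENNReal.ofReal (frob2 (jac u x)) ≤
      K * ∫⁻ x in ExtD r', ENNReal.ofReal (frob2 (strain u x)) := by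
    intro m
    have ht := tail_tendsto (ExtD r') (isOpen_ExtD r').measurableSet _ hfin
    have ht2 := (ENNReal.Tendsto.const_mul (a := L) ht (Or.inr hL)).const_add
      (K * ∫⁻ x in ExtD r', ENNReal.ofReal (frob2 (strain u x)))
    rw [mul_zero, add_zero] at ht2
    refine ge_of_tendsto ht2 ?_
    obtain ⟨n0, hn0⟩ := exists_nat_gt r
    filter_upwards [Filter.eventually_ge_atTop (max m (max n0 1))] with n hn
    have a1 : m ≤ n := (le_max_left _ _).trans hn
    have a2 : n0 ≤ n := (le_max_left _ _).trans ((le_max_right _ _).trans hn)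
    have a3 : 1 ≤ n := (le_max_right _ _).trans ((le_max_right _ _).trans hn)
    refine le_trans (lintegral_mono_set ?_) (h u hu hfin n ?_ ?_)
    · exact inter_subset_inter_right _ (ball_subset_ball (by exact_mod_cast a1))
    · have : (n0 : ℝ) ≤ n := by exact_mod_cast a2
      linarith
    · exact_mod_cast a3
  have hU : ExtD r = ⋃ m : ℕ, ExtD r ∩ ball 0 (m : ℝ) := by
    rw [← inter_iUnion, iUnion_ball_nat, inter_univ]
  rw [hU, setLIntegral_iUnion_of_directed]
  · exact iSup_le hb
  · refine Monotone.directed_le fun m n hmn => ?_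
    exact inter_subset_inter_right _ (ball_subset_ball (by exact_mod_cast hmn))

theorem korn_exterior_hemisphere (r' r : ℝ) (hr' : 0 < r') (hrr : r' < r) :
    ∃ c : ℝ, 0 < c ∧ ∀ u : E3 → E3,
      ContDiffOn ℝ 1 u {x : E3 | r' < ‖x‖ ∧ x 2 < 0} →
      IntegrableOn (fun x => ‖u x‖^2 / (1 + ‖x‖^2)) {x : E3 | r' < ‖x‖ ∧ x 2 < 0} →
      IntegrableOn (fun x => frob2 (jac u x)) {x : E3 | r' < ‖x‖ ∧ x 2 < 0} →
      (∫ x in {x : E3 | r < ‖x‖ ∧ x 2 < 0}, frob2 (jac u x)) ≤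
        c^2 * ∫ x in {x : E3 | r' < ‖x‖ ∧ x 2 < 0}, frob2 (strain u x) := by
  obtain ⟨K, hK, h⟩ := korn_ext hr' hrr
  refine ⟨Real.sqrt (K.toReal + 1), by positivity, fun u hu h1 h2 => ?_⟩
  rw [Real.sq_sqrt (by positivity)]
  have hk := h u hu h1.lintegral_lt_top.ne
  have hS : IntegrableOn (fun x => frob2 (strain u x)) (ExtD r') :=
    Integrable.mono' h2 (measurable_frob_strain u).aestronglyMeasurable
      (Filter.Eventually.of_forall fun x => by
        rw [Real.norm_of_nonneg (frob2_nonneg _)]; exact frob2_strain_le u x)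
  have hJ : IntegrableOn (fun x => frob2 (jac u x)) (ExtD r) :=
    IntegrableOn.mono_set h2 fun x hx => ⟨hrr.trans hx.1, hx.2⟩
  have e1 := ofReal_integral_eq_lintegral_ofReal hJ
    (Filter.Eventually.of_forall fun x => frob2_nonneg _)
  have e2 := ofReal_integral_eq_lintegral_ofReal hS
    (Filter.Eventually.of_forall fun x => frob2_nonneg _)
  rw [← e1, ← e2] at hk
  have hS0 : 0 ≤ ∫ x in ExtD r', frob2 (strain u x) := integral_nonneg fun x => frob2_nonneg _
  have hJ0 : 0 ≤ ∫ x in ExtD r, frob2 (jac u x) := integral_nonneg fun x => frob2_nonneg _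
  have hk2 := ENNReal.toReal_mono (ENNReal.mul_ne_top hK ENNReal.ofReal_ne_top) hk
  rw [ENNReal.toReal_mul, ENNReal.toReal_ofReal hS0, ENNReal.toReal_ofReal hJ0] at hk2
  change (∫ x in ExtD r, frob2 (jac u x)) ≤ (K.toReal + 1) * ∫ x in ExtD r', frob2 (strain u x)
  nlinarith

end
end

section
/- Let λ, μ ∈ ℝ with μ > 0 and 3λ + 2μ > 0. There exists θ* ∈ (0,1], depending only on λ and μ, such that for all ratios 0 < ρ₁ < ρ₂ < 1 there are constants c > 0 and δ ∈ (0,1), depending only on λ, μ, ρ₁, ρ₂, with the following property: for every bounded open set Ω ⊂ ℝ³, every twice continuously differentiable w : Ω → ℝ³ satisfying the Lamé system μΔw + (λ+μ)∇(div w) = 0 on Ω, every r̄ > 0 and 0 < r₃ ≤ θ* r̄, and every x ∈ Ω with dist(x, ∂Ω) > r̄, setting r₁ = ρ₁ r₃ and r₂ = ρ₂ r₃, one has ∫_{B_{r₂}(x)} |∇̂w|² ≤ c (∫_{B_{r₁}(x)} |∇̂w|²)^{δ} (∫_{B_{r₃}(x)} |∇̂w|²)^{1−δ}. -/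
open MeasureTheory Metric Set

noncomputable section

section TsHelpers
open scoped ContDiff Topology Convolution
open Filter

lemma ts_pd_contDiff {f : E3 → ℝ} {n m : WithTop ℕ∞} (hf : ContDiff ℝ n f) (h : m + 1 ≤ n) (k : Fin 3) :
    ContDiff ℝ m (pd f k) :=
  (hf.fderiv_right h).clm_apply contDiff_const

lemma ts_pd_smooth {f : E3 → ℝ} (hf : ContDiff ℝ ∞ f) (k : Fin 3) : ContDiff ℝ ∞ (pd f k) :=
  ts_pd_contDiff hf (by simp) k

lemma ts_pd_cont {f : E3 → ℝ} (hf : ContDiff ℝ 1 f) (k : Fin 3) : Continuous (pd f k) :=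
  (ts_pd_contDiff (m := 0) hf (by simp) k).continuous

lemma ts_sm_diff {f : E3 → ℝ} (hf : ContDiff ℝ ∞ f) (x : E3) : DifferentiableAt ℝ f x :=
  (hf.differentiable (by simp)) x

lemma ts_pd_mul {f g : E3 → ℝ} {x : E3} (hf : DifferentiableAt ℝ f x) (hg : DifferentiableAt ℝ g x)
    (k : Fin 3) : pd (fun y => f y * g y) k x = f x * pd g k x + g x * pd f k x := by
  unfold pd
  rw [fderiv_fun_mul hf hg]; simp

lemma ts_pd_add {f g : E3 → ℝ} {x : E3} (hf : DifferentiableAt ℝ f x) (hg : DifferentiableAt ℝ g x)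
    (k : Fin 3) : pd (fun y => f y + g y) k x = pd f k x + pd g k x := by
  unfold pd
  rw [fderiv_fun_add hf hg]; simp

lemma ts_pd_sub {f g : E3 → ℝ} {x : E3} (hf : DifferentiableAt ℝ f x) (hg : DifferentiableAt ℝ g x)
    (k : Fin 3) : pd (fun y => f y - g y) k x = pd f k x - pd g k x := by
  unfold pd
  rw [fderiv_fun_sub hf hg]; simp

lemma ts_pd_const_mul {f : E3 → ℝ} {x : E3} (hf : DifferentiableAt ℝ f x) (c : ℝ)
    (k : Fin 3) : pd (fun y => c * f y) k x = c * pd f k x := by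
  unfold pd
  rw [fderiv_const_mul hf]; simp

lemma ts_pd_sum {f : Fin 3 → E3 → ℝ} {x : E3} (hf : ∀ i, DifferentiableAt ℝ (f i) x)
    (k : Fin 3) : pd (fun y => ∑ i, f i y) k x = ∑ i, pd (f i) k x := by
  unfold pd
  rw [fderiv_fun_sum (fun i _ => hf i)]; simp

lemma ts_pd_congr {f g : E3 → ℝ} {x : E3} (h : f =ᶠ[𝓝 x] g) (k : Fin 3) : pd f k x = pd g k x := by
  unfold pd
  rw [h.fderiv_eq]

lemma ts_coord_smooth (i : Fin 3) : ContDiff ℝ ∞ (fun y : E3 => y i) :=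
  (EuclideanSpace.proj (𝕜 := ℝ) i : E3 →L[ℝ] ℝ).contDiff

lemma ts_pd_coord (i k : Fin 3) (x : E3) : pd (fun y : E3 => y i) k x = if i = k then 1 else 0 := by
  unfold pd
  have : fderiv ℝ (fun y : E3 => y i) x = (EuclideanSpace.proj (𝕜 := ℝ) i : E3 →L[ℝ] ℝ) :=
    (EuclideanSpace.proj (𝕜 := ℝ) i : E3 →L[ℝ] ℝ).fderiv
  rw [this]
  simp [Pi.single_apply, eq_comm]

lemma ts_pd_comm {f : E3 → ℝ} (hf : ContDiff ℝ 2 f) (i j : Fin 3) (x : E3) :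
    pd (pd f i) j x = pd (pd f j) i x := by
  have hd : DifferentiableAt ℝ (fderiv ℝ f) x :=
    (hf.fderiv_right (m := 1) (by norm_num)).differentiable (by simp) x
  have h : ∀ v w : E3, fderiv ℝ (fun y => fderiv ℝ f y v) x w = fderiv ℝ (fderiv ℝ f) x w v := by
    intro v w
    rw [fderiv_clm_apply hd (differentiableAt_const _)]
    simp
  unfold pd
  rw [h, h]
  exact (hf.contDiffAt.isSymmSndFDerivAt (by simp)) _ _

lemma ts_pd_aff {f : E3 → ℝ} {x : E3} (a : E3) (r : ℝ) (hf : DifferentiableAt ℝ f (a + r • x)) (k : Fin 3) :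
    pd (fun y => f (a + r • y)) k x = r * pd f k (a + r • x) := by
  unfold pd
  have h1 : HasFDerivAt (fun y : E3 => a + r • y) (r • ContinuousLinearMap.id ℝ E3) x := by
    simpa using ((hasFDerivAt_id x).const_smul r).const_add a
  have := (hf.hasFDerivAt.comp x h1).fderiv
  simp only [Function.comp_def] at this
  rw [this]; simp

lemma ts_pd_scale {f : E3 → ℝ} {x : E3} (r : ℝ) (hf : DifferentiableAt ℝ f (r • x)) (k : Fin 3) :
    pd (fun y => f (r • y)) k x = r * pd f k (r • x) := by
  have := ts_pd_aff (f := f) (x := x) 0 r (by simpa using hf) k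
  simpa using this

lemma ts_pd_supp {f : E3 → ℝ} (hf : HasCompactSupport f) (k : Fin 3) : HasCompactSupport (pd f k) :=
  (hf.fderiv ℝ).comp_left (g := fun L : E3 →L[ℝ] ℝ => L (EuclideanSpace.single k 1)) (by simp)

lemma ts_ibp {f g : E3 → ℝ} (hf : ContDiff ℝ 1 f) (hg : ContDiff ℝ 1 g) (hc : HasCompactSupport f)
    (k : Fin 3) : ∫ x, f x * pd g k x = - ∫ x, pd f k x * g x := by
  unfold pd
  have c1 := ts_pd_cont hf k
  have c2 := ts_pd_cont hg k
  apply integral_mul_fderiv_eq_neg_fderiv_mul_of_integrable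
  · exact (c1.mul hg.continuous).integrable_of_hasCompactSupport ((ts_pd_supp hc k).mul_right)
  · exact (hf.continuous.mul c2).integrable_of_hasCompactSupport (hc.mul_right)
  · exact (hf.continuous.mul hg.continuous).integrable_of_hasCompactSupport (hc.mul_right)
  · exact fun x _ => hf.differentiable (by simp) x
  · exact fun x _ => hg.differentiable (by simp) x

/-- Derivative of a weighted integral. -/
lemma ts_deriv_int {ψ : E3 → ℝ} (hψ : Continuous ψ) (hc : HasCompactSupport ψ)
    {K K' : ℝ → E3 → ℝ} (hK : ∀ t, Continuous (K t)) (hK' : Continuous (fun p : ℝ × E3 => K' p.1 p.2))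
    (hd : ∀ t x, HasDerivAt (fun s => K s x) (K' t x) t) (t : ℝ) :
    HasDerivAt (fun s => ∫ x, ψ x * K s x) (∫ x, ψ x * K' t x) t := by
  obtain ⟨C, hC⟩ := ((isCompact_closedBall t 1).prod hc.isCompact).exists_bound_of_continuousOn
    hK'.continuousOn
  have hK't : ∀ t, Continuous (K' t) := fun t => hK'.comp (by fun_prop : Continuous fun x : E3 => (t, x))
  refine (hasDerivAt_integral_of_dominated_loc_of_deriv_le (μ := volume)
    (F := fun s x => ψ x * K s x) (F' := fun s x => ψ x * K' s x)
    (bound := fun x => ‖ψ x‖ * C) (closedBall_mem_nhds t one_pos) ?_ ?_ ?_ ?_ ?_ ?_).2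
  · exact Eventually.of_forall fun s => (hψ.mul (hK s)).aestronglyMeasurable
  · exact (hψ.mul (hK t)).integrable_of_hasCompactSupport hc.mul_right
  · exact (hψ.mul (hK't t)).aestronglyMeasurable
  · refine Eventually.of_forall fun x s hs => ?_
    rw [norm_mul]
    by_cases hx : x ∈ tsupport ψ
    · exact mul_le_mul_of_nonneg_left (hC (s, x) ⟨hs, hx⟩) (norm_nonneg _)
    · simp [image_eq_zero_of_notMem_tsupport hx]
  · exact (hψ.norm.mul continuous_const).integrable_of_hasCompactSupport hc.norm.mul_right
  · exact Eventually.of_forall fun x s _ => (hd s x).const_mul _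

def tsHarm (f : E3 → ℝ) : Prop := ∀ x ∈ ball (0 : E3) 1, ∑ k, pd (pd f k) k x = 0

def tsPsi (x : E3) : ℝ := max (1 - ‖x‖ ^ 2) 0

def tsPhi (x : E3) : ℝ := -(1 / 4) * (max (1 - ‖x‖ ^ 2) 0) ^ 2

lemma ts_maxsq_deriv (t : ℝ) : HasDerivAt (fun s : ℝ => (max s 0) ^ 2) (2 * max t 0) t := by
  rcases lt_trichotomy t 0 with h | h | h
  · rw [max_eq_right h.le, mul_zero]
    refine (hasDerivAt_const t (0 : ℝ)).congr_of_eventuallyEq ?_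
    filter_upwards [Iio_mem_nhds h] with s hs
    have hs' : s ≤ 0 := le_of_lt (mem_Iio.1 hs)
    simp [max_eq_right hs']
  · subst h
    simp only [max_self, mul_zero]
    rw [hasDerivAt_iff_isLittleO]
    simp only [max_self, sub_zero, smul_zero]
    have : (fun x' : ℝ => x' ^ 2) =o[𝓝 0] fun x' => x' := by
      simpa using Asymptotics.isLittleO_pow_pow (𝕜 := ℝ) (m := 1) (n := 2) (by norm_num)
    refine Asymptotics.IsBigO.trans_isLittleO ?_ this
    refine Asymptotics.IsBigO.of_bound 1 (Eventually.of_forall fun s => ?_)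
    simp only [ne_eq, OfNat.ofNat_ne_zero, not_false_eq_true, zero_pow, sub_zero, norm_pow, Real.norm_eq_abs, sq_abs, one_mul]
    rcases le_total s 0 with h | h
    · simp [max_eq_right h]; positivity
    · simp [max_eq_left h]
  · rw [max_eq_left h.le]
    have : HasDerivAt (fun s : ℝ => s ^ 2) (2 * t) t := by simpa using hasDerivAt_pow 2 t
    refine this.congr_of_eventuallyEq ?_
    filter_upwards [Ioi_mem_nhds h] with s hs
    have hs' : 0 ≤ s := le_of_lt (mem_Ioi.1 hs)
    simp [max_eq_left hs']

lemma ts_maxsq_C1 : ContDiff ℝ 1 (fun s : ℝ => (max s 0) ^ 2) := by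
  rw [contDiff_one_iff_deriv]
  refine ⟨fun t => (ts_maxsq_deriv t).differentiableAt, ?_⟩
  have : deriv (fun s : ℝ => (max s 0) ^ 2) = fun t => 2 * max t 0 :=
    funext fun t => (ts_maxsq_deriv t).deriv
  rw [this]; fun_prop

lemma ts_nsq_smooth : ContDiff ℝ ∞ (fun x : E3 => 1 - ‖x‖ ^ 2) :=
  contDiff_const.sub (contDiff_norm_sq ℝ)

lemma ts_phi_C1 : ContDiff ℝ 1 tsPhi :=
  contDiff_const.mul (ts_maxsq_C1.comp (ts_nsq_smooth.of_le (by simp)))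

lemma ts_psi_cont : Continuous tsPsi := by unfold tsPsi; fun_prop

lemma ts_psi_zero {x : E3} (hx : x ∉ ball (0 : E3) 1) : tsPsi x = 0 := by
  simp only [mem_ball, dist_zero_right, not_lt] at hx
  unfold tsPsi
  apply max_eq_right; nlinarith

lemma ts_phi_zero {x : E3} (hx : x ∉ ball (0 : E3) 1) : tsPhi x = 0 := by
  have := ts_psi_zero hx
  unfold tsPsi at this
  simp [tsPhi, this]

lemma ts_psi_supp : HasCompactSupport tsPsi :=
  HasCompactSupport.intro (isCompact_closedBall (0 : E3) 1)
    fun _ hx => ts_psi_zero fun h => hx (ball_subset_closedBall h)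

lemma ts_phi_supp : HasCompactSupport tsPhi :=
  HasCompactSupport.intro (isCompact_closedBall (0 : E3) 1)
    fun _ hx => ts_phi_zero fun h => hx (ball_subset_closedBall h)

lemma ts_pd_phi (k : Fin 3) (x : E3) : pd tsPhi k x = x k * tsPsi x := by
  have h1 : HasFDerivAt (fun x : E3 => 1 - ‖x‖ ^ 2) (-(2 • innerSL ℝ x)) x := by
    simpa using (HasStrictFDerivAt.hasFDerivAt (hasStrictFDerivAt_norm_sq x)).const_sub 1
  have h2 := ((ts_maxsq_deriv (1 - ‖x‖ ^ 2)).comp_hasFDerivAt x h1).const_mul (-(1/4))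
  unfold pd
  have h3 : fderiv ℝ tsPhi x = _ := h2.fderiv
  rw [h3]
  have : inner ℝ x (EuclideanSpace.single k (1:ℝ)) = x k := by
    simp [EuclideanSpace.inner_single_right]
  simp [this, tsPsi]
  ring

lemma ts_green {F G : E3 → ℝ} (hF : ContDiff ℝ ∞ F) (hG : ContDiff ℝ ∞ G) (aF : tsHarm F) (aG : tsHarm G) :
    ∫ x, tsPsi x * (∑ k, x k * (G x * pd F k x - F x * pd G k x)) = 0 := by
  have hV : ∀ k, ContDiff ℝ ∞ (fun x => G x * pd F k x - F x * pd G k x) := fun k =>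
    (hG.mul (ts_pd_smooth hF k)).sub (hF.mul (ts_pd_smooth hG k))
  have hVd : ∀ k x, pd (fun x => G x * pd F k x - F x * pd G k x) k x
      = G x * pd (pd F k) k x - F x * pd (pd G k) k x := by
    intro k x
    have a1 := ts_sm_diff hF x
    have a2 := ts_sm_diff hG x
    have a3 := ts_sm_diff (ts_pd_smooth hF k) x
    have a4 := ts_sm_diff (ts_pd_smooth hG k) x
    rw [ts_pd_sub (a2.fun_mul a3) (a1.fun_mul a4), ts_pd_mul a2 a3, ts_pd_mul a1 a4]
    ring
  have hint : ∀ k, Integrable (fun x => tsPhi x * pd (fun x => G x * pd F k x - F x * pd G k x) k x) := fun k =>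
    (ts_phi_C1.continuous.mul (ts_pd_smooth (hV k) k).continuous).integrable_of_hasCompactSupport
      ts_phi_supp.mul_right
  have hint2 : ∀ k, Integrable (fun x => pd tsPhi k x * (G x * pd F k x - F x * pd G k x)) := fun k =>
    ((ts_pd_cont ts_phi_C1 k).mul (hV k).continuous).integrable_of_hasCompactSupport
      (ts_pd_supp ts_phi_supp k).mul_right
  calc ∫ x, tsPsi x * (∑ k, x k * (G x * pd F k x - F x * pd G k x))
      = ∫ x, ∑ k, pd tsPhi k x * (G x * pd F k x - F x * pd G k x) := by
        congr 1; ext x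
        rw [Finset.mul_sum]
        refine Finset.sum_congr rfl fun k _ => ?_
        rw [ts_pd_phi]; ring
    _ = ∑ k, ∫ x, pd tsPhi k x * (G x * pd F k x - F x * pd G k x) :=
        integral_finsetSum _ fun k _ => hint2 k
    _ = ∑ k, -∫ x, tsPhi x * pd (fun x => G x * pd F k x - F x * pd G k x) k x := by
        refine Finset.sum_congr rfl fun k _ => ?_
        rw [ts_ibp ts_phi_C1 ((hV k).of_le (by simp)) ts_phi_supp k, neg_neg]
    _ = -∫ x, ∑ k, tsPhi x * pd (fun x => G x * pd F k x - F x * pd G k x) k x := by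
        rw [integral_finsetSum _ fun k _ => hint k, Finset.sum_neg_distrib]
    _ = 0 := by
        rw [neg_eq_zero]
        apply integral_eq_zero_of_ae
        refine Eventually.of_forall fun x => ?_
        by_cases hx : x ∈ ball (0 : E3) 1
        · simp only [hVd, ← Finset.mul_sum, Finset.sum_sub_distrib, aF x hx, aG x hx]
          simp
        · simp [ts_phi_zero hx]

lemma ts_fderiv_eq (f : E3 → ℝ) (y x : E3) : fderiv ℝ f y x = ∑ k, x k * pd f k y := by
  unfold pd
  conv_lhs => rw [← (EuclideanSpace.basisFun (Fin 3) ℝ).sum_repr x]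
  simp [map_sum]

lemma ts_scale_smooth {f : E3 → ℝ} (hf : ContDiff ℝ ∞ f) (r : ℝ) : ContDiff ℝ ∞ (fun x => f (r • x)) :=
  hf.comp (contDiff_const_smul r)

lemma ts_scale_harm {f : E3 → ℝ} (hf : ContDiff ℝ ∞ f) (af : tsHarm f) {r : ℝ} (h0 : 0 ≤ r) (h1 : r ≤ 1) :
    tsHarm (fun x => f (r • x)) := by
  intro x hx
  have e : ∀ k, pd (fun x => f (r • x)) k = fun x => r * pd f k (r • x) := fun k =>
    funext fun y => ts_pd_scale r (ts_sm_diff hf _) k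
  have e2 : ∀ k, pd (pd (fun x => f (r • x)) k) k x = r * (r * pd (pd f k) k (r • x)) := by
    intro k
    rw [e, ts_pd_const_mul (ts_sm_diff (ts_scale_smooth (ts_pd_smooth hf k) r) x),
      ts_pd_scale r (ts_sm_diff (ts_pd_smooth hf k) _)]
  simp only [e2, ← Finset.mul_sum]
  rw [af (r • x)]
  · simp
  · simp only [mem_ball, dist_zero_right] at hx ⊢
    rw [norm_smul, Real.norm_of_nonneg h0]
    nlinarith [norm_nonneg x]

lemma ts_const {f : E3 → ℝ} (hf : ContDiff ℝ ∞ f) (af : tsHarm f) {m T : ℝ} (hm : 0 ≤ m) (hT : 0 ≤ T)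
    (h1 : m * Real.exp T ≤ 1) :
    ∫ x, tsPsi x * (f ((m * Real.exp T) • x) * f ((m * Real.exp (-T)) • x))
      = ∫ x, tsPsi x * (f (m • x) * f (m • x)) := by
  set K : ℝ → E3 → ℝ := fun t x => f ((m * Real.exp t) • x) * f ((m * Real.exp (-t)) • x) with hK
  set K' : ℝ → E3 → ℝ := fun t x =>
    ((m * Real.exp t) * ∑ k, x k * pd f k ((m * Real.exp t) • x)) * f ((m * Real.exp (-t)) • x)
    + f ((m * Real.exp t) • x) * (-(m * Real.exp (-t)) * ∑ k, x k * pd f k ((m * Real.exp (-t)) • x)) with hK'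
  have fc := hf.continuous
  have pc : ∀ k, Continuous (pd f k) := fun k => (ts_pd_smooth hf k).continuous
  have hd : ∀ t x, HasDerivAt (fun s => K s x) (K' t x) t := by
    intro t x
    have b1 : HasDerivAt (fun s => (m * Real.exp s) • x) ((m * Real.exp t) • x) t :=
      ((Real.hasDerivAt_exp t).const_mul m).smul_const x
    have b2 : HasDerivAt (fun s => (m * Real.exp (-s)) • x) ((-(m * Real.exp (-t))) • x) t := by
      have := (((hasDerivAt_neg t).exp).const_mul m).smul_const x
      simpa using this
    have c1 := (ts_sm_diff hf ((m * Real.exp t) • x)).hasFDerivAt.comp_hasDerivAt t b1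
    have c2 := (ts_sm_diff hf ((m * Real.exp (-t)) • x)).hasFDerivAt.comp_hasDerivAt t b2
    have := c1.mul c2
    rw [map_smul, map_smul, ts_fderiv_eq, ts_fderiv_eq] at this
    exact this
  have hder := fun t => ts_deriv_int ts_psi_cont ts_psi_supp (K := K) (K' := K')
    (fun t => by simp only [hK]; fun_prop) (by simp only [hK']; fun_prop) hd t
  have hz : ∀ t ∈ Icc (0:ℝ) T, ∫ x, tsPsi x * K' t x = 0 := by
    intro t ht
    have r1 : m * Real.exp t ≤ 1 :=
      le_trans (mul_le_mul_of_nonneg_left (Real.exp_le_exp.2 ht.2) hm) h1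
    have r2 : m * Real.exp (-t) ≤ 1 :=
      le_trans (mul_le_mul_of_nonneg_left (Real.exp_le_exp.2 (by linarith [ht.1, ht.2])) hm) h1
    have p1 : 0 ≤ m * Real.exp t := by positivity
    have p2 : 0 ≤ m * Real.exp (-t) := by positivity
    rw [← ts_green (ts_scale_smooth hf (m * Real.exp t)) (ts_scale_smooth hf (m * Real.exp (-t)))
      (ts_scale_harm hf af p1 r1) (ts_scale_harm hf af p2 r2)]
    congr 1; ext x
    simp only [ts_pd_scale _ (ts_sm_diff hf _), hK', Fin.sum_univ_three]
    ring
  have := constant_of_has_deriv_right_zero (f := fun s => ∫ x, tsPsi x * K s x) (a := 0) (b := T)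
    (fun t _ => (hder t).continuousAt.continuousWithinAt)
    (fun t ht => by
      have := (hder t).hasDerivWithinAt (s := Ici t)
      rwa [hz t ⟨ht.1, ht.2.le⟩] at this) T ⟨hT, le_rfl⟩
  simpa [hK] using this

def tsA (f : E3 → ℝ) (r : ℝ) : ℝ := ∫ x, tsPsi x * (f (r • x)) ^ 2

lemma ts_A_nonneg (f : E3 → ℝ) (r : ℝ) : 0 ≤ tsA f r :=
  integral_nonneg fun x => mul_nonneg (le_max_right _ _) (sq_nonneg _)

lemma ts_CS {F G : E3 → ℝ} (hF : Continuous F) (hG : Continuous G) :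
    (∫ x, tsPsi x * (F x * G x)) ^ 2 ≤ (∫ x, tsPsi x * F x ^ 2) * (∫ x, tsPsi x * G x ^ 2) := by
  have i1 : Integrable (fun x => tsPsi x * F x ^ 2) :=
    (ts_psi_cont.mul (hF.pow 2)).integrable_of_hasCompactSupport ts_psi_supp.mul_right
  have i2 : Integrable (fun x => tsPsi x * G x ^ 2) :=
    (ts_psi_cont.mul (hG.pow 2)).integrable_of_hasCompactSupport ts_psi_supp.mul_right
  have i3 : Integrable (fun x => tsPsi x * (F x * G x)) :=
    (ts_psi_cont.mul (hF.mul hG)).integrable_of_hasCompactSupport ts_psi_supp.mul_right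
  have h : ∀ t : ℝ, 0 ≤ (∫ x, tsPsi x * F x ^ 2) * (t * t) + (2 * ∫ x, tsPsi x * (F x * G x)) * t
      + ∫ x, tsPsi x * G x ^ 2 := by
    intro t
    have : ∫ x, tsPsi x * (t * F x + G x) ^ 2 = (∫ x, tsPsi x * F x ^ 2) * (t * t)
        + (2 * ∫ x, tsPsi x * (F x * G x)) * t + ∫ x, tsPsi x * G x ^ 2 := by
      have e : (fun x => tsPsi x * (t * F x + G x) ^ 2) = fun x =>
          (t * t) * (tsPsi x * F x ^ 2) + (2 * t) * (tsPsi x * (F x * G x)) + tsPsi x * G x ^ 2 := by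
        ext x; ring
      have i12 : Integrable (fun x => (t * t) * (tsPsi x * F x ^ 2) + (2 * t) * (tsPsi x * (F x * G x))) :=
        (i1.const_mul _).add (i3.const_mul _)
      rw [e, integral_add i12 i2,
        integral_add (i1.const_mul _) (i3.const_mul _), integral_const_mul, integral_const_mul]
      ring
    rw [← this]
    exact integral_nonneg fun x => mul_nonneg (le_max_right _ _) (sq_nonneg _)
  have := discrim_le_zero h
  unfold discrim at this
  nlinarith

lemma ts_logconv {f : E3 → ℝ} (hf : ContDiff ℝ ∞ f) (af : tsHarm f) {a m σ : ℝ} (ha : 0 < a) (hm : a ≤ m)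
    (hσ : σ ≤ 1) (h : m ^ 2 = a * σ) : tsA f m ^ 2 ≤ tsA f a * tsA f σ := by
  have hm0 : 0 < m := ha.trans_le hm
  have hms : m ≤ σ := by nlinarith
  have hs0 : 0 < σ := hm0.trans_le hms
  have e1 : m * Real.exp (Real.log (σ / m)) = σ := by
    rw [Real.exp_log (by positivity)]; field_simp
  have e2 : m * Real.exp (-Real.log (σ / m)) = a := by
    rw [Real.exp_neg, Real.exp_log (by positivity)]; field_simp; linarith
  have := ts_const hf af (m := m) (T := Real.log (σ / m)) hm0.le
    (Real.log_nonneg ((one_le_div hm0).2 hms)) (by rw [e1]; exact hσ)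
  rw [e1, e2] at this
  have h2 : tsA f m = ∫ x, tsPsi x * (f (σ • x) * f (a • x)) := by
    rw [this]; unfold tsA; simp only [sq]
  rw [h2, mul_comm (tsA f a)]
  exact ts_CS (ts_scale_smooth hf σ).continuous (ts_scale_smooth hf a).continuous

lemma ts_iter {f : E3 → ℝ} (hf : ContDiff ℝ ∞ f) (af : tsHarm f) {a σ : ℝ} (ha : 0 < a) (has : a < σ)
    (hσ : σ ≤ 1) (k : ℕ) :
    tsA f (σ * (a / σ) ^ ((1 / 2 : ℝ) ^ k)) ≤
      tsA f a ^ ((1 / 2 : ℝ) ^ k) * tsA f σ ^ (1 - (1 / 2 : ℝ) ^ k) := by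
  have hs0 : 0 < σ := ha.trans has
  have hq : 0 < a / σ := by positivity
  have hq1 : a / σ < 1 := (div_lt_one hs0).2 has
  induction k with
  | zero =>
    have : σ * (a / σ) = a := by field_simp
    simp [this]
  | succ k ih =>
    set d : ℝ := (1 / 2 : ℝ) ^ (k + 1) with hd
    have hd0 : 0 < d := by positivity
    have hd2 : (1 / 2 : ℝ) ^ k = d + d := by rw [hd, pow_succ]; ring
    have hd1 : d + d ≤ 1 := by rw [← hd2]; exact pow_le_one₀ (by norm_num) (by norm_num)
    rw [hd2] at ih
    have hpos : 0 < (a / σ) ^ d := Real.rpow_pos_of_pos hq _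
    have hp2 : (a / σ) ^ (d + d) = (a / σ) ^ d * (a / σ) ^ d := Real.rpow_add hq _ _
    have hle : (a / σ) ^ d ≤ 1 := Real.rpow_le_one hq.le hq1.le hd0.le
    have h1 := ts_logconv hf af (a := σ * (a / σ) ^ (d + d)) (m := σ * (a / σ) ^ d) (σ := σ)
      (by positivity) (by rw [hp2]; exact mul_le_mul_of_nonneg_left (by nlinarith) hs0.le) hσ
      (by rw [hp2]; ring)
    have na := ts_A_nonneg f a
    have ns := ts_A_nonneg f σ
    have h2 : tsA f (σ * (a / σ) ^ d) ^ 2 ≤ (tsA f a ^ d * tsA f σ ^ (1 - d)) ^ 2 := by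
      refine h1.trans ((mul_le_mul_of_nonneg_right ih ns).trans (le_of_eq ?_))
      have e1 : tsA f a ^ (d + d) = tsA f a ^ d * tsA f a ^ d :=
        Real.rpow_add_of_nonneg na hd0.le hd0.le
      have e2 : tsA f σ ^ (1 - (d + d)) * tsA f σ = tsA f σ ^ (1 - d) * tsA f σ ^ (1 - d) := by
        rw [← Real.rpow_add_of_nonneg ns (by linarith) (by linarith)]
        nth_rewrite 2 [← Real.rpow_one (tsA f σ)]
        rw [← Real.rpow_add_of_nonneg ns (by linarith) (by linarith)]
        congr 1; ring
      rw [mul_assoc, e1, e2]; ring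
    exact le_of_sq_le_sq h2 (by positivity)

lemma ts_ball_scale (g : E3 → ℝ) {R : ℝ} (hR : 0 < R) (r : ℝ) :
    ∫ x in ball (0 : E3) r, g (R • x) = (R ^ 3)⁻¹ * ∫ x in ball (0 : E3) (R * r), g x := by
  rw [Measure.setIntegral_comp_smul_of_pos volume g _ hR, _root_.smul_ball hR.ne']
  simp [abs_of_pos hR]

lemma ts_int_on {g : E3 → ℝ} (hg : Continuous g) (r : ℝ) : IntegrableOn g (ball (0 : E3) r) :=
  (hg.continuousOn.integrableOn_compact (isCompact_closedBall 0 r)).mono_set ball_subset_closedBall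

lemma ts_sq_nonneg (f : E3 → ℝ) (r : ℝ) : 0 ≤ ∫ x in ball (0 : E3) r, f x ^ 2 :=
  setIntegral_nonneg measurableSet_ball fun _ _ => sq_nonneg _

lemma ts_A_le {f : E3 → ℝ} (hf : Continuous f) {r : ℝ} (hr : 0 < r) :
    tsA f r ≤ (r ^ 3)⁻¹ * ∫ x in ball (0 : E3) r, f x ^ 2 := by
  have h := ts_ball_scale (fun x => f x ^ 2) hr 1
  rw [mul_one] at h
  rw [← h]
  unfold tsA
  have hc : Continuous fun x : E3 => f (r • x) := by fun_prop
  rw [← setIntegral_eq_integral_of_forall_compl_eq_zero (s := ball (0 : E3) 1)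
    (fun x hx => by rw [ts_psi_zero hx, zero_mul])]
  refine setIntegral_mono (ts_int_on (ts_psi_cont.mul (hc.pow 2)) 1) (ts_int_on (hc.pow 2) 1) fun x => ?_
  have : tsPsi x ≤ 1 := max_le (by nlinarith [norm_nonneg x]) zero_le_one
  nlinarith [sq_nonneg (f (r • x))]

lemma ts_le_A {f : E3 → ℝ} (hf : Continuous f) {b s : ℝ} (hb : 0 < b) (hbs : b < s) :
    ∫ x in ball (0 : E3) b, f x ^ 2 ≤ s ^ 3 * (1 - (b / s) ^ 2)⁻¹ * tsA f s := by
  have hs : 0 < s := hb.trans hbs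
  have h := ts_ball_scale (fun x => f x ^ 2) hs (b / s)
  have e : s * (b / s) = b := by field_simp
  rw [e] at h
  have hq : 0 < b / s := by positivity
  have hq1 : b / s < 1 := (div_lt_one hs).2 hbs
  have hd : 0 < 1 - (b / s) ^ 2 := by nlinarith
  have hc : Continuous fun x : E3 => f (s • x) := by fun_prop
  have h2 : (1 - (b / s) ^ 2) * ∫ x in ball (0 : E3) (b / s), f (s • x) ^ 2 ≤ tsA f s := by
    rw [← integral_const_mul]
    have i1 : Integrable (fun x => tsPsi x * f (s • x) ^ 2) :=
      (ts_psi_cont.mul (hc.pow 2)).integrable_of_hasCompactSupport ts_psi_supp.mul_right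
    refine le_trans ?_ (setIntegral_le_integral (s := ball (0 : E3) (b / s)) i1
      (Eventually.of_forall fun x => mul_nonneg (le_max_right _ _) (sq_nonneg _)))
    refine setIntegral_mono_on (ts_int_on (continuous_const.mul (hc.pow 2)) _) i1.integrableOn
      measurableSet_ball fun x hx => ?_
    refine mul_le_mul_of_nonneg_right ?_ (sq_nonneg _)
    rw [mem_ball, dist_zero_right] at hx
    exact le_trans (by nlinarith [norm_nonneg x]) (le_max_left _ _)
  have h3 : ∫ x in ball (0 : E3) b, f x ^ 2 = s ^ 3 * ∫ x in ball (0 : E3) (b / s), f (s • x) ^ 2 := by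
    rw [h]; field_simp
  rw [h3, mul_assoc]
  refine mul_le_mul_of_nonneg_left ?_ (by positivity)
  rw [inv_mul_eq_div, le_div_iff₀ hd]; linarith

/-- Three balls inequality for harmonic functions. -/
lemma ts_three_harm {a b σ : ℝ} (ha : 0 < a) (hab : a < b) (hbs : b < σ) (hσ : σ ≤ 1) :
    ∃ C δ : ℝ, 0 < C ∧ 0 < δ ∧ δ < 1 ∧ ∀ f : E3 → ℝ, ContDiff ℝ ∞ f → tsHarm f →
      ∫ x in ball (0 : E3) b, f x ^ 2 ≤
        C * (∫ x in ball (0 : E3) a, f x ^ 2) ^ δ * (∫ x in ball (0 : E3) σ, f x ^ 2) ^ (1 - δ) := by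
  have hb : 0 < b := ha.trans hab
  have hs0 : 0 < σ := hb.trans hbs
  have hq : 0 < a / σ := by positivity
  have hlim : Tendsto (fun k : ℕ => σ * (a / σ) ^ ((1 / 2 : ℝ) ^ k)) atTop (𝓝 σ) := by
    have h1 : Tendsto (fun k : ℕ => ((1 / 2 : ℝ) ^ k)) atTop (𝓝 0) :=
      tendsto_pow_atTop_nhds_zero_of_lt_one (by norm_num) (by norm_num)
    have h2 := ((Real.continuousAt_const_rpow (a := a / σ) (b := 0) hq.ne').tendsto.comp h1).const_mul σ
    simpa [Function.comp_def] using h2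
  obtain ⟨k, hk1, hk2⟩ := ((hlim.eventually (lt_mem_nhds hbs)).and (eventually_ge_atTop 1)).exists
  set d : ℝ := (1 / 2 : ℝ) ^ k with hd
  set s := σ * (a / σ) ^ d with hs
  have hd0 : 0 < d := by positivity
  have hd1 : d < 1 := pow_lt_one₀ (by norm_num) (by norm_num) (by omega)
  have hsp : 0 < s := hb.trans hk1
  have hq0 : 0 < b / s := by positivity
  have hq1 : b / s < 1 := (div_lt_one hsp).2 hk1
  have hdd : 0 < 1 - (b / s) ^ 2 := by nlinarith
  refine ⟨s ^ 3 * (1 - (b / s) ^ 2)⁻¹ * ((a ^ 3)⁻¹ ^ d * (σ ^ 3)⁻¹ ^ (1 - d)), d, by positivity, hd0, hd1,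
    fun f hf af => ?_⟩
  have fc := hf.continuous
  have Xa := ts_sq_nonneg f a
  have Xs := ts_sq_nonneg f σ
  have na := ts_A_nonneg f a
  have ns := ts_A_nonneg f σ
  calc _ ≤ s ^ 3 * (1 - (b / s) ^ 2)⁻¹ * tsA f s := ts_le_A fc hb hk1
    _ ≤ s ^ 3 * (1 - (b / s) ^ 2)⁻¹ * (tsA f a ^ d * tsA f σ ^ (1 - d)) :=
      mul_le_mul_of_nonneg_left (ts_iter hf af ha (hab.trans hbs) hσ k) (by positivity)
    _ ≤ s ^ 3 * (1 - (b / s) ^ 2)⁻¹ * (((a ^ 3)⁻¹ * ∫ x in ball (0 : E3) a, f x ^ 2) ^ d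
          * ((σ ^ 3)⁻¹ * ∫ x in ball (0 : E3) σ, f x ^ 2) ^ (1 - d)) := by
      refine mul_le_mul_of_nonneg_left ?_ (by positivity)
      refine mul_le_mul (Real.rpow_le_rpow na (ts_A_le fc ha) hd0.le)
        (Real.rpow_le_rpow ns (ts_A_le fc hs0) (by linarith)) (by positivity) (by positivity)
    _ = _ := by
      rw [Real.mul_rpow (by positivity) Xa, Real.mul_rpow (by positivity) Xs]; ring

/-- Caccioppoli. -/
lemma ts_cacc {a b : ℝ} (ha : 0 < a) (hab : a < b) (hb1 : b ≤ 1) :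
    ∃ C : ℝ, 0 < C ∧ ∀ f : E3 → ℝ, ContDiff ℝ ∞ f → tsHarm f → ∀ j,
      ∫ x in ball (0 : E3) a, (pd f j x) ^ 2 ≤ C * ∫ x in ball (0 : E3) b, f x ^ 2 := by
  let ζ : ContDiffBump (0 : E3) := ⟨a, (a + b) / 2, ha, by linarith⟩
  have hζ : ContDiff ℝ ∞ (ζ : E3 → ℝ) := ζ.contDiff
  have hζc : HasCompactSupport (ζ : E3 → ℝ) := ζ.hasCompactSupport
  have hts : tsupport (ζ : E3 → ℝ) ⊆ ball 0 b := by
    rw [ζ.tsupport_eq]; exact closedBall_subset_ball (by change (a + b) / 2 < b; linarith)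
  set L : E3 → ℝ := fun x => ∑ k, pd (pd ζ k) k x with hL
  have hLc : Continuous L := continuous_finsetSum _ fun k _ =>
    (ts_pd_smooth (ts_pd_smooth hζ k) k).continuous
  have pdz : ∀ (g : E3 → ℝ) k x, x ∉ tsupport g → pd g k x = 0 := by
    intro g k x hx
    have : g =ᶠ[𝓝 x] fun _ => 0 := notMem_tsupport_iff_eventuallyEq.1 hx
    rw [ts_pd_congr this]; simp [pd]
  have pdts : ∀ (g : E3 → ℝ) k, tsupport (pd g k) ⊆ tsupport g := by
    intro g k
    refine closure_minimal (fun x hx => ?_) (isClosed_tsupport g)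
    by_contra h
    exact hx (pdz g k x h)
  have hLz : ∀ x, x ∉ ball (0 : E3) b → L x = 0 := by
    intro x hx
    refine Finset.sum_eq_zero fun k _ => pdz _ _ _ fun h => hx (hts (pdts _ _ h))
  obtain ⟨C, hC⟩ := (isCompact_closedBall (0 : E3) b).exists_bound_of_continuousOn hLc.continuousOn
  refine ⟨(|C| + 1) / 2, by positivity, fun f hf af j => ?_⟩
  have fs := fun k => ts_pd_smooth hf k
  have i0 : ∀ k, Integrable (fun x => ζ x * pd f k x ^ 2) := fun k =>
    (hζ.continuous.mul ((fs k).continuous.pow 2)).integrable_of_hasCompactSupport hζc.mul_right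
  -- step 1
  have s1 : ∫ x in ball (0 : E3) a, (pd f j x) ^ 2 ≤ ∫ x, ζ x * ∑ k, pd f k x ^ 2 := by
    have i1 : Integrable (fun x => ζ x * ∑ k, pd f k x ^ 2) := by
      simp only [Finset.mul_sum]
      exact integrable_finsetSum _ fun k _ => i0 k
    refine le_trans ?_ (setIntegral_le_integral (s := ball (0 : E3) a) i1
      (Eventually.of_forall fun x => mul_nonneg ζ.nonneg (Finset.sum_nonneg fun _ _ => sq_nonneg _)))
    refine setIntegral_mono_on (ts_int_on ((fs j).continuous.pow 2) _) i1.integrableOn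
      measurableSet_ball fun x hx => ?_
    have : ζ x = 1 := ζ.one_of_mem_closedBall (ball_subset_closedBall hx)
    rw [this, one_mul]
    exact Finset.single_le_sum (f := fun k => pd f k x ^ 2) (fun _ _ => sq_nonneg _) (Finset.mem_univ j)
  -- step 2
  have s2 : ∫ x, ζ x * ∑ k, pd f k x ^ 2 = ∫ x, ∑ k, ζ x * pd (fun y => f y * pd f k y) k x := by
    congr 1; ext x
    rw [← Finset.mul_sum]
    by_cases hx : x ∈ tsupport (ζ : E3 → ℝ)
    · congr 1
      have h0 := af x (ball_subset_ball hb1 (hts hx))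
      have : ∀ k, pd (fun y => f y * pd f k y) k x = f x * pd (pd f k) k x + pd f k x ^ 2 := by
        intro k
        rw [ts_pd_mul (ts_sm_diff hf x) (ts_sm_diff (fs k) x)]; ring
      simp only [this, Finset.sum_add_distrib, ← Finset.mul_sum, h0]; simp
    · simp [image_eq_zero_of_notMem_tsupport hx]
  have s3 : ∀ k, ∫ x, ζ x * pd (fun y => f y * pd f k y) k x = (1 / 2) * ∫ x, pd (pd ζ k) k x * f x ^ 2 := by
    intro k
    rw [ts_ibp (hζ.of_le (by simp)) ((hf.mul (fs k)).of_le (by simp)) hζc]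
    have e : ∀ x, pd ζ k x * (f x * pd f k x) = (1 / 2) * (pd ζ k x * pd (fun y => f y ^ 2) k x) := by
      intro x
      have : pd (fun y => f y ^ 2) k x = 2 * (f x * pd f k x) := by
        simp only [sq]
        rw [ts_pd_mul (ts_sm_diff hf x) (ts_sm_diff hf x)]; ring
      rw [this]; ring
    simp only [e]
    rw [integral_const_mul, ts_ibp ((ts_pd_smooth hζ k).of_le (by simp)) ((hf.pow 2).of_le (by simp))
      (ts_pd_supp hζc k)]
    ring
  have s4 : ∫ x, ∑ k, ζ x * pd (fun y => f y * pd f k y) k x = (1 / 2) * ∫ x, L x * f x ^ 2 := by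
    have j1 : ∀ k, Integrable (fun x => ζ x * pd (fun y => f y * pd f k y) k x) := fun k => (hζ.continuous.mul
      (ts_pd_smooth (hf.mul (fs k)) k).continuous).integrable_of_hasCompactSupport hζc.mul_right
    have j2 : ∀ k, Integrable (fun x => pd (pd ζ k) k x * f x ^ 2) := fun k =>
      ((ts_pd_smooth (ts_pd_smooth hζ k) k).continuous.mul
      (hf.continuous.pow 2)).integrable_of_hasCompactSupport
      (ts_pd_supp (ts_pd_supp hζc k) k).mul_right
    rw [integral_finsetSum _ fun k _ => j1 k]
    simp only [s3, ← Finset.mul_sum]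
    rw [← integral_finsetSum _ fun k _ => j2 k]
    simp only [hL, Finset.sum_mul]
  have s5 : ∫ x, L x * f x ^ 2 ≤ (|C| + 1) * ∫ x in ball (0 : E3) b, f x ^ 2 := by
    rw [← setIntegral_eq_integral_of_forall_compl_eq_zero (s := ball (0 : E3) b)
      (fun x hx => by rw [hLz x hx, zero_mul]), ← integral_const_mul]
    refine setIntegral_mono_on (ts_int_on (hLc.mul (hf.continuous.pow 2)) _)
      (ts_int_on (continuous_const.mul (hf.continuous.pow 2)) _) measurableSet_ball fun x hx => ?_
    refine mul_le_mul_of_nonneg_right ?_ (sq_nonneg _)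
    have := hC x (ball_subset_closedBall hx)
    rw [Real.norm_eq_abs] at this
    linarith [le_abs_self (L x), le_abs_self C]
  rw [s2, s4] at s1
  linarith

def tsLap (f : E3 → ℝ) (x : E3) : ℝ := ∑ k, pd (pd f k) k x

lemma ts_lap_smooth {f : E3 → ℝ} (hf : ContDiff ℝ ∞ f) : ContDiff ℝ ∞ (tsLap f) :=
  ContDiff.sum fun k _ => ts_pd_smooth (ts_pd_smooth hf k) k

lemma ts_lap_pd {f : E3 → ℝ} (hf : ContDiff ℝ ∞ f) (i : Fin 3) (x : E3) :
    tsLap (pd f i) x = pd (tsLap f) i x := by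
  have h2 : ∀ {g : E3 → ℝ}, ContDiff ℝ ∞ g → ∀ i j, pd (pd g i) j = pd (pd g j) i := fun hg i j =>
    funext fun y => ts_pd_comm (contDiff_infty.1 hg 2) i j y
  have : pd (tsLap f) i x = ∑ k, pd (pd (pd f k) k) i x :=
    ts_pd_sum (fun k => ts_sm_diff (ts_pd_smooth (ts_pd_smooth hf k) k) x) i
  rw [this]
  refine Finset.sum_congr rfl fun k _ => ?_
  rw [h2 hf i k, h2 (ts_pd_smooth hf k) i k]

lemma ts_pd_add' {f g : E3 → ℝ} (hf : ContDiff ℝ ∞ f) (hg : ContDiff ℝ ∞ g) (k : Fin 3) :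
    pd (fun y => f y + g y) k = fun x => pd f k x + pd g k x :=
  funext fun x => ts_pd_add (ts_sm_diff hf x) (ts_sm_diff hg x) k

lemma ts_pd_const_mul' {f : E3 → ℝ} (hf : ContDiff ℝ ∞ f) (c : ℝ) (k : Fin 3) :
    pd (fun y => c * f y) k = fun x => c * pd f k x :=
  funext fun x => ts_pd_const_mul (ts_sm_diff hf x) c k

lemma ts_lap_add {f g : E3 → ℝ} (hf : ContDiff ℝ ∞ f) (hg : ContDiff ℝ ∞ g) (x : E3) :
    tsLap (fun y => f y + g y) x = tsLap f x + tsLap g x := by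
  simp only [tsLap, ts_pd_add' hf hg, ts_pd_add' (ts_pd_smooth hf _) (ts_pd_smooth hg _),
    Finset.sum_add_distrib]

lemma ts_lap_const_mul {f : E3 → ℝ} (hf : ContDiff ℝ ∞ f) (c : ℝ) (x : E3) :
    tsLap (fun y => c * f y) x = c * tsLap f x := by
  simp only [tsLap, ts_pd_const_mul' hf, ts_pd_const_mul' (ts_pd_smooth hf _), Finset.mul_sum]

lemma ts_lap_coord {g : E3 → ℝ} (hg : ContDiff ℝ ∞ g) (i : Fin 3) (x : E3) :
    tsLap (fun y => y i * g y) x = x i * tsLap g x + 2 * pd g i x := by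
  have e : ∀ k, pd (fun y : E3 => y i * g y) k = fun x => x i * pd g k x + (if i = k then 1 else 0) * g x := by
    intro k; ext y
    rw [ts_pd_mul (ts_sm_diff (ts_coord_smooth i) y) (ts_sm_diff hg y), ts_pd_coord]; ring
  have e2 : ∀ k, pd (pd (fun y : E3 => y i * g y) k) k x
      = x i * pd (pd g k) k x + 2 * ((if i = k then 1 else 0) * pd g k x) := by
    intro k
    have hk := ts_pd_smooth hg k
    rw [e, ts_pd_add' ((ts_coord_smooth i).mul hk) (contDiff_const.mul hg)]
    simp only [ts_pd_const_mul' hg]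
    rw [ts_pd_mul (ts_sm_diff (ts_coord_smooth i) x) (ts_sm_diff hk x), ts_pd_coord]; ring
  unfold tsLap
  simp only [e2, Finset.sum_add_distrib, ← Finset.mul_sum]
  simp

def tsE (v : Fin 3 → E3 → ℝ) (i j : Fin 3) (x : E3) : ℝ := (pd (v i) j x + pd (v j) i x) / 2

def tsQ (v : Fin 3 → E3 → ℝ) (x : E3) : ℝ := ∑ i, ∑ j, tsE v i j x ^ 2

lemma ts_E_smooth {v : Fin 3 → E3 → ℝ} (hv : ∀ i, ContDiff ℝ ∞ (v i)) (i j : Fin 3) :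
    ContDiff ℝ ∞ (tsE v i j) :=
  ((ts_pd_smooth (hv i) j).add (ts_pd_smooth (hv j) i)).div_const 2

lemma ts_E_le_Q (v : Fin 3 → E3 → ℝ) (i j : Fin 3) (x : E3) : tsE v i j x ^ 2 ≤ tsQ v x :=
  le_trans (Finset.single_le_sum (f := fun j => tsE v i j x ^ 2) (fun _ _ => sq_nonneg _) (Finset.mem_univ j))
    (Finset.single_le_sum (f := fun i => ∑ j, tsE v i j x ^ 2)
      (fun _ _ => Finset.sum_nonneg fun _ _ => sq_nonneg _) (Finset.mem_univ i))

lemma ts_Q_nonneg (v : Fin 3 → E3 → ℝ) (x : E3) : 0 ≤ tsQ v x :=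
  Finset.sum_nonneg fun _ _ => Finset.sum_nonneg fun _ _ => sq_nonneg _

def tsP (v : Fin 3 → E3 → ℝ) (x : E3) : ℝ := ∑ k, pd (v k) k x

def tsH (κ : ℝ) (v : Fin 3 → E3 → ℝ) (i j : Fin 3) (x : E3) : ℝ :=
  tsE v i j x + (κ / 4) * (x i * pd (tsP v) j x + x j * pd (tsP v) i x)

section
variable {κ : ℝ} {v : Fin 3 → E3 → ℝ}

lemma ts_P_smooth (hv : ∀ i, ContDiff ℝ ∞ (v i)) : ContDiff ℝ ∞ (tsP v) :=
  ContDiff.sum fun k _ => ts_pd_smooth (hv k) k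

lemma ts_H_smooth (hv : ∀ i, ContDiff ℝ ∞ (v i)) (i j : Fin 3) : ContDiff ℝ ∞ (tsH κ v i j) :=
  (ts_E_smooth hv i j).add (contDiff_const.mul
    (((ts_coord_smooth i).mul (ts_pd_smooth (ts_P_smooth hv) j)).add
      ((ts_coord_smooth j).mul (ts_pd_smooth (ts_P_smooth hv) i))))

lemma ts_lap_dv (hv : ∀ i, ContDiff ℝ ∞ (v i))
    (hL : ∀ x ∈ ball (0 : E3) 1, ∀ i, tsLap (v i) x + κ * pd (tsP v) i x = 0)
    {x : E3} (hx : x ∈ ball (0 : E3) 1) (i j : Fin 3) :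
    tsLap (pd (v i) j) x = -κ * pd (pd (tsP v) i) j x := by
  rw [ts_lap_pd (hv i)]
  have : tsLap (v i) =ᶠ[𝓝 x] fun y => -κ * pd (tsP v) i y := by
    filter_upwards [isOpen_ball.mem_nhds hx] with y hy
    linarith [hL y hy i]
  rw [ts_pd_congr this, ts_pd_const_mul (ts_sm_diff (ts_pd_smooth (ts_P_smooth hv) i) x)]

lemma ts_P_harm (hκ : 1 + κ ≠ 0) (hv : ∀ i, ContDiff ℝ ∞ (v i))
    (hL : ∀ x ∈ ball (0 : E3) 1, ∀ i, tsLap (v i) x + κ * pd (tsP v) i x = 0) : tsHarm (tsP v) := by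
  intro x hx
  change tsLap (tsP v) x = 0
  have h : tsLap (tsP v) x = ∑ k, tsLap (pd (v k) k) x := by
    have s := fun k => ts_pd_smooth (hv k) k
    have e : tsP v = fun y => (pd (v 0) 0 y + pd (v 1) 1 y) + pd (v 2) 2 y := by
      ext y; simp [tsP, Fin.sum_univ_three]
    rw [e, ts_lap_add ((s 0).add (s 1)) (s 2), ts_lap_add (s 0) (s 1), Fin.sum_univ_three]
  simp only [ts_lap_dv hv hL hx, ← Finset.mul_sum] at h
  have h' : tsLap (tsP v) x = -κ * tsLap (tsP v) x := h
  have : (1 + κ) * tsLap (tsP v) x = 0 := by linarith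
  exact (mul_eq_zero.1 this).resolve_left hκ

lemma ts_pd_harm {p : E3 → ℝ} (hp : ContDiff ℝ ∞ p) (h : tsHarm p) (j : Fin 3) : tsHarm (pd p j) := by
  intro x hx
  change tsLap (pd p j) x = 0
  rw [ts_lap_pd hp]
  have : tsLap p =ᶠ[𝓝 x] fun _ => 0 := by
    filter_upwards [isOpen_ball.mem_nhds hx] with y hy using h y hy
  rw [ts_pd_congr this]; simp [pd]

lemma ts_H_harm (hκ : 1 + κ ≠ 0) (hv : ∀ i, ContDiff ℝ ∞ (v i))
    (hL : ∀ x ∈ ball (0 : E3) 1, ∀ i, tsLap (v i) x + κ * pd (tsP v) i x = 0) (i j : Fin 3) :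
    tsHarm (tsH κ v i j) := by
  intro x hx
  change tsLap (tsH κ v i j) x = 0
  have hp := ts_P_smooth hv
  have hP := ts_P_harm hκ hv hL
  have q := fun j => ts_pd_smooth hp j
  have lq : ∀ j, tsLap (pd (tsP v) j) x = 0 := fun j => ts_pd_harm hp hP j x hx
  have e : tsH κ v i j = fun y => (1 / 2) * (pd (v i) j y + pd (v j) i y) +
      (κ / 4) * (y i * pd (tsP v) j y + y j * pd (tsP v) i y) := by
    ext y; simp only [tsH, tsE]; ring
  have s1 := (ts_coord_smooth i).mul (q j)
  have s2 := (ts_coord_smooth j).mul (q i)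
  have t1 := ts_pd_smooth (hv i) j
  have t2 := ts_pd_smooth (hv j) i
  rw [e, ts_lap_add (contDiff_const.mul (t1.add t2)) (contDiff_const.mul (s1.add s2)),
    ts_lap_const_mul (t1.add t2), ts_lap_const_mul (s1.add s2), ts_lap_add t1 t2, ts_lap_add s1 s2,
    ts_lap_coord (q j), ts_lap_coord (q i), lq, lq, ts_lap_dv hv hL hx, ts_lap_dv hv hL hx,
    ts_pd_comm (contDiff_infty.1 hp 2) i j]
  ring

end

lemma ts_mono {f g : E3 → ℝ} (hf : Continuous f) (hg : Continuous g) {r : ℝ}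
    (h : ∀ x ∈ ball (0 : E3) r, f x ≤ g x) : ∫ x in ball (0 : E3) r, f x ≤ ∫ x in ball (0 : E3) r, g x :=
  setIntegral_mono_on (ts_int_on hf r) (ts_int_on hg r) measurableSet_ball h

lemma ts_mono_r {f : E3 → ℝ} (hf : Continuous f) (h0 : ∀ x, 0 ≤ f x) {r s : ℝ} (h : r ≤ s) :
    ∫ x in ball (0 : E3) r, f x ≤ ∫ x in ball (0 : E3) s, f x :=
  setIntegral_mono_set (ts_int_on hf s) (Eventually.of_forall h0)
    (Eventually.of_forall (ball_subset_ball h))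

lemma ts_core_bound {κ r R C : ℝ} {v : Fin 3 → E3 → ℝ} (hv : ∀ i, ContDiff ℝ ∞ (v i))
    (hrR : r ≤ R) (hr1 : r ≤ 1) (hC : 0 ≤ C)
    (hca : ∀ j, ∫ x in ball (0 : E3) r, (pd (tsP v) j x) ^ 2 ≤ C * ∫ x in ball (0 : E3) R, tsP v x ^ 2) :
    (∀ j, ∫ x in ball (0 : E3) r, (pd (tsP v) j x) ^ 2 ≤ 3 * C * ∫ x in ball (0 : E3) R, tsQ v x) ∧
    (∀ i j, ∫ x in ball (0 : E3) r, (tsH κ v i j x) ^ 2 ≤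
      (2 + κ ^ 2 / 4 * (6 * C)) * ∫ x in ball (0 : E3) R, tsQ v x) := by
  have hp := ts_P_smooth hv
  have qc : ∀ j, Continuous (pd (tsP v) j) := fun j => (ts_pd_smooth hp j).continuous
  have Qc : Continuous (tsQ v) := continuous_finsetSum _ fun i _ => continuous_finsetSum _ fun j _ =>
    (ts_E_smooth hv i j).continuous.pow 2
  have h1 : ∫ x in ball (0 : E3) R, tsP v x ^ 2 ≤ 3 * ∫ x in ball (0 : E3) R, tsQ v x := by
    rw [← integral_const_mul]
    have pc := hp.continuous
    refine ts_mono (f := fun x => tsP v x ^ 2) (g := fun x => 3 * tsQ v x) (by fun_prop) (by fun_prop) fun x _ => ?_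
    beta_reduce
    have hP : tsP v x = tsE v 0 0 x + tsE v 1 1 x + tsE v 2 2 x := by
      simp only [tsP, tsE, Fin.sum_univ_three]; ring
    rw [hP]
    simp only [tsQ, Fin.sum_univ_three]
    nlinarith [sq_nonneg (tsE v 0 0 x - tsE v 1 1 x), sq_nonneg (tsE v 0 0 x - tsE v 2 2 x),
      sq_nonneg (tsE v 1 1 x - tsE v 2 2 x), sq_nonneg (tsE v 0 1 x), sq_nonneg (tsE v 0 2 x),
      sq_nonneg (tsE v 1 0 x), sq_nonneg (tsE v 1 2 x), sq_nonneg (tsE v 2 0 x), sq_nonneg (tsE v 2 1 x)]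
  have h2 : ∀ j, ∫ x in ball (0 : E3) r, (pd (tsP v) j x) ^ 2 ≤ 3 * C * ∫ x in ball (0 : E3) R, tsQ v x := by
    intro j
    refine (hca j).trans ((mul_le_mul_of_nonneg_left h1 hC).trans (le_of_eq (by ring)))
  refine ⟨h2, fun i j => ?_⟩
  have h3 : ∫ x in ball (0 : E3) r, (tsH κ v i j x) ^ 2 ≤ ∫ x in ball (0 : E3) r,
      (2 * tsQ v x + (κ ^ 2 / 4) * ((pd (tsP v) j x) ^ 2 + (pd (tsP v) i x) ^ 2)) := by
    have Hc : Continuous (tsH κ v i j) := (ts_H_smooth hv i j).continuous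
    refine ts_mono (f := fun x => tsH κ v i j x ^ 2) (by fun_prop) (by fun_prop) fun x hx => ?_
    beta_reduce
    have hE := ts_E_le_Q v i j x
    have hxn : ∀ i, (x i) ^ 2 ≤ 1 := by
      intro i
      have a1 : ‖x i‖ ≤ ‖x‖ := PiLp.norm_apply_le x i
      rw [mem_ball, dist_zero_right] at hx
      rw [sq_le_one_iff_abs_le_one]
      exact a1.trans (hx.le.trans hr1)
    have b1 : ∀ i j, (x i * pd (tsP v) j x) ^ 2 ≤ (pd (tsP v) j x) ^ 2 := by
      intro i j; rw [mul_pow]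
      nlinarith [hxn i, sq_nonneg (pd (tsP v) j x)]
    have c1 := b1 i j
    have c2 := b1 j i
    unfold tsH
    set A := x i * pd (tsP v) j x
    set B := x j * pd (tsP v) i x
    have d1 : (tsE v i j x + κ / 4 * (A + B)) ^ 2 ≤ 2 * tsE v i j x ^ 2 + κ ^ 2 / 4 * (A ^ 2 + B ^ 2) := by
      have : (A + B) ^ 2 ≤ 2 * (A ^ 2 + B ^ 2) := by nlinarith [sq_nonneg (A - B)]
      nlinarith [sq_nonneg (tsE v i j x - κ / 4 * (A + B)), mul_le_mul_of_nonneg_left this (sq_nonneg κ)]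
    have := mul_le_mul_of_nonneg_left (add_le_add c1 c2) (by positivity : 0 ≤ κ ^ 2 / 4)
    linarith
  have i1 : IntegrableOn (fun x => 2 * tsQ v x) (ball (0 : E3) r) := ts_int_on (by fun_prop) r
  have i2 : ∀ j, IntegrableOn (fun x => pd (tsP v) j x ^ 2) (ball (0 : E3) r) := fun j => ts_int_on ((qc j).pow 2) r
  have i3 : IntegrableOn (fun x => κ ^ 2 / 4 * (pd (tsP v) j x ^ 2 + pd (tsP v) i x ^ 2)) (ball (0 : E3) r) :=
    ts_int_on (by have := qc i; have := qc j; fun_prop) r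
  rw [integral_add i1 i3, integral_const_mul,
    integral_const_mul, integral_add (i2 j) (i2 i)] at h3
  have h4 := ts_mono_r Qc (ts_Q_nonneg v) hrR
  have h5 := mul_le_mul_of_nonneg_left (add_le_add (h2 j) (h2 i)) (by positivity : 0 ≤ κ ^ 2 / 4)
  linarith

lemma ts_core (κ : ℝ) (hκ : 1 + κ ≠ 0) {ρ₁ ρ₂ : ℝ} (h1 : 0 < ρ₁) (h12 : ρ₁ < ρ₂) (h2 : ρ₂ < 1) :
    ∃ c δ : ℝ, 0 < c ∧ 0 < δ ∧ δ < 1 ∧ ∀ v : Fin 3 → E3 → ℝ, (∀ i, ContDiff ℝ ∞ (v i)) →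
      (∀ x ∈ ball (0 : E3) 1, ∀ i, tsLap (v i) x + κ * pd (tsP v) i x = 0) →
      ∫ x in ball (0 : E3) ρ₂, tsQ v x ≤
        c * (∫ x in ball (0 : E3) ρ₁, tsQ v x) ^ δ * (∫ x in ball (0 : E3) 1, tsQ v x) ^ (1 - δ) := by
  obtain ⟨C, δ, hC, hδ0, hδ1, hT⟩ := ts_three_harm (a := ρ₁ / 2) (b := ρ₂) (σ := (1 + ρ₂) / 2)
    (by linarith) (by linarith) (by linarith) (by linarith)
  obtain ⟨C1, hC1, hc1⟩ := ts_cacc (a := ρ₁ / 2) (b := ρ₁) (by linarith) (by linarith) (by linarith)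
  obtain ⟨C3, hC3, hc3⟩ := ts_cacc (a := (1 + ρ₂) / 2) (b := 1) (by linarith) (by linarith) le_rfl
  set M : ℝ := 2 + (κ ^ 2 / 4 * 6 + 3) * (C1 + C3) with hM
  have hMp : 0 < M := by positivity
  refine ⟨(18 + κ ^ 2 / 4 * 18) * (C * M), δ, by positivity, hδ0, hδ1, fun v hv hL => ?_⟩
  have hp := ts_P_smooth hv
  have hP := ts_P_harm hκ hv hL
  have qc : ∀ j, Continuous (pd (tsP v) j) := fun j => (ts_pd_smooth hp j).continuous
  have Hc : ∀ i j, Continuous (tsH κ v i j) := fun i j => (ts_H_smooth hv i j).continuous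
  have Qc : Continuous (tsQ v) := continuous_finsetSum _ fun i _ => continuous_finsetSum _ fun j _ =>
    (ts_E_smooth hv i j).continuous.pow 2
  obtain ⟨a1, a2⟩ := ts_core_bound (κ := κ) (r := ρ₁ / 2) (R := ρ₁) hv (by linarith) (by linarith) hC1.le (hc1 _ hp hP)
  obtain ⟨b1, b2⟩ := ts_core_bound (κ := κ) (r := (1 + ρ₂) / 2) (R := 1) hv (by linarith) (by linarith) hC3.le (hc3 _ hp hP)
  have X1 : 0 ≤ ∫ x in ball (0 : E3) ρ₁, tsQ v x := setIntegral_nonneg measurableSet_ball fun x _ => ts_Q_nonneg v x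
  have X3 : 0 ≤ ∫ x in ball (0 : E3) 1, tsQ v x := setIntegral_nonneg measurableSet_ball fun x _ => ts_Q_nonneg v x
  set Y1 := ∫ x in ball (0 : E3) ρ₁, tsQ v x
  set Y3 := ∫ x in ball (0 : E3) 1, tsQ v x
  have k2 : 0 ≤ κ ^ 2 / 4 := by positivity
  have key : ∀ f : E3 → ℝ, ContDiff ℝ ∞ f → tsHarm f → (∫ x in ball (0 : E3) (ρ₁ / 2), f x ^ 2) ≤ M * Y1 →
      (∫ x in ball (0 : E3) ((1 + ρ₂) / 2), f x ^ 2) ≤ M * Y3 →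
      ∫ x in ball (0 : E3) ρ₂, f x ^ 2 ≤ C * M * (Y1 ^ δ * Y3 ^ (1 - δ)) := by
    intro f hf af e1 e3
    refine (hT f hf af).trans ?_
    have n1 := ts_sq_nonneg f (ρ₁ / 2)
    have n3 := ts_sq_nonneg f ((1 + ρ₂) / 2)
    have g1 := Real.rpow_le_rpow n1 e1 hδ0.le
    have g3 := Real.rpow_le_rpow n3 e3 (by linarith : 0 ≤ 1 - δ)
    have hMM : M = M ^ δ * M ^ (1 - δ) := by
      rw [← Real.rpow_add hMp]; simp
    calc _ ≤ C * (M * Y1) ^ δ * (M * Y3) ^ (1 - δ) := by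
          rw [mul_assoc, mul_assoc]
          exact mul_le_mul_of_nonneg_left (mul_le_mul g1 g3 (by positivity) (by positivity)) hC.le
      _ = C * (M ^ δ * M ^ (1 - δ)) * (Y1 ^ δ * Y3 ^ (1 - δ)) := by
          rw [Real.mul_rpow hMp.le X1, Real.mul_rpow hMp.le X3]; ring
      _ = _ := by rw [← hMM]
  set Z := C * M * (Y1 ^ δ * Y3 ^ (1 - δ)) with hZ
  have kq : ∀ j, ∫ x in ball (0 : E3) ρ₂, (pd (tsP v) j x) ^ 2 ≤ Z := fun j => by
    refine key _ (ts_pd_smooth hp j) (ts_pd_harm hp hP j) ((a1 j).trans ?_) ((b1 j).trans ?_)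
    · exact mul_le_mul_of_nonneg_right (by rw [hM]; nlinarith [mul_nonneg k2 (add_pos hC1 hC3).le]) X1
    · exact mul_le_mul_of_nonneg_right (by rw [hM]; nlinarith [mul_nonneg k2 (add_pos hC1 hC3).le]) X3
  have kh : ∀ i j, ∫ x in ball (0 : E3) ρ₂, (tsH κ v i j x) ^ 2 ≤ Z := fun i j => by
    refine key _ (ts_H_smooth hv i j) (ts_H_harm hκ hv hL i j) ((a2 i j).trans ?_) ((b2 i j).trans ?_)
    · exact mul_le_mul_of_nonneg_right (by rw [hM]; nlinarith [mul_nonneg k2 hC3.le]) X1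
    · exact mul_le_mul_of_nonneg_right (by rw [hM]; nlinarith [mul_nonneg k2 hC1.le]) X3
  have kE : ∀ i j, ∫ x in ball (0 : E3) ρ₂, tsE v i j x ^ 2 ≤ (2 + κ ^ 2 / 4 * 2) * Z := by
    intro i j
    have h3 : ∫ x in ball (0 : E3) ρ₂, (tsE v i j x) ^ 2 ≤ ∫ x in ball (0 : E3) ρ₂,
        (2 * tsH κ v i j x ^ 2 + (κ ^ 2 / 4) * ((pd (tsP v) j x) ^ 2 + (pd (tsP v) i x) ^ 2)) := by
      have Ec := (ts_E_smooth hv i j).continuous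
      refine ts_mono (f := fun x => tsE v i j x ^ 2) (by fun_prop) (by fun_prop) fun x hx => ?_
      beta_reduce
      have hxn : ∀ i, (x i) ^ 2 ≤ 1 := by
        intro i
        have a1 : ‖x i‖ ≤ ‖x‖ := PiLp.norm_apply_le x i
        rw [mem_ball, dist_zero_right] at hx
        rw [sq_le_one_iff_abs_le_one]
        exact a1.trans (hx.le.trans h2.le)
      have b1 : ∀ i j, (x i * pd (tsP v) j x) ^ 2 ≤ (pd (tsP v) j x) ^ 2 := by
        intro i j; rw [mul_pow]
        nlinarith [hxn i, sq_nonneg (pd (tsP v) j x)]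
      have c1 := b1 i j
      have c2 := b1 j i
      have eE : tsE v i j x = tsH κ v i j x - κ / 4 * (x i * pd (tsP v) j x + x j * pd (tsP v) i x) := by
        unfold tsH; ring
      rw [eE]
      set A := x i * pd (tsP v) j x
      set B := x j * pd (tsP v) i x
      have d1 : (tsH κ v i j x - κ / 4 * (A + B)) ^ 2 ≤ 2 * tsH κ v i j x ^ 2 + κ ^ 2 / 4 * (A ^ 2 + B ^ 2) := by
        have : (A + B) ^ 2 ≤ 2 * (A ^ 2 + B ^ 2) := by nlinarith [sq_nonneg (A - B)]
        nlinarith [sq_nonneg (tsH κ v i j x + κ / 4 * (A + B)), mul_le_mul_of_nonneg_left this (sq_nonneg κ)]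
      have := mul_le_mul_of_nonneg_left (add_le_add c1 c2) (by positivity : 0 ≤ κ ^ 2 / 4)
      linarith
    have i1 : IntegrableOn (fun x => 2 * tsH κ v i j x ^ 2) (ball (0 : E3) ρ₂) :=
      ts_int_on (by have := Hc i j; fun_prop) _
    have i2 : ∀ j, IntegrableOn (fun x => pd (tsP v) j x ^ 2) (ball (0 : E3) ρ₂) :=
      fun j => ts_int_on ((qc j).pow 2) _
    have i3 : IntegrableOn (fun x => κ ^ 2 / 4 * (pd (tsP v) j x ^ 2 + pd (tsP v) i x ^ 2)) (ball (0 : E3) ρ₂) :=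
      ts_int_on (by have := qc i; have := qc j; fun_prop) _
    rw [integral_add i1 i3, integral_const_mul, integral_const_mul, integral_add (i2 j) (i2 i)] at h3
    have h5 := mul_le_mul_of_nonneg_left (add_le_add (kq j) (kq i)) (by positivity : 0 ≤ κ ^ 2 / 4)
    have := kh i j
    linarith
  have Ei : ∀ i j, IntegrableOn (fun x => tsE v i j x ^ 2) (ball (0 : E3) ρ₂) := fun i j =>
    ts_int_on ((ts_E_smooth hv i j).continuous.pow 2) _
  calc ∫ x in ball (0 : E3) ρ₂, tsQ v x = ∑ i, ∑ j, ∫ x in ball (0 : E3) ρ₂, tsE v i j x ^ 2 := by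
        unfold tsQ
        rw [integral_finsetSum _ fun i _ => integrable_finsetSum _ fun j _ => Ei i j]
        exact Finset.sum_congr rfl fun i _ => integral_finsetSum _ fun j _ => Ei i j
    _ ≤ ∑ i : Fin 3, ∑ j : Fin 3, (2 + κ ^ 2 / 4 * 2) * Z :=
        Finset.sum_le_sum fun i _ => Finset.sum_le_sum fun j _ => kE i j
    _ = _ := by simp [hZ]; ring

def tsM (φ : ContDiffBump (0 : E3)) (g : E3 → ℝ) : E3 → ℝ :=
  φ.normed volume ⋆[ContinuousLinearMap.lsmul ℝ ℝ, volume] g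

lemma ts_M_int (φ : ContDiffBump (0 : E3)) : LocallyIntegrable (φ.normed volume) (volume : Measure E3) :=
  φ.continuous_normed.locallyIntegrable

lemma ts_M_smooth (φ : ContDiffBump (0 : E3)) {g : E3 → ℝ} (hg : Continuous g) : ContDiff ℝ ∞ (tsM φ g) :=
  HasCompactSupport.contDiff_convolution_left _ φ.hasCompactSupport_normed φ.contDiff_normed
    hg.locallyIntegrable

lemma ts_M_pd (φ : ContDiffBump (0 : E3)) {g : E3 → ℝ} (hg : ContDiff ℝ 1 g) (hc : HasCompactSupport g)
    (k : Fin 3) : pd (tsM φ g) k = tsM φ (pd g k) := by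
  ext x
  have h := HasCompactSupport.hasFDerivAt_convolution_right (ContinuousLinearMap.lsmul ℝ ℝ) hc (ts_M_int φ) hg x
  have h2 := convolution_precompR_apply (ContinuousLinearMap.lsmul ℝ ℝ) (ts_M_int φ) (hc.fderiv ℝ)
    (hg.continuous_fderiv (by simp)) x (EuclideanSpace.single k (1 : ℝ))
  unfold pd tsM
  rw [h.fderiv, h2]

lemma ts_M_ex (φ : ContDiffBump (0 : E3)) {g : E3 → ℝ} (hg : Continuous g) :
    ConvolutionExists (φ.normed volume) g (ContinuousLinearMap.lsmul ℝ ℝ) (volume : Measure E3) :=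
  HasCompactSupport.convolutionExists_left _ φ.hasCompactSupport_normed φ.continuous_normed
    hg.locallyIntegrable

lemma ts_M_add (φ : ContDiffBump (0 : E3)) {f g : E3 → ℝ} (hf : Continuous f) (hg : Continuous g) (x : E3) :
    tsM φ (fun y => f y + g y) x = tsM φ f x + tsM φ g x :=
  congrFun ((ts_M_ex φ hf).distrib_add (ts_M_ex φ hg)) x

lemma ts_M_cmul (φ : ContDiffBump (0 : E3)) (c : ℝ) (f : E3 → ℝ) (x : E3) :
    tsM φ (fun y => c * f y) x = c * tsM φ f x :=
  congrFun (convolution_smul (L := ContinuousLinearMap.lsmul ℝ ℝ) (f := φ.normed volume) (g := f) (y := c)) x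

lemma ts_M_sum (φ : ContDiffBump (0 : E3)) {f : Fin 3 → E3 → ℝ} (hf : ∀ k, Continuous (f k)) (x : E3) :
    tsM φ (fun y => ∑ k, f k y) x = ∑ k, tsM φ (f k) x := by
  simp only [Fin.sum_univ_three]
  rw [ts_M_add φ (f := fun y => f 0 y + f 1 y) ((hf 0).add (hf 1)) (hf 2), ts_M_add φ (hf 0) (hf 1)]

lemma ts_M_bd (φ : ContDiffBump (0 : E3)) {g : E3 → ℝ} (hg : Continuous g) {C : ℝ} (h : ∀ x, |g x| ≤ C)
    (x : E3) : |tsM φ g x| ≤ 3 * C := by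
  have := ContDiffBump.dist_normed_convolution_le (φ := φ) (g := g) (μ := volume) (x₀ := x) (ε := 2 * C)
    hg.aestronglyMeasurable (fun y _ => by
      rw [Real.dist_eq]; exact (abs_sub _ _).trans (by linarith [h x, h y]))
  rw [Real.dist_eq] at this
  change |tsM φ g x - g x| ≤ _ at this
  have h1 := h x
  rw [abs_le] at *
  constructor <;> linarith [this.1, this.2, h1.1, h1.2]

lemma ts_M_lame (φ : ContDiffBump (0 : E3)) {κ R : ℝ} {W : Fin 3 → E3 → ℝ} (hW : ∀ i, ContDiff ℝ 2 (W i))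
    (hc : ∀ i, HasCompactSupport (W i)) (hR : 1 + φ.rOut ≤ R)
    (hL : ∀ x ∈ ball (0 : E3) R, ∀ i, tsLap (W i) x + κ * pd (tsP W) i x = 0) :
    ∀ x ∈ ball (0 : E3) 1, ∀ i, tsLap (tsM φ (W i)) x + κ * pd (tsP fun i => tsM φ (W i)) i x = 0 := by
  intro x hx i
  have h1 : ∀ i, ContDiff ℝ 1 (W i) := fun i => (hW i).of_le (by norm_num)
  have d1 : ∀ i k, ContDiff ℝ 1 (pd (W i) k) := fun i k => ts_pd_contDiff (hW i) (by norm_num) k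
  have c1 : ∀ i k, HasCompactSupport (pd (W i) k) := fun i k => ts_pd_supp (hc i) k
  have c2 : ∀ i k l, Continuous (pd (pd (W i) k) l) := fun i k l => ts_pd_cont (d1 i k) l
  have eL : tsLap (tsM φ (W i)) x = tsM φ (tsLap (W i)) x := by
    have : tsLap (W i) = fun y => ∑ k, pd (pd (W i) k) k y := rfl
    rw [this, ts_M_sum φ (fun k => c2 i k k)]
    unfold tsLap
    simp only [ts_M_pd φ (h1 i) (hc i), ts_M_pd φ (d1 i _) (c1 i _)]
  have hP1 : ContDiff ℝ 1 (tsP W) := ContDiff.sum fun k _ => d1 k k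
  have hPe : tsP W = fun y => pd (W 0) 0 y + pd (W 1) 1 y + pd (W 2) 2 y := by
    ext y; simp [tsP, Fin.sum_univ_three]
  have hPc : HasCompactSupport (tsP W) := by
    rw [hPe]; exact ((c1 0 0).add (c1 1 1)).add (c1 2 2)
  have eP : (tsP fun i => tsM φ (W i)) = tsM φ (tsP W) := by
    ext y
    have : tsP W = fun y => ∑ k, pd (W k) k y := rfl
    rw [this, ts_M_sum φ (fun k => (d1 k k).continuous)]
    unfold tsP
    simp only [ts_M_pd φ (h1 _) (hc _)]
  rw [eL, eP, ts_M_pd φ hP1 hPc, ← ts_M_cmul]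
  have Lc : Continuous (tsLap (W i)) := continuous_finsetSum _ fun k _ => c2 i k k
  have pc := ts_pd_cont hP1 i
  rw [← ts_M_add φ Lc (by fun_prop)]
  have z : ∀ y ∈ ball x φ.rOut, tsLap (W i) y + κ * pd (tsP W) i y = 0 := fun y hy => by
    refine hL y ?_ i
    rw [mem_ball] at *
    linarith [dist_triangle y x 0]
  have z0 := z x (mem_ball_self φ.rOut_pos)
  refine (ContDiffBump.normed_convolution_eq_right (φ := φ) (μ := volume) (x₀ := x)
    (g := fun y => tsLap (W i) y + κ * pd (tsP W) i y) fun y hy => ?_).trans z0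
  beta_reduce
  rw [z y hy, z0]

lemma ts_M_Qlim {W : Fin 3 → E3 → ℝ} (hW : ∀ i, ContDiff ℝ 2 (W i))
    (hc : ∀ i, HasCompactSupport (W i)) {φ : ℕ → ContDiffBump (0 : E3)}
    (hφ : Tendsto (fun n => (φ n).rOut) atTop (𝓝 0)) (r : ℝ) :
    Tendsto (fun n => ∫ x in ball (0 : E3) r, tsQ (fun i => tsM (φ n) (W i)) x) atTop
      (𝓝 (∫ x in ball (0 : E3) r, tsQ W x)) := by
  have h1 : ∀ i, ContDiff ℝ 1 (W i) := fun i => (hW i).of_le (by norm_num)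
  have d0 : ∀ i k, Continuous (pd (W i) k) := fun i k => ts_pd_cont (h1 i) k
  have e : ∀ n i j x, tsE (fun i => tsM (φ n) (W i)) i j x
      = (tsM (φ n) (pd (W i) j) x + tsM (φ n) (pd (W j) i) x) / 2 := by
    intro n i j x
    simp only [tsE, ts_M_pd _ (h1 _) (hc _)]
  have hb : ∀ i k, ∃ C, ∀ x, ‖pd (W i) k x‖ ≤ C := fun i k =>
    (ts_pd_supp (hc i) k).exists_bound_of_continuous (d0 i k)
  choose C hC using hb
  have hC0 : ∀ i k, 0 ≤ C i k := fun i k => (norm_nonneg _).trans (hC i k 0)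
  refine tendsto_integral_of_dominated_convergence
    (fun _ => ∑ i, ∑ j, ((3 * C i j + 3 * C j i) / 2) ^ 2) ?_ ?_ ?_ ?_
  · intro n
    have : Continuous (tsQ fun i => tsM (φ n) (W i)) :=
      continuous_finsetSum _ fun i _ => continuous_finsetSum _ fun j _ =>
        (ts_E_smooth (fun i => ts_M_smooth (φ n) (hW i).continuous) i j).continuous.pow 2
    exact this.aestronglyMeasurable
  · exact integrableOn_const (by exact measure_ball_lt_top.ne)
  · intro n
    refine Eventually.of_forall fun x => ?_
    rw [Real.norm_of_nonneg (ts_Q_nonneg _ _)]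
    refine Finset.sum_le_sum fun i _ => Finset.sum_le_sum fun j _ => ?_
    rw [e]
    have b1 := ts_M_bd (φ n) (d0 i j) (hC i j) x
    have b2 := ts_M_bd (φ n) (d0 j i) (hC j i) x
    rw [← sq_abs]
    gcongr
    rw [abs_div, abs_two]
    gcongr
    exact (abs_add_le _ _).trans (add_le_add b1 b2)
  · refine Eventually.of_forall fun x => ?_
    simp only [tsQ, e]
    refine tendsto_finsetSum _ fun i _ => tendsto_finsetSum _ fun j _ => ?_
    have t : ∀ i j, Tendsto (fun n => tsM (φ n) (pd (W i) j) x) atTop (𝓝 (pd (W i) j x)) := fun i j =>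
      ContDiffBump.convolution_tendsto_right_of_continuous hφ (d0 i j) x
    exact (((t i j).add (t j i)).div_const 2).pow 2

lemma ts_core2 (κ : ℝ) (hκ : 1 + κ ≠ 0) {ρ₁ ρ₂ : ℝ} (h1 : 0 < ρ₁) (h12 : ρ₁ < ρ₂) (h2 : ρ₂ < 1) :
    ∃ c δ : ℝ, 0 < c ∧ 0 < δ ∧ δ < 1 ∧ ∀ v : Fin 3 → E3 → ℝ, ∀ R : ℝ, 1 < R →
      (∀ i, ContDiffOn ℝ 2 (v i) (ball 0 R)) →
      (∀ x ∈ ball (0 : E3) R, ∀ i, tsLap (v i) x + κ * pd (tsP v) i x = 0) →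
      ∫ x in ball (0 : E3) ρ₂, tsQ v x ≤
        c * (∫ x in ball (0 : E3) ρ₁, tsQ v x) ^ δ * (∫ x in ball (0 : E3) 1, tsQ v x) ^ (1 - δ) := by
  obtain ⟨c, δ, hc, hδ0, hδ1, H⟩ := ts_core κ hκ h1 h12 h2
  refine ⟨c, δ, hc, hδ0, hδ1, fun v R hR hv hL => ?_⟩
  let χ : ContDiffBump (0 : E3) := ⟨(2 + R) / 3, (1 + 2 * R) / 3, by linarith, by linarith⟩
  set W : Fin 3 → E3 → ℝ := fun i x => χ x * v i x with hWd
  have hsub : tsupport (χ : E3 → ℝ) ⊆ ball 0 R := by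
    rw [χ.tsupport_eq]
    exact closedBall_subset_ball (by change (1 + 2 * R) / 3 < R; linarith)
  have hWc : ∀ i, HasCompactSupport (W i) := fun i => χ.hasCompactSupport.mul_right
  have hW : ∀ i, ContDiff ℝ 2 (W i) := by
    intro i
    rw [contDiff_iff_contDiffAt]
    intro x
    by_cases hx : x ∈ ball (0 : E3) R
    · exact χ.contDiff.contDiffAt.mul ((hv i).contDiffAt (isOpen_ball.mem_nhds hx))
    · have hx' : x ∉ tsupport (χ : E3 → ℝ) := fun h => hx (hsub h)
      have : W i =ᶠ[𝓝 x] fun _ => 0 := by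
        filter_upwards [notMem_tsupport_iff_eventuallyEq.1 hx'] with y hy
        simp [hWd, hy]
      exact contDiffAt_const.congr_of_eventuallyEq this
  have hWv : ∀ i, ∀ x ∈ ball (0 : E3) ((2 + R) / 3), W i x = v i x := by
    intro i x hx
    have : χ x = 1 := χ.one_of_mem_closedBall (ball_subset_closedBall hx)
    simp [hWd, this]
  have hpd : ∀ {f g : E3 → ℝ}, (∀ x ∈ ball (0 : E3) ((2 + R) / 3), f x = g x) → ∀ k,
      ∀ x ∈ ball (0 : E3) ((2 + R) / 3), pd f k x = pd g k x := by
    intro f g h k x hx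
    refine ts_pd_congr ?_ k
    filter_upwards [isOpen_ball.mem_nhds hx] with y hy using h y hy
  have hWL : ∀ x ∈ ball (0 : E3) ((2 + R) / 3), ∀ i, tsLap (W i) x + κ * pd (tsP W) i x = 0 := by
    intro x hx i
    rw [← hL x (ball_subset_ball (by linarith) hx) i]
    congr 1
    · exact Finset.sum_congr rfl fun k _ => hpd (hpd (hWv i) k) k x hx
    · congr 1
      exact hpd (fun y hy => Finset.sum_congr rfl fun k _ => hpd (hWv k) k y hy) i x hx
  have hQ : ∀ r ≤ (1 : ℝ), ∫ x in ball (0 : E3) r, tsQ v x = ∫ x in ball (0 : E3) r, tsQ W x := by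
    intro r hr
    refine setIntegral_congr_fun measurableSet_ball fun x hx => ?_
    have hx' : x ∈ ball (0 : E3) ((2 + R) / 3) := ball_subset_ball (by linarith) hx
    simp only [tsQ, tsE, hpd (hWv _) _ x hx']
  let ψ : ℕ → ContDiffBump (0 : E3) := fun n =>
    ⟨(R - 1) / 6 * (1 / ((n : ℝ) + 1)), (R - 1) / 3 * (1 / ((n : ℝ) + 1)),
      mul_pos (by linarith) (by positivity), mul_lt_mul_of_pos_right (by linarith) (by positivity)⟩
  have hψ : Tendsto (fun n => (ψ n).rOut) atTop (𝓝 0) := by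
    have := (tendsto_one_div_add_atTop_nhds_zero_nat (𝕜 := ℝ)).const_mul ((R - 1) / 3)
    rwa [mul_zero] at this
  have hψ2 : ∀ n, 1 + (ψ n).rOut ≤ (2 + R) / 3 := by
    intro n
    change 1 + (R - 1) / 3 * (1 / ((n : ℝ) + 1)) ≤ _
    have : 1 / ((n : ℝ) + 1) ≤ 1 := by
      rw [div_le_one (by positivity)]; linarith [(Nat.cast_nonneg n : (0 : ℝ) ≤ n)]
    nlinarith
  have lim := ts_M_Qlim hW hWc hψ
  have ineq := fun n => H (fun i => tsM (ψ n) (W i)) (fun i => ts_M_smooth (ψ n) (hW i).continuous)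
    (ts_M_lame (ψ n) hW hWc (hψ2 n) hWL)
  rw [hQ ρ₂ h2.le, hQ ρ₁ (by linarith), hQ 1 le_rfl]
  refine le_of_tendsto_of_tendsto' (lim ρ₂) ?_ ineq
  exact (((lim ρ₁).rpow_const (Or.inr hδ0.le)).const_mul c).mul
    ((lim 1).rpow_const (Or.inr (by linarith)))

lemma ts_ball_trans (g : E3 → ℝ) (x : E3) (s : ℝ) :
    ∫ z in ball (0 : E3) s, g (x + z) = ∫ y in ball x s, g y := by
  have := (measurePreserving_add_left (volume : Measure E3) x).setIntegral_preimage_emb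
    (measurableEmbedding_addLeft x) g (ball x s)
  rw [← this]
  congr 2
  ext z; simp [mem_ball, dist_eq_norm]

lemma ts_ball_aff (g : E3 → ℝ) (x : E3) {r : ℝ} (hr : 0 < r) (ρ : ℝ) :
    ∫ y in ball x (ρ * r), g y = r ^ 3 * ∫ y in ball (0 : E3) ρ, g (x + r • y) := by
  rw [ts_ball_scale (fun z => g (x + z)) hr ρ, ts_ball_trans, mul_comm ρ r, ← mul_assoc,
    mul_inv_cancel₀ (by positivity), one_mul]

lemma ts_ball_sub {Ω : Set E3} (hΩ : IsOpen Ω) {x : E3} (hx : x ∈ Ω) {R : ℝ}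
    (hR : R ≤ Metric.infDist x (frontier Ω)) : ball x R ⊆ Ω := by
  intro y hy
  have hR0 : 0 < R := pos_of_mem_ball hy
  have hd : Disjoint (ball x R) (frontier Ω) :=
    disjoint_ball_infDist.mono_left (ball_subset_ball hR)
  have hpre : IsPreconnected (ball x R) := (convex_ball x R).isPreconnected
  by_contra hyΩ
  have hcl : ∀ z ∈ ball x R, z ∉ Ω → z ∈ (closure Ω)ᶜ := by
    intro z hz hzΩ hzc
    exact Set.disjoint_left.1 hd hz ⟨hzc, by rwa [hΩ.interior_eq]⟩
  obtain ⟨z, _, hz1, hz2⟩ := hpre Ω (closure Ω)ᶜ hΩ isClosed_closure.isOpen_compl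
    (fun z hz => (em (z ∈ Ω)).imp_right (hcl z hz)) ⟨x, mem_ball_self hR0, hx⟩ ⟨y, hy, hcl y hy hyΩ⟩
  exact hz2 (subset_closure hz1)

lemma ts_final {lam mu : ℝ} (hmu : 0 < mu) {c δ ρ₁ ρ₂ : ℝ} (h1'' : ρ₁ ≤ 1) (h2' : ρ₂ ≤ 1)
    (H : ∀ v : Fin 3 → E3 → ℝ, ∀ R : ℝ, 1 < R →
      (∀ i, ContDiffOn ℝ 2 (v i) (ball 0 R)) →
      (∀ x ∈ ball (0 : E3) R, ∀ i, tsLap (v i) x + ((lam + mu) / mu) * pd (tsP v) i x = 0) →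
      ∫ x in ball (0 : E3) ρ₂, tsQ v x ≤
        c * (∫ x in ball (0 : E3) ρ₁, tsQ v x) ^ δ * (∫ x in ball (0 : E3) 1, tsQ v x) ^ (1 - δ))
    {w : E3 → E3} {x : E3} {R r : ℝ} (hr : 0 < r) (hrR : r < R) (hw : ContDiffOn ℝ 2 w (ball x R))
    (hL : ∀ y ∈ ball x R, ∀ i : Fin 3,
          mu * tsLap (fun z => w z i) y + (lam + mu) * pd (tsP fun k z => w z k) i y = 0) :
    (∫ y in Metric.ball x (ρ₂ * r), frob2 (strain w y)) ≤
          c * (∫ y in Metric.ball x (ρ₁ * r), frob2 (strain w y)) ^ δ *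
            (∫ y in Metric.ball x r, frob2 (strain w y)) ^ (1 - δ) := by
  set V : Fin 3 → E3 → ℝ := fun i z => w z i with hV
  have hVc : ∀ i, ContDiffOn ℝ 2 (V i) (ball x R) := fun i =>
    (contDiff_euclidean.1 (contDiff_id (𝕜 := ℝ) (n := 2) (E := E3)) i).comp_contDiffOn hw
  have hVa : ∀ i, ∀ y ∈ ball x R, ContDiffAt ℝ 2 (V i) y := fun i y hy =>
    (hVc i).contDiffAt (isOpen_ball.mem_nhds hy)
  have hVd : ∀ i, ∀ y ∈ ball x R, DifferentiableAt ℝ (V i) y := fun i y hy =>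
    (hVa i y hy).differentiableAt (by norm_num)
  have hVdd : ∀ i k, ∀ y ∈ ball x R, DifferentiableAt ℝ (pd (V i) k) y := fun i k y hy =>
    (((hVa i y hy).fderiv_right (m := 1) (by norm_num)).clm_apply contDiffAt_const).differentiableAt (by norm_num)
  set v : Fin 3 → E3 → ℝ := fun i y => V i (x + r • y) with hv
  have hmem : ∀ y ∈ ball (0 : E3) (R / r), x + r • y ∈ ball x R := by
    intro y hy
    rw [mem_ball, dist_zero_right, lt_div_iff₀ hr] at hy
    rw [mem_ball, dist_eq_norm, add_sub_cancel_left, norm_smul, Real.norm_of_nonneg hr.le]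
    linarith
  have h1 : ∀ i k, ∀ y ∈ ball (0 : E3) (R / r), pd (v i) k y = r * pd (V i) k (x + r • y) := fun i k y hy =>
    ts_pd_aff x r (hVd i _ (hmem y hy)) k
  have h1' : ∀ {f g : E3 → ℝ}, (∀ y ∈ ball (0 : E3) (R / r), f y = g y) → ∀ k,
      ∀ y ∈ ball (0 : E3) (R / r), pd f k y = pd g k y := by
    intro f g h k y hy
    refine ts_pd_congr ?_ k
    filter_upwards [isOpen_ball.mem_nhds hy] with z hz using h z hz
  have haff : ∀ y, DifferentiableAt ℝ (fun y : E3 => x + r • y) y := fun y => by fun_prop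
  have h2 : ∀ i k l, ∀ y ∈ ball (0 : E3) (R / r), pd (pd (v i) k) l y = r ^ 2 * pd (pd (V i) k) l (x + r • y) := by
    intro i k l y hy
    rw [h1' (h1 i k) l y hy, ts_pd_const_mul, ts_pd_aff x r (hVdd i k _ (hmem y hy))]
    · ring
    · exact DifferentiableAt.comp (g := pd (V i) k) y (hVdd i k _ (hmem y hy)) (haff y)
  have hr1 : 1 < R / r := by rwa [one_lt_div hr]
  have key := H v (R / r) hr1 ?_ ?_
  · have hQ : ∀ ρ ≤ (1 : ℝ), ∫ y in ball x (ρ * r), frob2 (strain w y)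
        = r * ∫ y in ball (0 : E3) ρ, tsQ v y := by
      intro ρ hρ
      rw [ts_ball_aff _ x hr]
      have : ∫ y in ball (0 : E3) ρ, tsQ v y =
          ∫ y in ball (0 : E3) ρ, r ^ 2 * frob2 (strain w (x + r • y)) := by
        refine setIntegral_congr_fun measurableSet_ball fun y hy => ?_
        have hy' : y ∈ ball (0 : E3) (R / r) := ball_subset_ball (by linarith) hy
        have hj : ∀ i j, jac w (x + r • y) i j = pd (V i) j (x + r • y) := by
          intro i j
          have hwd : DifferentiableAt ℝ w (x + r • y) :=
            (hw.contDiffAt (isOpen_ball.mem_nhds (hmem y hy'))).differentiableAt (by norm_num)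
          have := ((EuclideanSpace.proj (𝕜 := ℝ) i).hasFDerivAt.comp (x + r • y) hwd.hasFDerivAt).fderiv
          simp only [jac, pd, hV]
          change _ = fderiv ℝ ((EuclideanSpace.proj (𝕜 := ℝ) i) ∘ w) (x + r • y) _
          rw [this]; rfl
        simp only [tsQ, tsE, frob2, strain, hj, h1 _ _ y hy', Finset.mul_sum]
        exact Finset.sum_congr rfl fun i _ => Finset.sum_congr rfl fun j _ => by ring
      rw [this, integral_const_mul]
      ring
    have q3 := hQ 1 le_rfl
    rw [one_mul] at q3
    rw [hQ ρ₂ h2', hQ ρ₁ h1'', q3]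
    have n : ∀ s, 0 ≤ ∫ y in ball (0 : E3) s, tsQ v y := fun s =>
      setIntegral_nonneg measurableSet_ball fun y _ => ts_Q_nonneg v y
    rw [Real.mul_rpow hr.le (n _), Real.mul_rpow hr.le (n _)]
    have hrr : r = r ^ δ * r ^ (1 - δ) := by
      rw [← Real.rpow_add hr]; simp
    have := mul_le_mul_of_nonneg_left key hr.le
    refine this.trans (le_of_eq ?_)
    nth_rewrite 1 [hrr]
    ring
  · intro i
    refine (hVc i).comp (t := ball x R) ?_ hmem
    have : ContDiff ℝ 2 (fun y : E3 => x + r • y) := by fun_prop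
    exact this.contDiffOn
  · intro y hy i
    have e1 : tsLap (v i) y = r ^ 2 * tsLap (V i) (x + r • y) := by
      simp only [tsLap, h2 i _ _ y hy, Finset.mul_sum]
    have e2 : pd (tsP v) i y = r ^ 2 * pd (tsP V) i (x + r • y) := by
      have hPd : DifferentiableAt ℝ (tsP V) (x + r • y) :=
        DifferentiableAt.fun_sum fun k _ => hVdd k k _ (hmem y hy)
      have : ∀ z ∈ ball (0 : E3) (R / r), tsP v z = r * tsP V (x + r • z) := by
        intro z hz
        simp only [tsP, h1 _ _ z hz, Finset.mul_sum]
      rw [h1' this i y hy, ts_pd_const_mul, ts_pd_aff x r hPd]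
      · ring
      · exact DifferentiableAt.comp (g := tsP V) y hPd (haff y)
    have h0 : mu * tsLap (V i) (x + r • y) + (lam + mu) * pd (tsP V) i (x + r • y) = 0 :=
      hL _ (hmem y hy) i
    rw [e1, e2]
    field_simp
    linear_combination r ^ 2 * h0

end TsHelpers

/-- Three spheres inequality for solutions of the homogeneous Lamé system. -/
theorem three_spheres_inequality (lam mu : ℝ) (hmu : 0 < mu) (hlam : 0 < 3*lam + 2*mu) :
    ∃ θ : ℝ, 0 < θ ∧ θ ≤ 1 ∧
      ∀ ρ₁ ρ₂ : ℝ, 0 < ρ₁ → ρ₁ < ρ₂ → ρ₂ < 1 →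
      ∃ c δ : ℝ, 0 < c ∧ 0 < δ ∧ δ < 1 ∧
        ∀ Ω : Set E3, IsOpen Ω → Bornology.IsBounded Ω →
        ∀ w : E3 → E3, ContDiffOn ℝ 2 w Ω →
        (∀ x ∈ Ω, ∀ i : Fin 3,
          mu * (∑ k, pd (fun y => pd (fun z => w z i) k y) k x)
            + (lam + mu) * pd (fun y => ∑ k, pd (fun z => w z k) k y) i x = 0) →
        ∀ rbar r₃ : ℝ, 0 < rbar → 0 < r₃ → r₃ ≤ θ * rbar →
        ∀ x ∈ Ω, rbar < Metric.infDist x (frontier Ω) →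
        (∫ y in Metric.ball x (ρ₂ * r₃), frob2 (strain w y)) ≤
          c * (∫ y in Metric.ball x (ρ₁ * r₃), frob2 (strain w y)) ^ δ *
            (∫ y in Metric.ball x r₃, frob2 (strain w y)) ^ (1 - δ) := by
  refine ⟨1, one_pos, le_rfl, fun ρ₁ ρ₂ h1 h12 h2 => ?_⟩
  have hκ : 1 + (lam + mu) / mu ≠ 0 := by
    have : 1 + (lam + mu) / mu = (lam + 2 * mu) / mu := by field_simp; ring
    rw [this]
    have : 0 < lam + 2 * mu := by linarith
    positivity
  obtain ⟨c, δ, hc, hδ0, hδ1, H⟩ := ts_core2 _ hκ h1 h12 h2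
  refine ⟨c, δ, hc, hδ0, hδ1, fun Ω hΩ _ w hw hL rbar r₃ _ hr hrr x hx hxd => ?_⟩
  have hsub := ts_ball_sub hΩ hx le_rfl
  exact ts_final hmu (by linarith) h2.le H hr (by linarith : r₃ < Metric.infDist x (frontier Ω))
    (hw.mono hsub) fun y hy i => hL y (hsub hy) i

end
end
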